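/- Let (R,m) be a Noetherian local ring of dimension d such that R̂ is reduced and equidimensional, and let B be a balanced big Cohen–Macaulay R-algebra satisfying condition (†). If e₁^B(Q) = e₁(Q) for some parameter ideal Q ⊆ R, then R is BCM_B-rational. In particular, if R is excellent of prime characteristic p > 0 with R̂ reduced and equidimensional, and e₁*(Q) = e₁(Q) for some parameter ideal Q, then R is F-rational. -/

import Mathlib

open IsLocalRing

universe u

section BasicDefs

variable (R : Type*) [CommRing R]

/-- The length of a module, i.e. the Krull dimension of its lattice of submodules. -/
noncomputable def moduleLength (M : Type*) [AddCommGroup M] [Module R M] : WithBot ℕ∞ :=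
  Order.krullDim (Submodule R M)

/-- A system of parameters of a Noetherian local ring: `d` elements generating an
ideal whose radical is the maximal ideal, where `d` is the Krull dimension. -/
def IsSOP [IsLocalRing R] {d : ℕ} (x : Fin d → R) : Prop :=
  ringKrullDim R = (d : WithBot ℕ∞) ∧
    (Ideal.span (Set.range x)).radical = maximalIdeal R

/-- A parameter ideal is an ideal generated by a system of parameters. -/
def IsParameterIdeal [IsLocalRing R] (Q : Ideal R) : Prop :=
  ∃ (d : ℕ) (x : Fin d → R), IsSOP R x ∧ Q = Ideal.span (Set.range x)

/-- `f : R →+* B` makes `B` a balanced big Cohen-Macaulay `R`-algebra if every system of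
parameters of `R` maps to a regular sequence on `B` and `m·B ≠ B`. -/
def IsBalancedBigCMHom [IsLocalRing R] {B : Type*} [CommRing B] (f : R →+* B) : Prop :=
  (∀ (d : ℕ) (x : Fin d → R), IsSOP R x →
      RingTheory.Sequence.IsRegular B (List.ofFn fun i => f (x i))) ∧
    (maximalIdeal R).map f ≠ ⊤

/-- A balanced big Cohen-Macaulay algebra. -/
def IsBalancedBigCM [IsLocalRing R] (B : Type*) [CommRing B] [Algebra R B] : Prop :=
  IsBalancedBigCMHom R (algebraMap R B)

/-- The integral closure of an ideal `I`, as a set: all `x` satisfying an equation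
`x^n + a₁ x^{n-1} + ⋯ + aₙ = 0` with `aₖ ∈ I^k`. -/
def intClSet (I : Ideal R) : Set R :=
  { x | ∃ n : ℕ, 0 < n ∧ ∃ a : ℕ → R,
      (∀ k ∈ Finset.Icc 1 n, a k ∈ I ^ k) ∧
      x ^ n + ∑ k ∈ Finset.Icc 1 n, a k * x ^ (n - k) = 0 }

/-- `I^B := IB ∩ R`, the contraction of the extension of `I` along `f : R →+* B`. -/
def contractedExt {B : Type*} [CommRing B] (f : R →+* B) (I : Ideal R) : Ideal R :=
  (I.map f).comap f

/-- Condition (†): `I^B ⊆ \bar I` for every m-primary ideal `I`. -/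
def SatisfiesDagger [IsLocalRing R] {B : Type*} [CommRing B] (f : R →+* B) : Prop :=
  ∀ I : Ideal R, I.radical = maximalIdeal R →
    (contractedExt R f I : Set R) ⊆ intClSet R I

/-- `e` is the family of Hilbert coefficients of the filtration `J` (in dimension `d`):
for `n ≫ 0`, `ℓ(R/J (n+1)) = ∑_{i≤d} (-1)^i e i * choose (n+d-i) (d-i)`. -/
def HasHilbertSeries (d : ℕ) (J : ℕ → Ideal R) (e : ℕ → ℤ) : Prop :=
  ∃ N : ℕ, ∀ n ≥ N, ∃ m : ℕ,
    moduleLength R (R ⧸ J (n + 1)) = (m : WithBot ℕ∞) ∧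
    (m : ℤ) = ∑ i ∈ Finset.range (d + 1),
      (-1) ^ i * e i * ((n + d - i).choose (d - i) : ℤ)

/-- Module version of `HasHilbertSeries`, for the `J`-adic filtration of a module `M`. -/
def HasHilbertSeriesMod (M : Type*) [AddCommGroup M] [Module R M] (d : ℕ)
    (J : Ideal R) (e : ℕ → ℤ) : Prop :=
  ∃ N : ℕ, ∀ n ≥ N, ∃ m : ℕ,
    moduleLength R (M ⧸ (J ^ (n + 1) • (⊤ : Submodule R M))) = (m : WithBot ℕ∞) ∧
    (m : ℤ) = ∑ i ∈ Finset.range (d + 1),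
      (-1) ^ i * e i * ((n + d - i).choose (d - i) : ℤ)


/-- The limit closure `(x₁,…,x_d)^{lim} = ⋃ₜ ((x₁^{t+1},…,x_d^{t+1}) : (x₁⋯x_d)^t)`. -/
def limitClosure {d : ℕ} (x : Fin d → R) : Ideal R :=
  ⨆ t : ℕ, (Ideal.span (Set.range fun i => x i ^ (t + 1))).colon
    (Ideal.span {(∏ i, x i) ^ t})

/-- A ring is equidimensional if `dim (R/P) = dim R` for every minimal prime `P`. -/
def IsEquidimensional : Prop :=
  ∀ P ∈ minimalPrimes R, ringKrullDim (R ⧸ P) = ringKrullDim R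

/-- Depth at least `n`: there is a regular sequence of length `n` in the
(Jacobson) radical, i.e. in the maximal ideal when `R` is local. -/
def HasDepthGE (n : ℕ) : Prop :=
  ∃ rs : List R, rs.length = n ∧ (∀ r ∈ rs, r ∈ (⊥ : Ideal R).jacobson) ∧
    RingTheory.Sequence.IsRegular R rs

/-- A Cohen-Macaulay (Noetherian) local ring: depth = dimension. -/
def IsCohenMacaulayLocalRing : Prop :=
  IsLocalRing R ∧ IsNoetherianRing R ∧
    ∃ d : ℕ, ringKrullDim R = (d : WithBot ℕ∞) ∧ HasDepthGE R d

/-- Serre's condition S₂: for every prime `P`,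
`depth R_P ≥ min 2 (dim R_P)`. -/
def SerreS2 : Prop :=
  ∀ (P : Ideal R) (hP : P.IsPrime) (n : ℕ),
    (n : WithBot ℕ∞) ≤ min 2 (ringKrullDim (Localization.AtPrime P)) →
    HasDepthGE (Localization.AtPrime P) n

/-- A regular local ring: a Noetherian local ring whose maximal ideal is generated
by `dim R` elements. -/
def IsRegularLocal : Prop :=
  IsLocalRing R ∧ IsNoetherianRing R ∧ ∃ (d : ℕ) (x : Fin d → R),
    ringKrullDim R = (d : WithBot ℕ∞) ∧
      Ideal.span (Set.range x) = (⊥ : Ideal R).jacobson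

/-- A regular (not necessarily local) ring: Noetherian and all localizations at
primes are regular local rings. -/
def IsRegularRing_stmt14 : Prop :=
  IsNoetherianRing R ∧
    ∀ (P : Ideal R) (hP : P.IsPrime), IsRegularLocal (Localization.AtPrime P)

/-- The tight closure of an ideal `I` in characteristic `p`, as a set. -/
def tightClSet (p : ℕ) (I : Ideal R) : Set R :=
  { x | ∃ c : R, (∀ P ∈ minimalPrimes R, c ∉ P) ∧
      ∃ E : ℕ, ∀ e ≥ E, c * x ^ p ^ e ∈ Ideal.span ((fun a => a ^ p ^ e) '' (I : Set R)) }

/-- F-rationality: every parameter ideal is tightly closed. -/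
def IsFRational [IsLocalRing R] (p : ℕ) : Prop :=
  ∀ Q : Ideal R, IsParameterIdeal R Q → tightClSet R p Q ⊆ (Q : Set R)

end BasicDefs

section Excellence

open TensorProduct

/-- Geometrically regular `k`-algebra (for `k` a field): `L ⊗[k] A` is regular
for every finite field extension `L` of `k`. -/
def IsGeometricallyRegular (k : Type u) (A : Type u) [CommRing k] [CommRing A]
    [Algebra k A] : Prop :=
  ∀ (L : Type u) [Field L] [Algebra k L], Module.Finite k L → IsRegularRing_stmt14 (L ⊗[k] A)

/-- `R` is a G-ring: for every prime `p`, the fibers of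
`R_p → (R_p)^∧` are geometrically regular. -/
def IsGRing (R : Type u) [CommRing R] : Prop :=
  ∀ (p : Ideal R) (hp : p.IsPrime) (q : Ideal (Localization.AtPrime p)) (hq : q.IsPrime),
    IsGeometricallyRegular
      (ResidueField (Localization.AtPrime q))
      ((ResidueField (Localization.AtPrime q))
        ⊗[Localization.AtPrime p]
        AdicCompletion (maximalIdeal (Localization.AtPrime p)) (Localization.AtPrime p))

/-- `R` is J-2: the regular locus of every finitely generated `R`-algebra is open. -/
def IsJ2 (R : Type u) [CommRing R] : Prop :=
  ∀ (A : Type u) [CommRing A] [Algebra R A], Algebra.FiniteType R A →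
    IsOpen { P : PrimeSpectrum A | IsRegularLocal (Localization.AtPrime P.asIdeal) }

/-- A catenary ring: any two saturated chains of primes with the same endpoints
have the same length. -/
def IsCatenary (A : Type*) [CommRing A] : Prop :=
  ∀ c₁ c₂ : LTSeries (PrimeSpectrum A),
    c₁.head = c₂.head → c₁.last = c₂.last →
    (∀ i : Fin c₁.length, c₁.toFun i.castSucc ⋖ c₁.toFun i.succ) →
    (∀ i : Fin c₂.length, c₂.toFun i.castSucc ⋖ c₂.toFun i.succ) →
    c₁.length = c₂.length

/-- Universally catenary: every finitely generated `R`-algebra is catenary. -/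
def IsUniversallyCatenary (R : Type u) [CommRing R] : Prop :=
  ∀ (A : Type u) [CommRing A] [Algebra R A], Algebra.FiniteType R A → IsCatenary A

/-- An excellent ring: Noetherian, a G-ring, J-2 and universally catenary. -/
def IsExcellentRing (R : Type u) [CommRing R] : Prop :=
  IsNoetherianRing R ∧ IsGRing R ∧ IsJ2 R ∧ IsUniversallyCatenary R

end Excellence

/-- `R` is BCM_B-rational (in dimension `d`): Cohen-Macaulay and the natural map
`H^d_m(R) → H^d_m(B)` is injective. -/
def IsBCMRational (R : Type u) [CommRing R] [IsLocalRing R]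
    (B : Type u) [CommRing B] [Algebra R B] (d : ℕ) : Prop :=
  IsCohenMacaulayLocalRing R ∧
    Function.Injective
      ((localCohomology (maximalIdeal R) d).map (ModuleCat.ofHom (Algebra.linearMap R B)))

section Piece01

/-- Monomials in a family of elements. -/
def mon {d : ℕ} {R : Type*} [CommRing R] (x : Fin d → R) (α : Fin d → ℕ) : R := ∏ j, x j ^ α j

/-- Exponents of degree `n`. -/
abbrev Dg (d n : ℕ) : Finset (Fin d → ℕ) := Finset.piAntidiag (Finset.univ : Finset (Fin d)) n

theorem mem_Dg {d n : ℕ} {α : Fin d → ℕ} : α ∈ Dg d n ↔ ∑ j, α j = n := by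
  simp [Dg]

theorem mon_add {d : ℕ} {R : Type*} [CommRing R] (x : Fin d → R) (α β : Fin d → ℕ) :
    mon x (α + β) = mon x α * mon x β := by
  simp [mon, pow_add, Finset.prod_mul_distrib]

theorem Dg_add {d n m : ℕ} {α β : Fin d → ℕ} (h : α ∈ Dg d n) (h' : β ∈ Dg d m) :
    α + β ∈ Dg d (n + m) := by
  rw [mem_Dg] at *
  simp [Finset.sum_add_distrib, h, h']

theorem pow_span_eq_exists {d : ℕ} {R : Type*} [CommRing R] (x : Fin d → R) (n : ℕ) {z : R}
    (hz : z ∈ Ideal.span (Set.range x) ^ n) :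
    ∃ c : (Fin d → ℕ) → R, z = ∑ α ∈ Dg d n, mon x α * c α := by
  classical
  rw [Ideal.mem_span_pow_iff_exists_isHomogeneous] at hz
  obtain ⟨p, hp, rfl⟩ := hz
  refine ⟨fun α => p.coeff (Finsupp.equivFunOnFinite.symm α), ?_⟩
  rw [MvPolynomial.eval_eq']
  have h1 : ∀ a ∈ p.support, (a : Fin d → ℕ) ∈ Dg d n := by
    intro a ha
    have := hp (MvPolynomial.mem_support_iff.1 ha)
    rw [mem_Dg, ← this]
    simp [Finsupp.weight_apply, Finsupp.sum_fintype]
  rw [← Finset.sum_subset (s₁ := p.support.image (fun a : Fin d →₀ ℕ => (a : Fin d → ℕ)))]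
  · rw [Finset.sum_image (by intro a _ b _ h; exact DFunLike.coe_injective h)]
    refine Finset.sum_congr rfl fun a _ => ?_
    rw [mul_comm, mon]
    congr 2
    ext; simp
  · intro a ha
    obtain ⟨b, hb, rfl⟩ := Finset.mem_image.1 ha
    exact h1 b hb
  · intro a _ ha
    have : Finsupp.equivFunOnFinite.symm a ∉ p.support := by
      intro h
      exact ha (Finset.mem_image.2 ⟨_, h, by simp⟩)
    simp [MvPolynomial.notMem_support_iff.1 this]

theorem mon_mem_pow {d : ℕ} {R : Type*} [CommRing R] (x : Fin d → R) {n : ℕ} {α : Fin d → ℕ}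
    (h : α ∈ Dg d n) : mon x α ∈ Ideal.span (Set.range x) ^ n := by
  rw [mem_Dg] at h
  rw [← h, ← Finset.prod_pow_eq_pow_sum]
  exact Ideal.prod_mem_prod fun i _ => Ideal.pow_mem_pow (Ideal.subset_span (Set.mem_range_self i)) _

/-- The regularity property of a family: powers of the elements form
regular sequences in any order. -/
def REG {d : ℕ} {B : Type*} [CommRing B] (y : Fin d → B) : Prop :=
  ∀ (i : Fin d) (s : Fin d → ℕ) (b : B),
    y i * b ∈ Ideal.span {z | ∃ j, j ≠ i ∧ z = y j ^ s j} →
      b ∈ Ideal.span {z | ∃ j, j ≠ i ∧ z = y j ^ s j}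

theorem REG.pow {d : ℕ} {B : Type*} [CommRing B] {y : Fin d → B} (h : REG y)
    (i : Fin d) (s : Fin d → ℕ) (n : ℕ) (b : B)
    (hb : y i ^ n * b ∈ Ideal.span {z | ∃ j, j ≠ i ∧ z = y j ^ s j}) :
    b ∈ Ideal.span {z | ∃ j, j ≠ i ∧ z = y j ^ s j} := by
  induction n generalizing b with
  | zero => simpa using hb
  | succ n ih =>
    apply ih
    apply h
    rwa [← mul_assoc, ← pow_succ']

theorem span_update {d : ℕ} {B : Type*} [CommRing B] (y : Fin d → B) (s : Fin d → ℕ) (i : Fin d)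
    (t : ℕ) : Ideal.span (Set.range fun j => y j ^ (Function.update s i t) j) =
      Ideal.span {y i ^ t} ⊔ Ideal.span {z | ∃ j, j ≠ i ∧ z = y j ^ s j} := by
  rw [← Ideal.span_union]
  congr 1
  ext z
  simp only [Set.mem_range, Set.mem_union, Set.mem_singleton_iff, Set.mem_ofPred_eq]
  constructor
  · rintro ⟨j, rfl⟩
    by_cases hj : j = i
    · subst hj; simp
    · right; exact ⟨j, hj, by simp [Function.update_of_ne hj]⟩
  · rintro (rfl | ⟨j, hj, rfl⟩)
    · exact ⟨i, by simp⟩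
    · exact ⟨j, by simp [Function.update_of_ne hj]⟩

theorem REG.step {d : ℕ} {B : Type*} [CommRing B] {y : Fin d → B} (h : REG y)
    (i : Fin d) (s : Fin d → ℕ) (n t : ℕ) (b : B)
    (hb : y i ^ n * b ∈ Ideal.span (Set.range fun j => y j ^ (Function.update s i (n + t)) j)) :
    b ∈ Ideal.span (Set.range fun j => y j ^ (Function.update s i t) j) := by
  rw [span_update] at *
  rw [Submodule.mem_sup] at hb
  obtain ⟨u, hu, v, hv, huv⟩ := hb
  obtain ⟨c, rfl⟩ := Ideal.mem_span_singleton'.1 hu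
  have h1 : y i ^ n * (b - c * y i ^ t) ∈ Ideal.span {z | ∃ j, j ≠ i ∧ z = y j ^ s j} := by
    have : y i ^ n * (b - c * y i ^ t) = v := by
      rw [mul_sub, ← huv, pow_add]; ring
    rwa [this]
  have h2 := h.pow i s n _ h1
  rw [Submodule.mem_sup]
  exact ⟨c * y i ^ t, Ideal.mem_span_singleton'.2 ⟨c, rfl⟩, _, h2, by ring⟩

theorem REG.col {d : ℕ} {B : Type*} [CommRing B] {y : Fin d → B} (h : REG y)
    (β : Fin d → ℕ) (t : Fin d → ℕ) (b : B)
    (hb : mon y β * b ∈ Ideal.span (Set.range fun j => y j ^ (β j + t j))) :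
    b ∈ Ideal.span (Set.range fun j => y j ^ t j) := by
  classical
  have key : ∀ (T : Finset (Fin d)) (b : B), (∏ j ∈ T, y j ^ β j) * b ∈
      Ideal.span (Set.range fun j => y j ^ (if j ∈ T then β j + t j else t j)) →
      b ∈ Ideal.span (Set.range fun j => y j ^ t j) := by
    intro T
    induction T using Finset.induction_on with
    | empty => intro b hb; simpa using hb
    | insert i T hi ih =>
      intro b hb
      apply ih
      rw [Finset.prod_insert hi, mul_assoc] at hb
      have h1 := h.step i (fun j => if j ∈ T then β j + t j else t j) (β i) (t i)
        ((∏ j ∈ T, y j ^ β j) * b) (by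
          convert hb using 5 with j
          by_cases hj : j = i
          · subst hj; simp
          · simp [Function.update_of_ne hj, hj])
      convert h1 using 5 with j
      by_cases hj : j = i
      · subst hj; simp [hi]
      · simp [Function.update_of_ne hj]
  apply key Finset.univ
  simpa [mon] using hb

theorem REG.qr {d : ℕ} {B : Type*} [CommRing B] {y : Fin d → B} (h : REG y) (n : ℕ)
    (c : (Fin d → ℕ) → B)
    (hc : ∑ α ∈ Dg d n, mon y α * c α ∈ Ideal.span (Set.range y) ^ (n + 1)) :
    ∀ β ∈ Dg d n, c β ∈ Ideal.span (Set.range y) := by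
  classical
  intro β hβ
  have hmon : ∀ α : Fin d → ℕ, (∃ j, β j + 1 ≤ α j) →
      mon y α ∈ Ideal.span (Set.range fun j => y j ^ (β j + 1)) := by
    rintro α ⟨j, hj⟩
    have h1 : y j ^ (β j + 1) ∣ mon y α :=
      (pow_dvd_pow _ hj).trans (Finset.dvd_prod_of_mem (fun j => y j ^ α j) (Finset.mem_univ j))
    exact Ideal.mem_of_dvd _ h1 (Ideal.subset_span ⟨j, rfl⟩)
  have h1 : mon y β * c β ∈ Ideal.span (Set.range fun j => y j ^ (β j + 1)) := by
    rw [← Finset.add_sum_erase _ _ hβ] at hc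
    obtain ⟨e, he⟩ := pow_span_eq_exists y (n + 1) hc
    rw [← eq_sub_iff_add_eq] at he
    rw [he]
    refine sub_mem (sum_mem fun α hα => Ideal.mul_mem_right _ _ (hmon α ?_))
      (sum_mem fun α hα => Ideal.mul_mem_right _ _ (hmon α ?_))
    · by_contra hcon
      push Not at hcon
      rw [mem_Dg] at hα hβ
      have : ∑ j, α j ≤ ∑ j, β j := Finset.sum_le_sum fun j _ => by have := hcon j; omega
      omega
    · by_contra hcon
      push Not at hcon
      rw [Finset.mem_erase] at hα
      obtain ⟨hne, hα⟩ := hα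
      rw [mem_Dg] at hα hβ
      apply hne
      have h2 : ∀ j ∈ Finset.univ, α j ≤ β j := fun j _ => by have := hcon j; omega
      have := (Finset.sum_eq_sum_iff_of_le h2).1 (by omega)
      ext j; exact this j (Finset.mem_univ j)
  have := h.col β (fun _ => 1) (c β) h1
  simpa using this

section alg
variable {R B : Type*} [CommRing R] [CommRing B] [Algebra R B] {d : ℕ}

theorem mon_map (x : Fin d → R) (α : Fin d → ℕ) :
    algebraMap R B (mon x α) = mon (fun j => algebraMap R B (x j)) α := by
  simp [mon]

theorem map_span_range (x : Fin d → R) : (Ideal.span (Set.range x)).map (algebraMap R B) =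
    Ideal.span (Set.range fun j => algebraMap R B (x j)) := by
  rw [Ideal.map_span, ← Set.range_comp]; rfl

theorem mem_pow_smul_iff (x : Fin d → R) (n : ℕ) (V : Submodule R B) {w : B} :
    w ∈ Ideal.span (Set.range x) ^ n • V ↔
    ∃ v : (Fin d → ℕ) → B, (∀ α, v α ∈ V) ∧ w = ∑ α ∈ Dg d n, mon x α • v α := by
  constructor
  · intro hw
    refine Submodule.smul_induction_on hw ?_ ?_
    · intro r hr v hv
      obtain ⟨c, rfl⟩ := pow_span_eq_exists x n hr
      refine ⟨fun α => c α • v, fun α => V.smul_mem _ hv, ?_⟩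
      rw [Finset.sum_smul]
      simp [mul_smul]
    · intro a b ha hb
      obtain ⟨v, hv, rfl⟩ := ha
      obtain ⟨w, hw, rfl⟩ := hb
      exact ⟨v + w, fun α => V.add_mem (hv α) (hw α), by simp [Finset.sum_add_distrib]⟩
  · rintro ⟨v, hv, rfl⟩
    exact sum_mem fun α hα => Submodule.smul_mem_smul (mon_mem_pow x hα) (hv α)

/-- `QB` as an `R`-submodule. -/
def extSub (B : Type*) [CommRing B] [Algebra R B] (I : Ideal R) : Submodule R B :=
  (I.map (algebraMap R B)).restrictScalars R

theorem mem_extSub {I : Ideal R} {b : B} : b ∈ extSub B I ↔ b ∈ I.map (algebraMap R B) := Iff.rfl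

theorem extSub_eq (I : Ideal R) : extSub B I = I • (⊤ : Submodule R B) := by
  rw [extSub, Ideal.smul_top_eq_map]

theorem uniq (x : Fin d → R) (hreg : REG (fun j => algebraMap R B (x j))) (n : ℕ)
    (V : Submodule R B) (hV : extSub B (Ideal.span (Set.range x)) ≤ V)
    (b : (Fin d → ℕ) → B)
    (hb : ∑ α ∈ Dg d n, mon x α • b α ∈ Ideal.span (Set.range x) ^ n • V) :
    ∀ α ∈ Dg d n, b α ∈ V := by
  obtain ⟨v, hv, h⟩ := (mem_pow_smul_iff x n V).1 hb
  intro α hα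
  have h0 : ∑ α ∈ Dg d n, mon (fun j => algebraMap R B (x j)) α * (b α - v α) ∈
      Ideal.span (Set.range fun j => algebraMap R B (x j)) ^ (n + 1) := by
    have : ∑ α ∈ Dg d n, mon (fun j => algebraMap R B (x j)) α * (b α - v α) = 0 := by
      simp only [Algebra.smul_def, mon_map] at h
      simp [mul_sub, h]
    rw [this]; exact zero_mem _
  have h1 := hreg.qr n _ h0 α hα
  rw [← map_span_range] at h1
  have := V.add_mem (hV h1) (hv α)
  simpa using this

end alg

end Piece01

section Piece02

open IsLocalRing

section growth
variable {R B : Type*} [CommRing R] [CommRing B] [Algebra R B] {d : ℕ}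

/-- The contraction of `Q^n V`. -/
def JV (Q : Ideal R) (n : ℕ) (V : Submodule R B) : Ideal R :=
  (Q ^ n • V).comap (Algebra.linearMap R B)

theorem mem_JV {Q : Ideal R} {n : ℕ} {V : Submodule R B} {a : R} :
    a ∈ JV Q n V ↔ algebraMap R B a ∈ Q ^ n • V := Iff.rfl

theorem growth_socle [IsLocalRing R] (Q : Ideal R) (V : Submodule R B)
    (hV : extSub B Q ≤ V) (hm : ∃ N, maximalIdeal R ^ N ≤ Q) (s : ℕ) (a : R)
    (ha : algebraMap R B a ∈ extSub B (Q ^ s)) (ha' : a ∉ JV Q s V) :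
    ∃ r : R, r * a ∉ JV Q s V ∧ ∀ u ∈ maximalIdeal R, u * (r * a) ∈ JV Q s V := by
  classical
  obtain ⟨N, hN⟩ := hm
  have hQ : ∀ q ∈ Q, q * a ∈ JV Q s V := by
    intro q hq
    rw [mem_JV, map_mul]
    rw [extSub_eq] at ha hV
    have h1 : q • algebraMap R B a ∈ Q • Q ^ s • (⊤ : Submodule R B) :=
      Submodule.smul_mem_smul hq ha
    rw [← Algebra.smul_def]
    have h2 : Q • Q ^ s • (⊤ : Submodule R B) = Q ^ s • Q • (⊤ : Submodule R B) := by
      rw [← mul_smul, ← mul_smul, mul_comm]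
    rw [h2] at h1
    exact Submodule.smul_mono le_rfl hV h1
  have hex : ∃ n, ∀ r ∈ maximalIdeal R ^ n, r * a ∈ JV Q s V :=
    ⟨N, fun r hr => hQ r (hN hr)⟩
  have hspec := Nat.find_spec hex
  have hpos : Nat.find hex ≠ 0 := by
    intro h0
    rw [h0] at hspec
    exact ha' (by simpa using hspec 1 (by simp))
  obtain ⟨k, hk⟩ := Nat.exists_eq_succ_of_ne_zero hpos
  have hmin := Nat.find_min hex (m := k) (by omega)
  push Not at hmin
  obtain ⟨r, hr, hra⟩ := hmin
  refine ⟨r, hra, fun u hu => ?_⟩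
  rw [← mul_assoc]
  apply hspec
  rw [hk, pow_succ']
  exact Ideal.mul_mem_mul hu hr

theorem growth_ker [IsLocalRing R] (x : Fin d → R)
    (hreg : REG (fun j => algebraMap R B (x j))) (V : Submodule R B)
    (hV : extSub B (Ideal.span (Set.range x)) ≤ V) (s t : ℕ) (a : R)
    (ha : algebraMap R B a ∈ extSub B (Ideal.span (Set.range x) ^ s))
    (ha' : a ∉ JV (Ideal.span (Set.range x)) s V)
    (hma : ∀ u ∈ maximalIdeal R, u * a ∈ JV (Ideal.span (Set.range x)) s V)
    (r : (Fin d → ℕ) → R)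
    (hr : (∑ γ ∈ Dg d t, r γ * mon x γ) * a ∈ JV (Ideal.span (Set.range x)) (s + t) V) :
    ∀ γ ∈ Dg d t, r γ ∈ maximalIdeal R := by
  classical
  rw [extSub_eq] at ha
  obtain ⟨b, -, hb⟩ := (mem_pow_smul_iff x s ⊤).1 ha
  have hmb : ∀ u ∈ maximalIdeal R, ∀ α ∈ Dg d s, u • b α ∈ V := by
    intro u hu
    apply uniq x hreg s V hV (fun α => u • b α)
    have := hma u hu
    rw [mem_JV, map_mul, hb, ← Algebra.smul_def, Finset.smul_sum] at this
    simpa only [smul_comm u] using this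
  set S1 := (Dg d s).filter (fun α => b α ∉ V) with hS1
  set S2 := (Dg d t).filter (fun γ => r γ ∉ maximalIdeal R) with hS2
  have hS1n : S1.Nonempty := by
    by_contra hcon
    rw [Finset.not_nonempty_iff_eq_empty, Finset.filter_eq_empty_iff] at hcon
    apply ha'
    rw [mem_JV, hb]
    exact sum_mem fun α hα => Submodule.smul_mem_smul (mon_mem_pow x hα) (by simpa using hcon hα)
  by_contra hcon
  have hS2n : S2.Nonempty := by
    push Not at hcon
    obtain ⟨γ, h1, h2⟩ := hcon
    exact ⟨γ, Finset.mem_filter.2 ⟨h1, h2⟩⟩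
  obtain ⟨α0, hα0, γ0, hγ0, huniq⟩ := UniqueSums.uniqueAdd_of_nonempty hS1n hS2n
  obtain ⟨hα0D, hα0V⟩ := Finset.mem_filter.1 hα0
  obtain ⟨hγ0D, hγ0m⟩ := Finset.mem_filter.1 hγ0
  set P := (Dg d s) ×ˢ (Dg d t) with hP
  let c : (Fin d → ℕ) → B := fun δ => ∑ p ∈ P with p.1 + p.2 = δ, r p.2 • b p.1
  have hsum : algebraMap R B ((∑ γ ∈ Dg d t, r γ * mon x γ) * a) =
      ∑ δ ∈ Dg d (s + t), mon x δ • c δ := by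
    have h1 : ∑ δ ∈ Dg d (s + t), mon x δ • c δ =
        ∑ p ∈ P, mon x (p.1 + p.2) • (r p.2 • b p.1) := by
      rw [← Finset.sum_fiberwise_of_maps_to (s := P) (t := Dg d (s + t)) (g := fun p => p.1 + p.2)
        (fun p hp => Dg_add (Finset.mem_product.1 hp).1 (Finset.mem_product.1 hp).2)]
      refine Finset.sum_congr rfl fun δ _ => ?_
      rw [Finset.smul_sum]
      refine Finset.sum_congr rfl fun p hp => ?_
      rw [(Finset.mem_filter.1 hp).2]
    rw [h1, map_mul, hb, map_sum, Finset.sum_mul_sum, hP, Finset.sum_product_right]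
    refine Finset.sum_congr rfl fun γ _ => Finset.sum_congr rfl fun α _ => ?_
    rw [mon_add]
    simp only [Algebra.smul_def, map_mul]
    ring
  rw [mem_JV, hsum] at hr
  have h2 := uniq x hreg (s + t) V hV c hr (α0 + γ0) (Dg_add hα0D hγ0D)
  have hmem : (α0, γ0) ∈ P.filter (fun p => p.1 + p.2 = α0 + γ0) := by
    simp [hP, hα0D, hγ0D, -Finset.mem_piAntidiag]
  simp only [c] at h2
  rw [← Finset.add_sum_erase _ _ hmem] at h2
  have h3 : ∑ p ∈ (P.filter (fun p => p.1 + p.2 = α0 + γ0)).erase (α0, γ0), r p.2 • b p.1 ∈ V := by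
    refine sum_mem fun p hp => ?_
    obtain ⟨hne, hp⟩ := Finset.mem_erase.1 hp
    obtain ⟨hpP, hpe⟩ := Finset.mem_filter.1 hp
    obtain ⟨hp1, hp2⟩ := Finset.mem_product.1 hpP
    by_cases h4 : b p.1 ∈ V
    · exact V.smul_mem _ h4
    by_cases h5 : r p.2 ∈ maximalIdeal R
    · exact hmb _ h5 _ hp1
    exfalso
    have h6 := huniq (Finset.mem_filter.2 ⟨hp1, h4⟩) (Finset.mem_filter.2 ⟨hp2, h5⟩) hpe
    exact hne (Prod.ext h6.1 h6.2)
  have h7 : r γ0 • b α0 ∈ V := by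
    have := V.sub_mem h2 h3
    simpa using this
  have hu : IsUnit (r γ0) := by simpa using hγ0m
  obtain ⟨u, hu⟩ := hu
  have := V.smul_mem (↑u⁻¹ : R) h7
  rw [← hu, smul_smul, Units.inv_mul, one_smul] at this
  exact hα0V this

theorem growth [IsLocalRing R] (x : Fin d → R)
    (hreg : REG (fun j => algebraMap R B (x j)))
    (hm : ∃ N, maximalIdeal R ^ N ≤ Ideal.span (Set.range x)) (V : Submodule R B)
    (hV : extSub B (Ideal.span (Set.range x)) ≤ V) (s t : ℕ) (a : R)
    (ha : algebraMap R B a ∈ extSub B (Ideal.span (Set.range x) ^ s))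
    (ha' : a ∉ JV (Ideal.span (Set.range x)) s V) (K : Ideal R)
    (hJ : JV (Ideal.span (Set.range x)) (s + t) V ≤ K)
    (hK : ∀ q ∈ Ideal.span (Set.range x) ^ t, q * a ∈ K) :
    Module.length R (R ⧸ K) + (Dg d t).card ≤
      Module.length R (R ⧸ JV (Ideal.span (Set.range x)) (s + t) V) := by
  classical
  set Q := Ideal.span (Set.range x) with hQ
  set J := JV Q (s + t) V with hJdef
  obtain ⟨r, hra, hma⟩ := growth_socle Q V hV hm s a ha ha'
  have hara : algebraMap R B (r * a) ∈ extSub B (Q ^ s) := by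
    rw [map_mul, ← Algebra.smul_def]; exact Submodule.smul_mem _ _ ha
  let f : (Dg d t → R) →ₗ[R] (R ⧸ J) :=
    (Submodule.mkQ J) ∘ₗ (LinearMap.mulRight R (r * a)) ∘ₗ
      (Fintype.linearCombination R (fun γ : Dg d t => mon x γ.1))
  have hf : ∀ c, f c = Submodule.Quotient.mk ((∑ γ : Dg d t, c γ * mon x γ.1) * (r * a)) := by
    intro c; rfl
  have hker : ∀ c, f c = 0 → ∀ γ, c γ ∈ maximalIdeal R := by
    intro c hc γ
    rw [hf, Submodule.Quotient.mk_eq_zero] at hc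
    have := growth_ker x hreg V hV s t (r * a) hara hra hma
      (fun γ => if h : γ ∈ Dg d t then c ⟨γ, h⟩ else 0) (by
        rw [← Finset.sum_coe_sort]
        convert hc using 4 with γ
        simp [-Finset.mem_piAntidiag]) γ.1 γ.2
    simpa [-Finset.mem_piAntidiag] using this
  let g : (R ⧸ J) →ₗ[R] (R ⧸ K) := Submodule.factor hJ
  have hg : Function.Surjective g := Submodule.factor_surjective hJ
  have hlen := Module.length_eq_add_of_exact (LinearMap.ker g).subtype g
    (Submodule.injective_subtype _) hg (by
      rw [LinearMap.exact_iff]; simp)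
  have hrange : LinearMap.range f ≤ LinearMap.ker g := by
    rintro _ ⟨c, rfl⟩
    rw [LinearMap.mem_ker, hf]
    change (Submodule.Quotient.mk _ : R ⧸ K) = 0
    rw [Submodule.Quotient.mk_eq_zero]
    have : (∑ γ : Dg d t, c γ * mon x γ.1) * (r * a) =
      r * ((∑ γ : Dg d t, c γ * mon x γ.1) * a) := by ring
    rw [this]
    refine K.mul_mem_left _ (hK _ (sum_mem fun γ _ => Ideal.mul_mem_left _ _ (mon_mem_pow x γ.2)))
  have h1 : Module.length R (LinearMap.range f) ≤ Module.length R (LinearMap.ker g) :=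
    Module.length_le_of_injective (Submodule.inclusion hrange) (Submodule.inclusion_injective _)
  let π : (Dg d t → R) →ₗ[R] (Dg d t → ResidueField R) :=
    LinearMap.pi fun γ => (Algebra.linearMap R (ResidueField R)) ∘ₗ LinearMap.proj γ
  have hπ : Function.Surjective π := by
    intro c
    choose b hb using fun γ => IsLocalRing.residue_surjective (R := R) (c γ)
    exact ⟨b, by ext γ; simpa [π] using hb γ⟩
  have hkerle : LinearMap.ker f ≤ LinearMap.ker π := by
    intro c hc
    rw [LinearMap.mem_ker] at *
    ext γ
    have := hker c hc γ
    simpa [π] using this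
  have h2 : Module.length R (Dg d t → ResidueField R) ≤ Module.length R (LinearMap.range f) := by
    rw [← (f.quotKerEquivRange).length_eq]
    refine Module.length_le_of_surjective (Submodule.liftQ _ π hkerle) ?_
    intro c
    obtain ⟨b, rfl⟩ := hπ c
    exact ⟨Submodule.Quotient.mk b, by simp⟩
  have h3 : Module.length R (Dg d t → ResidueField R) = (Dg d t).card := by
    rw [Module.length_pi]
    have : Module.length R (ResidueField R) = 1 := by
      rw [Module.length_eq_one_iff]
      exact isSimpleModule_iff_quot_maximal.2 ⟨maximalIdeal R, inferInstance, ⟨LinearEquiv.refl _ _⟩⟩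
    rw [this, mul_one, ENat.card_eq_coe_fintype_card, Fintype.card_coe]
  rw [hlen, add_comm, ← h3]
  gcongr
  exact h2.trans h1

end growth

end Piece02

section Piece03

open IsLocalRing

section lam
variable {R : Type*} [CommRing R]

/-- natural-number valued colength -/
noncomputable def lam (J : Ideal R) : ℕ := (Module.length R (R ⧸ J)).toNat

theorem length_quot_ne_top [IsLocalRing R] [IsNoetherianRing R] {J : Ideal R} {N : ℕ}
    (h : maximalIdeal R ^ N ≤ J) : Module.length R (R ⧸ J) ≠ ⊤ := by
  rw [Module.length_ne_top_iff]
  by_cases htop : J = ⊤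
  · subst htop
    have : Subsingleton (R ⧸ (⊤ : Ideal R)) := Ideal.Quotient.subsingleton_iff.2 rfl
    exact IsFiniteLength.of_subsingleton
  have hr : J.radical = maximalIdeal R := by
    apply le_antisymm
    · exact ((IsLocalRing.maximalIdeal.isMaximal R).isPrime.radical_le_iff).2
        (IsLocalRing.le_maximalIdeal htop)
    · intro z hz
      exact ⟨N, h (Ideal.pow_mem_pow hz N)⟩
  have hart : IsArtinianRing (R ⧸ J) := by
    have : Nontrivial (R ⧸ J) := Ideal.Quotient.nontrivial_iff.2 htop
    have : IsLocalRing (R ⧸ J) := .of_surjective' (Ideal.Quotient.mk J) Ideal.Quotient.mk_surjective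
    rw [isArtinianRing_iff_isNilpotent_maximalIdeal]
    refine ⟨N, ?_⟩
    have : maximalIdeal (R ⧸ J) = (maximalIdeal R).map (Ideal.Quotient.mk J) := by
      symm
      apply IsLocalRing.eq_maximalIdeal
      apply Ideal.IsMaximal.map_of_surjective_of_ker_le (Ideal.Quotient.mk_surjective)
      rw [Ideal.mk_ker]; exact IsLocalRing.le_maximalIdeal htop
    rw [this, ← Ideal.map_pow]
    rw [Ideal.zero_eq_bot, eq_bot_iff, Ideal.map_le_iff_le_comap, ← RingHom.ker_eq_comap_bot,
      Ideal.mk_ker]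
    exact h
  have h1 : IsArtinian R (R ⧸ J) := isArtinian_of_surjective_algebraMap (R := R ⧸ J) (S := R)
    Ideal.Quotient.mk_surjective
  exact isFiniteLength_iff_isNoetherian_isArtinian.2 ⟨inferInstance, h1⟩

theorem lam_mono {J K : Ideal R} (h : J ≤ K) (hf : Module.length R (R ⧸ J) ≠ ⊤) :
    lam K ≤ lam J :=
  ENat.toNat_le_toNat (Module.length_le_of_surjective (Submodule.factor h)
    (Submodule.factor_surjective h)) hf

theorem card_Dg (d t : ℕ) : (Dg (d + 1) t).card = (t + d).choose d := by
  rw [Dg, ← Finset.map_sym_eq_piAntidiag, Finset.card_map]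
  simp [Sym.card_sym_eq_choose]
  rw [add_comm d t, Nat.choose_symm_add]

theorem sum_card_Dg (d m : ℕ) : ∑ t ∈ Finset.range (m + 1), (Dg (d + 1) t).card =
    (m + (d + 1)).choose (d + 1) := by
  simp only [card_Dg]
  rw [Nat.sum_range_add_choose, add_assoc]

theorem card_Dg_mono (d : ℕ) {s t : ℕ} (h : s ≤ t) :
    (Dg (d + 1) s).card ≤ (Dg (d + 1) t).card := by
  rw [card_Dg, card_Dg]
  exact Nat.choose_le_choose _ (by omega)

theorem choose_le_pow' (n k : ℕ) : (n + k).choose k ≤ (n + 1) ^ k := by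
  induction k with
  | zero => simp
  | succ k ih =>
    have h := Nat.add_one_mul_choose_eq (n + k) k
    have h2 : (n + (k + 1)).choose (k + 1) * (k + 1) ≤ ((n + 1) ^ (k + 1)) * (k + 1) := by
      rw [← add_assoc, ← h, pow_succ]
      have : n + k + 1 ≤ (n + 1) * (k + 1) := by nlinarith [Nat.zero_le (n * k)]
      calc (n + k + 1) * (n + k).choose k ≤ ((n + 1) * (k + 1)) * (n + 1) ^ k :=
            Nat.mul_le_mul this ih
        _ = _ := by ring
    exact Nat.le_of_mul_le_mul_right h2 (Nat.succ_pos k)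

theorem pow_le_choose' (n k : ℕ) : (n + 1) ^ k ≤ k.factorial * (n + k).choose k := by
  rw [← Nat.ascFactorial_eq_factorial_mul_choose]
  exact Nat.pow_succ_le_ascFactorial (n + 1) k

end lam

section S1
variable {R B : Type*} [CommRing R] [CommRing B] [Algebra R B] {d : ℕ}

/-- the contracted extension of powers -/
def IB (B : Type*) [CommRing B] [Algebra R B] (Q : Ideal R) (n : ℕ) : Ideal R :=
  contractedExt R (algebraMap R B) (Q ^ n)

theorem mem_IB {Q : Ideal R} {n : ℕ} {a : R} :
    a ∈ IB B Q n ↔ algebraMap R B a ∈ extSub B (Q ^ n) := Iff.rfl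

theorem pow_le_IB (Q : Ideal R) (n : ℕ) : Q ^ n ≤ IB B Q n := Ideal.le_comap_map

theorem IB_mul (Q : Ideal R) {n t : ℕ} {a q : R} (ha : a ∈ IB B Q n) (hq : q ∈ Q ^ t) :
    q * a ∈ IB B Q (n + t) := by
  rw [mem_IB, mem_extSub] at *
  rw [map_mul, add_comm, pow_add, Ideal.map_mul]
  exact Ideal.mul_mem_mul (Ideal.mem_map_of_mem _ hq) ha

theorem IB_anti (Q : Ideal R) {n t : ℕ} (h : n ≤ t) : IB B Q t ≤ IB B Q n :=
  Ideal.comap_mono (Ideal.map_mono (Ideal.pow_le_pow_right h))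

theorem JV_ext (Q : Ideal R) (n : ℕ) : JV Q n (extSub B Q) = IB B Q (n + 1) := by
  ext a
  rw [mem_JV, mem_IB, extSub_eq, extSub_eq, ← mul_smul, ← pow_succ]

theorem JV_le (Q : Ideal R) (n : ℕ) (V : Submodule R B) : JV Q n V ≤ IB B Q n := by
  intro a ha
  rw [mem_JV] at ha
  rw [mem_IB, extSub_eq]
  exact Submodule.smul_mono le_rfl le_top ha

theorem JV_mono (Q : Ideal R) (n : ℕ) {V W : Submodule R B} (h : V ≤ W) : JV Q n V ≤ JV Q n W :=
  fun _ ha => Submodule.smul_mono le_rfl h ha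

theorem pow_le_of_le [IsLocalRing R] {Q : Ideal R} {N : ℕ} (hN : maximalIdeal R ^ N ≤ Q) (n : ℕ) :
    maximalIdeal R ^ (N * n) ≤ Q ^ n := by
  rw [pow_mul]; exact Ideal.pow_right_mono hN n

theorem IB_fin [IsLocalRing R] [IsNoetherianRing R] {Q : Ideal R}
    (hm : ∃ N, maximalIdeal R ^ N ≤ Q) (n : ℕ) : Module.length R (R ⧸ IB B Q n) ≠ ⊤ := by
  obtain ⟨N, hN⟩ := hm
  exact length_quot_ne_top ((pow_le_of_le hN n).trans (pow_le_IB Q n))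

theorem JV_fin [IsLocalRing R] [IsNoetherianRing R] {Q : Ideal R}
    (hm : ∃ N, maximalIdeal R ^ N ≤ Q) (n : ℕ) (V : Submodule R B) (hV : extSub B Q ≤ V) :
    Module.length R (R ⧸ JV Q n V) ≠ ⊤ := by
  obtain ⟨N, hN⟩ := hm
  refine length_quot_ne_top ((pow_le_of_le hN (n + 1)).trans ((pow_le_IB (B := B) Q (n + 1)).trans ?_))
  rw [← JV_ext]
  exact JV_mono Q n hV

theorem s1_step [IsLocalRing R] [IsNoetherianRing R] (x : Fin (d + 1) → R)
    (hreg : REG (fun j => algebraMap R B (x j)))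
    (hm : ∃ N, maximalIdeal R ^ N ≤ Ideal.span (Set.range x))
    (hno : ∀ V0 : Submodule R B, V0.FG → ∃ n,
      ¬ IB B (Ideal.span (Set.range x)) n ≤
        JV (Ideal.span (Set.range x)) n (V0 ⊔ extSub B (Ideal.span (Set.range x)))) (r : ℕ) :
    ∃ (V0 : Submodule R B) (S : ℕ), V0.FG ∧ ∀ n ≥ S,
      lam (JV (Ideal.span (Set.range x)) n (V0 ⊔ extSub B (Ideal.span (Set.range x)))) +
        r * (Dg (d + 1) (n - S)).card ≤ lam (IB B (Ideal.span (Set.range x)) (n + 1)) := by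
  classical
  set Q := Ideal.span (Set.range x) with hQ
  induction r with
  | zero =>
    refine ⟨⊥, 0, Submodule.fg_bot, fun n _ => ?_⟩
    simp [JV_ext]
  | succ r ih =>
    obtain ⟨V0, S, hfg, h⟩ := ih
    obtain ⟨s, hs⟩ := hno V0 hfg
    obtain ⟨a, ha, ha'⟩ := SetLike.not_le_iff_exists.1 hs
    rw [mem_IB, extSub_eq] at ha
    obtain ⟨b, -, hb⟩ := (mem_pow_smul_iff x s ⊤).1 ha
    let W : Submodule R B := V0 ⊔ Submodule.span R (((Dg (d + 1) s).image b : Finset B) : Set B)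
    have hW : V0 ⊔ extSub B Q ≤ W ⊔ extSub B Q := sup_le_sup_right le_sup_left _
    have haW : a ∈ JV Q s (W ⊔ extSub B Q) := by
      rw [mem_JV, hb]
      refine sum_mem fun α hα => Submodule.smul_mem_smul (mon_mem_pow x hα) ?_
      apply Submodule.mem_sup_left
      apply Submodule.mem_sup_right
      exact Submodule.subset_span (Finset.mem_coe.2 (Finset.mem_image_of_mem b hα))
    refine ⟨W, max S s, hfg.sup (Submodule.fg_span (Finset.finite_toSet _)), fun n hn => ?_⟩
    have h1 := h n (le_trans (le_max_left _ _) hn)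
    obtain ⟨t, rfl⟩ := Nat.exists_eq_add_of_le (le_trans (le_max_right _ _) hn)
    have h2 := growth x hreg hm (V0 ⊔ extSub B Q) le_sup_right s t a (by rw [extSub_eq]; exact ha)
      ha' (JV Q (s + t) (W ⊔ extSub B Q)) (JV_mono _ _ hW) (by
        intro q hq
        rw [mem_JV] at *
        rw [map_mul, ← Algebra.smul_def, add_comm, pow_add, mul_smul]
        exact Submodule.smul_mem_smul hq haW)
    have h3 : lam (JV Q (s + t) (W ⊔ extSub B Q)) + (Dg (d + 1) t).card ≤
        lam (JV Q (s + t) (V0 ⊔ extSub B Q)) := by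
      have h4 := ENat.toNat_le_toNat h2 (JV_fin hm _ _ le_sup_right)
      rwa [ENat.toNat_add (JV_fin hm _ _ le_sup_right) (ENat.natCast_ne_top _)] at h4
    have h5 : (Dg (d + 1) (s + t - max S s)).card ≤ (Dg (d + 1) t).card := card_Dg_mono d (by omega)
    have h6 : (Dg (d + 1) (s + t - max S s)).card ≤ (Dg (d + 1) (s + t - S)).card :=
      card_Dg_mono d (by omega)
    have h7 := Nat.mul_le_mul_left r h6
    rw [add_mul, one_mul]
    omega

theorem s1 [IsLocalRing R] [IsNoetherianRing R] (x : Fin (d + 1) → R)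
    (hreg : REG (fun j => algebraMap R B (x j)))
    (hm : ∃ N, maximalIdeal R ^ N ≤ Ideal.span (Set.range x))
    (hbd : ∃ C N : ℕ, ∀ n ≥ N, lam (IB B (Ideal.span (Set.range x)) (n + 1)) ≤
      C * (n + 1) ^ (d + 1)) :
    ∃ V0 : Submodule R B, V0.FG ∧ ∀ n, IB B (Ideal.span (Set.range x)) n ≤
        JV (Ideal.span (Set.range x)) n (V0 ⊔ extSub B (Ideal.span (Set.range x))) := by
  by_contra hcon
  push Not at hcon
  obtain ⟨C, N, hC⟩ := hbd
  obtain ⟨V0, S, -, h⟩ := s1_step x hreg hm hcon ((d + 1).factorial * C * 2 ^ (d + 1) + 1)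
  set Q := Ideal.span (Set.range x)
  set r := (d + 1).factorial * C * 2 ^ (d + 1) + 1 with hr
  have h1 : ∀ m, r * (∑ t ∈ Finset.range m, (Dg (d + 1) t).card) ≤ lam (IB B Q (S + m)) := by
    intro m
    induction m with
    | zero => simp
    | succ m ih =>
      rw [Finset.sum_range_succ, mul_add]
      have h2 := h (S + m) (by omega)
      have h3 : lam (IB B Q (S + m)) ≤ lam (JV Q (S + m) (V0 ⊔ extSub B Q)) :=
        lam_mono (JV_le _ _ _) (JV_fin hm _ _ le_sup_right)
      rw [Nat.add_sub_cancel_left] at h2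
      rw [← add_assoc]
      omega
  have h2 := h1 (S + N + 1)
  rw [sum_card_Dg] at h2
  have h3 := hC (S + (S + N)) (by omega)
  rw [add_assoc] at h3
  have h4 := pow_le_choose' (S + N) (d + 1)
  have h5 : (S + (S + N + 1)) ^ (d + 1) ≤ 2 ^ (d + 1) * (S + N + 1) ^ (d + 1) := by
    rw [← mul_pow]; exact Nat.pow_le_pow_left (by omega) _
  have h6 : r * (S + N + 1) ^ (d + 1) ≤ (r - 1) * (S + N + 1) ^ (d + 1) := by
    calc r * (S + N + 1) ^ (d + 1)
        ≤ r * ((d + 1).factorial * (S + N + (d + 1)).choose (d + 1)) := Nat.mul_le_mul_left _ h4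
      _ = (d + 1).factorial * (r * (S + N + (d + 1)).choose (d + 1)) := by ring
      _ ≤ (d + 1).factorial * (C * (S + (S + N + 1)) ^ (d + 1)) :=
          Nat.mul_le_mul_left _ (h2.trans h3)
      _ ≤ (d + 1).factorial * (C * (2 ^ (d + 1) * (S + N + 1) ^ (d + 1))) :=
          Nat.mul_le_mul_left _ (Nat.mul_le_mul_left _ h5)
      _ = _ := by rw [hr, Nat.add_sub_cancel]; ring
  have h7 : 0 < (S + N + 1) ^ (d + 1) := by positivity
  have := Nat.le_of_mul_le_mul_right h6 h7
  omega

end S1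

end Piece03

section Piece04

open IsLocalRing Polynomial

section S2
variable {R B : Type*} [CommRing R] [CommRing B] [Algebra R B] {d : ℕ}

theorem s2_aux [IsNoetherianRing R] (x : Fin d → R)
    (V0 : Submodule R B) (hfg : V0.FG)
    (hV : ∀ n, IB B (Ideal.span (Set.range x)) n ≤
        JV (Ideal.span (Set.range x)) n (V0 ⊔ extSub B (Ideal.span (Set.range x)))) :
    ∃ j, ∀ n ≥ j, IB B (Ideal.span (Set.range x)) n ≤
      Ideal.span (Set.range x) ^ (n - j) ⊔ IB B (Ideal.span (Set.range x)) (n + 1) := by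
  classical
  set Q := Ideal.span (Set.range x) with hQ
  let y : Fin d → B[X] := fun j => C (algebraMap R B (x j)) * X
  let P : Subalgebra R B[X] := Algebra.adjoin R (Set.range y)
  have hP : IsNoetherianRing P := by
    have : P.FG := Subalgebra.fg_def.2 ⟨_, Set.finite_range y, rfl⟩
    have := P.fg_iff_finiteType.1 this
    exact Algebra.FiniteType.isNoetherianRing R P
  -- general inductive principle
  have key : ∀ (W : ℕ → Submodule R B), (∀ n i b, b ∈ W n → x i • b ∈ W (n + 1)) →
      ∀ p ∈ P, ∀ F : B[X], (∀ n, F.coeff n ∈ W n) → ∀ n, (p * F).coeff n ∈ W n := by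
    intro W hW p hp
    induction hp using Algebra.adjoin_induction with
    | mem z hz =>
      obtain ⟨i, rfl⟩ := hz
      intro F hF n
      simp only [y]
      rw [mul_assoc, coeff_C_mul]
      cases n with
      | zero => simp
      | succ n =>
        rw [coeff_X_mul, ← Algebra.smul_def]
        exact hW n i _ (hF n)
    | algebraMap r =>
      intro F hF n
      rw [← Algebra.smul_def, coeff_smul]
      exact (W n).smul_mem _ (hF n)
    | add a b _ _ ha hb =>
      intro F hF n
      rw [add_mul, coeff_add]
      exact (W n).add_mem (ha F hF n) (hb F hF n)
    | mul a b _ _ ha hb =>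
      intro F hF n
      rw [mul_assoc]
      exact ha _ (hb F hF) n
  -- image of an ideal
  let im : Ideal R → Submodule R B := fun I => Submodule.map (Algebra.linearMap R B) I
  let W1 : ℕ → Submodule R B := fun n => im (IB B Q n) ⊔ extSub B (Q ^ (n + 1))
  have hxQ : ∀ i, x i ∈ Q := fun i => Ideal.subset_span ⟨i, rfl⟩
  have hext : ∀ n i (b : B), b ∈ extSub B (Q ^ n) → x i • b ∈ extSub B (Q ^ (n + 1)) := by
    intro n i b hb
    rw [extSub_eq] at *
    rw [pow_succ', mul_smul]
    exact Submodule.smul_mem_smul (hxQ i) hb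
  have hW1 : ∀ n i b, b ∈ W1 n → x i • b ∈ W1 (n + 1) := by
    intro n i b hb
    obtain ⟨u, hu, v, hv, rfl⟩ := Submodule.mem_sup.1 hb
    rw [smul_add]
    refine Submodule.add_mem_sup ?_ (hext _ _ _ hv)
    obtain ⟨a, ha, rfl⟩ := hu
    exact ⟨x i * a, IB_mul Q ha (by simpa using hxQ i), by simp [Algebra.smul_def]⟩
  let M0 : Submodule P B[X] := Submodule.span P ((fun b : B => C b) '' (V0 : Set B))
  have hM0 : M0.FG := by
    obtain ⟨T, hT⟩ := hfg
    have : M0 = Submodule.span P ((fun b : B => C b) '' (T : Set B)) := by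
      apply le_antisymm
      · refine Submodule.span_le.2 ?_
        rintro _ ⟨b, hb, rfl⟩
        rw [← hT] at hb
        change C b ∈ Submodule.span P ((fun b : B => C b) '' (T : Set B))
        induction hb using Submodule.span_induction with
        | mem z hz => exact Submodule.subset_span ⟨z, hz, rfl⟩
        | zero => simp
        | add u v _ _ hu hv => rw [C_add]; exact add_mem hu hv
        | smul r u _ hu =>
          have h1 : C (r • u) = (algebraMap R P r) • (C u : B[X]) := by
            rw [algebraMap_smul, smul_C]
          rw [h1]
          exact Submodule.smul_mem _ _ hu
      · refine Submodule.span_mono (Set.image_mono ?_)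
        rw [← hT]; exact Submodule.subset_span
    rw [this]
    exact Submodule.fg_span (Set.Finite.image _ (Finset.finite_toSet T))
  let N : Submodule P B[X] :=
    { carrier := {F | F ∈ M0 ∧ ∀ n, F.coeff n ∈ W1 n}
      add_mem' := fun {a b} ha hb => ⟨add_mem ha.1 hb.1, fun n => by
        rw [coeff_add]; exact add_mem (ha.2 n) (hb.2 n)⟩
      zero_mem' := ⟨zero_mem _, fun n => by simp⟩
      smul_mem' := fun p F hF => ⟨M0.smul_mem p hF.1, fun n => by
        have := key W1 hW1 p.1 p.2 F hF.2 n
        rwa [Subalgebra.smul_def, smul_eq_mul]⟩ }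
  have hN : N.FG := by
    have : IsNoetherian P M0 := isNoetherian_of_fg_of_noetherian M0 hM0
    have hle : N ≤ M0 := fun F hF => hF.1
    have h1 := IsNoetherian.noetherian (N.comap M0.subtype)
    have h2 := h1.map M0.subtype
    rwa [Submodule.map_comap_subtype, inf_eq_right.2 hle] at h2
  obtain ⟨T, hT⟩ := hN
  let j := T.sup natDegree
  let W2 : ℕ → Submodule R B := fun n =>
    (if n ≤ j then im (IB B Q n) else im (Q ^ (n - j))) ⊔ extSub B (Q ^ (n + 1))
  have hW2 : ∀ n i b, b ∈ W2 n → x i • b ∈ W2 (n + 1) := by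
    intro n i b hb
    obtain ⟨u, hu, v, hv, rfl⟩ := Submodule.mem_sup.1 hb
    rw [smul_add]
    refine Submodule.add_mem_sup ?_ (hext _ _ _ hv)
    by_cases h1 : n + 1 ≤ j
    · rw [if_pos (by omega)] at hu
      rw [if_pos h1]
      obtain ⟨a, ha, rfl⟩ := hu
      exact ⟨x i * a, IB_mul Q ha (by simpa using hxQ i), by simp [Algebra.smul_def]⟩
    · rw [if_neg h1]
      by_cases h2 : n ≤ j
      · rw [if_pos h2] at hu
        obtain ⟨a, ha, rfl⟩ := hu
        have : n + 1 - j = 1 := by omega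
        exact ⟨x i * a, by rw [this, pow_one]; exact Ideal.mul_mem_right _ _ (hxQ i),
          by simp [Algebra.smul_def]⟩
      · rw [if_neg h2] at hu
        obtain ⟨a, ha, rfl⟩ := hu
        have : n + 1 - j = (n - j) + 1 := by omega
        exact ⟨x i * a, by rw [this, pow_succ']; exact Ideal.mul_mem_mul (hxQ i) ha,
          by simp [Algebra.smul_def]⟩
  have hNW : ∀ F ∈ N, ∀ n, F.coeff n ∈ W2 n := by
    intro F hF
    rw [← hT] at hF
    induction hF using Submodule.span_induction with
    | mem F hF =>
      intro n
      by_cases hn : n ≤ j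
      · have h1 : F ∈ N := by rw [← hT]; exact Submodule.subset_span hF
        have := h1.2 n
        simp only [W2, if_pos hn]
        exact this
      · have h2 : F.natDegree ≤ j := Finset.le_sup (f := natDegree) (Finset.mem_coe.1 hF)
        rw [coeff_eq_zero_of_natDegree_lt (by omega)]
        exact zero_mem _
    | zero => intro n; simp
    | add u v _ _ hu hv => intro n; rw [coeff_add]; exact add_mem (hu n) (hv n)
    | smul p F _ hF =>
      intro n
      rw [Subalgebra.smul_def, smul_eq_mul]
      exact key W2 hW2 p.1 p.2 F hF n
  refine ⟨j + 1, fun n hn a ha => ?_⟩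
  have h1 := hV n ha
  rw [mem_JV, Submodule.smul_sup, Submodule.mem_sup] at h1
  obtain ⟨u, hu, v, hv, huv⟩ := h1
  have hv' : v ∈ extSub B (Q ^ (n + 1)) := by
    rw [extSub_eq, ← mul_smul, ← pow_succ] at hv
    rwa [extSub_eq]
  have huN : (monomial n u : B[X]) ∈ N := by
    refine ⟨?_, fun k => ?_⟩
    · obtain ⟨w, hw, rfl⟩ := (mem_pow_smul_iff x n V0).1 hu
      rw [map_sum]
      refine sum_mem fun α hα => ?_
      have h3 : monomial n (mon x α • w α) = (mon y α) * C (w α) := by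
        rw [mem_Dg] at hα
        simp only [mon, y, mul_pow, Finset.prod_mul_distrib]
        rw [Finset.prod_pow_eq_pow_sum, hα, Algebra.smul_def, map_prod]
        simp only [map_pow, ← C_mul_X_pow_eq_monomial, C_mul, map_prod]
        ring
      rw [h3]
      have h4 : mon y α ∈ P := prod_mem fun i _ => pow_mem (Algebra.subset_adjoin (Set.mem_range_self i)) _
      exact M0.smul_mem (⟨_, h4⟩ : P) (Submodule.subset_span ⟨w α, hw α, rfl⟩)
    · rw [coeff_monomial]
      split_ifs with hk
      · subst hk
        have : u = algebraMap R B a - v := by rw [← huv]; ring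
        rw [this]
        refine sub_mem (Submodule.mem_sup_left ⟨a, ha, rfl⟩) (Submodule.mem_sup_right hv')
      · exact zero_mem _
  have h5 := hNW _ huN n
  rw [coeff_monomial, if_pos rfl] at h5
  simp only [W2] at h5
  rw [if_neg (by omega), Submodule.mem_sup] at h5
  obtain ⟨_, ⟨c, hc, rfl⟩, v2, hv2, h6⟩ := h5
  rw [Submodule.mem_sup]
  refine ⟨c, Ideal.pow_le_pow_right (by omega) hc, a - c, ?_, by ring⟩
  rw [mem_IB, map_sub]
  have : algebraMap R B a - algebraMap R B c = v2 + v := by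
    rw [← huv, ← h6, Algebra.linearMap_apply]; ring
  rw [this]
  exact add_mem hv2 hv'

theorem s2 (Q : Ideal R) (hchev : ∀ n, ∃ k, IB B Q k ≤ Q ^ n) (j : ℕ)
    (hj : ∀ n ≥ j, IB B Q n ≤ Q ^ (n - j) ⊔ IB B Q (n + 1)) :
    ∀ n ≥ j, IB B Q n ≤ Q ^ (n - j) := by
  intro n hn
  have h1 : ∀ t, IB B Q n ≤ Q ^ (n - j) ⊔ IB B Q (n + t) := by
    intro t
    induction t with
    | zero => exact le_sup_right
    | succ t ih =>
      refine ih.trans (sup_le le_sup_left ((hj (n + t) (by omega)).trans (sup_le ?_ le_sup_right)))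
      exact (Ideal.pow_le_pow_right (by omega)).trans le_sup_left
  obtain ⟨k, hk⟩ := hchev (n - j)
  exact (h1 k).trans (sup_le le_rfl ((IB_anti Q (by omega)).trans hk))

end S2

end Piece04

section Piece05

open IsLocalRing

section Asym

/-- Hilbert polynomial expression -/
def HP (D : ℕ) (e : ℕ → ℤ) (n : ℕ) : ℤ :=
  ∑ i ∈ Finset.range (D + 1), (-1) ^ i * e i * ((n + D - i).choose (D - i) : ℤ)

theorem HP_bound (D k : ℕ) (c : ℕ → ℤ) (hc : ∀ i < k, c i = 0) :
    ∃ C : ℤ, 0 ≤ C ∧ ∀ n : ℕ, ((n : ℤ) + 1) ^ k * |HP D c n| ≤ C * ((n : ℤ) + 1) ^ D := by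
  refine ⟨∑ i ∈ Finset.range (D + 1), |c i|, Finset.sum_nonneg fun i _ => abs_nonneg _, fun n => ?_⟩
  rw [HP, Finset.sum_mul]
  calc _ ≤ ((n : ℤ) + 1) ^ k * ∑ i ∈ Finset.range (D + 1),
        |(-1) ^ i * c i * ((n + D - i).choose (D - i) : ℤ)| :=
        mul_le_mul_of_nonneg_left (Finset.abs_sum_le_sum_abs _ _) (by positivity)
    _ ≤ _ := by
      rw [Finset.mul_sum]
      refine Finset.sum_le_sum fun i hi => ?_
      rw [abs_mul, abs_mul, abs_pow, abs_neg, abs_one, one_pow, one_mul, Nat.abs_cast]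
      by_cases hik : i < k
      · simp [hc i hik]
      · push Not at hik
        have hiD : i ≤ D := by simpa [Nat.lt_succ_iff] using hi
        have h1 : n + D - i = n + (D - i) := by omega
        have h2 : (((n + D - i).choose (D - i) : ℕ) : ℤ) ≤ ((n : ℤ) + 1) ^ (D - i) := by
          rw [h1]; exact_mod_cast choose_le_pow' n (D - i)
        calc ((n : ℤ) + 1) ^ k * (|c i| * ((n + D - i).choose (D - i) : ℤ))
            ≤ ((n : ℤ) + 1) ^ k * (|c i| * ((n : ℤ) + 1) ^ (D - i)) := by gcongr
          _ = |c i| * ((n : ℤ) + 1) ^ (k + (D - i)) := by rw [pow_add]; ring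
          _ ≤ |c i| * ((n : ℤ) + 1) ^ D := by
            gcongr
            · linarith [Int.natCast_nonneg n]
            · omega

theorem HP_sub (D : ℕ) (e e' : ℕ → ℤ) (n : ℕ) :
    HP D e n - HP D e' n = HP D (fun i => e i - e' i) n := by
  rw [HP, HP, HP, ← Finset.sum_sub_distrib]
  exact Finset.sum_congr rfl fun i _ => by ring

theorem HP_lead (D : ℕ) (e : ℕ → ℤ) (n : ℕ) :
    HP D e n = e 0 * ((n + D).choose D : ℤ) + HP D (fun i => if i = 0 then 0 else e i) n := by
  rw [HP, HP, Finset.sum_range_succ', Finset.sum_range_succ']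
  simp
  ring

theorem choose_shift (d j n : ℕ) : ((n + j + (d + 1)).choose (d + 1)) ≤
    (n + (d + 1)).choose (d + 1) + j * (n + j + 1) ^ d := by
  induction j with
  | zero => simp
  | succ j ih =>
    have h1 : n + (j + 1) + (d + 1) = (n + j + (d + 1)) + 1 := by ring
    rw [h1, Nat.choose_succ_succ]
    have h2 := choose_le_pow' (n + (j + 1)) d
    have h3 : n + (j + 1) + d = n + j + (d + 1) := by ring
    rw [h3] at h2
    have h4 : (n + j + 1) ^ d ≤ (n + (j + 1) + 1) ^ d := Nat.pow_le_pow_left (by omega) _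
    nlinarith [Nat.mul_le_mul_left j h4]

theorem asym (d : ℕ) (e e' : ℕ → ℤ) (N j : ℕ) (f g : ℕ → ℕ)
    (hf : ∀ n ≥ N, (f n : ℤ) = HP (d + 1) e n) (hg : ∀ n ≥ N, (g n : ℤ) = HP (d + 1) e' n)
    (hgf : ∀ n, g n ≤ f n) (hfg : ∀ n, f n ≤ g (n + j)) (h1 : e' 1 = e 1) :
    ∃ C : ℤ, 0 ≤ C ∧ ∀ n ≥ N, ((n : ℤ) + 1) * ((f n : ℤ) - g n) ≤ C * ((n : ℤ) + 1) ^ d := by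
  -- leading coefficients agree
  have hE : e 0 = e' 0 := by
    have hpc : ∀ n : ℕ, ((n : ℤ) + 1) ^ (d + 1) ≤
        ((d + 1).factorial : ℤ) * ((n + (d + 1)).choose (d + 1) : ℤ) := fun n => by
      exact_mod_cast pow_le_choose' n (d + 1)
    obtain ⟨C1, hC1, hb1⟩ := HP_bound (d + 1) 1
      (fun i => if i = 0 then 0 else (e i - e' i)) (by simp)
    obtain ⟨C2, hC2, hb2⟩ := HP_bound (d + 1) 1
      (fun i => if i = 0 then 0 else e i) (by simp)
    have canc : ∀ (n : ℕ) (z C : ℤ), ((n : ℤ) + 1) ^ 1 * z ≤ C * ((n : ℤ) + 1) ^ (d + 1) →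
        z ≤ C * ((n : ℤ) + 1) ^ d := by
      intro n z C h
      have hp : (0 : ℤ) < (n : ℤ) + 1 := by positivity
      refine le_of_mul_le_mul_left ?_ hp
      calc _ = ((n : ℤ) + 1) ^ 1 * z := by ring
        _ ≤ _ := h
        _ = _ := by ring
    have hdiff : ∀ n ≥ N, (f n : ℤ) - g n = (e 0 - e' 0) * ((n + (d + 1)).choose (d + 1) : ℤ)
        + HP (d + 1) (fun i => if i = 0 then 0 else (e i - e' i)) n := fun n hn => by
      rw [hf n hn, hg n hn, HP_sub, HP_lead]
    -- general conclusion principle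
    have prin : ∀ (N : ℕ) (E K : ℤ), 0 ≤ K → (∀ n ≥ N, E * ((n + (d + 1)).choose (d + 1) : ℤ) ≤
        K * ((n : ℤ) + 1) ^ d) → E ≤ 0 := by
      intro N E K hK h
      by_contra hE
      push Not at hE
      set n := N + ((d + 1).factorial * K).toNat with hn
      have h2 := h n (by omega)
      have h3 : ((d + 1).factorial : ℤ) * K ≤ n := by
        rw [hn]; push_cast
        have := Int.self_le_toNat ((d + 1).factorial * K)
        linarith [Int.natCast_nonneg N]
      have h4 : ((n : ℤ) + 1) ^ (d + 1) ≤ (d + 1).factorial * K * ((n : ℤ) + 1) ^ d := by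
        calc _ ≤ _ := hpc n
          _ ≤ ((d + 1).factorial : ℤ) * (E * ((n + (d + 1)).choose (d + 1) : ℤ)) := by
            gcongr
            have : (0 : ℤ) ≤ ((n + (d + 1)).choose (d + 1) : ℤ) := by positivity
            nlinarith
          _ ≤ ((d + 1).factorial : ℤ) * (K * ((n : ℤ) + 1) ^ d) := by gcongr
          _ = _ := by ring
      rw [pow_succ'] at h4
      have hp : (0 : ℤ) < ((n : ℤ) + 1) ^ d := by positivity
      have := le_of_mul_le_mul_right h4 hp
      linarith
    apply le_antisymm
    · -- e 0 - e' 0 ≤ 0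
      have := prin (N + j) (e 0 - e' 0) (|e 0| * j + C2 + C2 + C1) (by positivity) ?_
      · linarith
      intro m hm
      obtain ⟨n, rfl⟩ : ∃ n, m = n + j := ⟨m - j, by omega⟩
      have a1 := canc _ _ _ (hb1 (n + j))
      have a2 := canc _ _ _ (hb2 (n + j))
      have a3 := canc _ _ _ (hb2 n)
      have a4 := hdiff (n + j) (by omega)
      have a5 : (f n : ℤ) ≤ g (n + j) := by exact_mod_cast hfg n
      have a6 := hf n (by omega)
      have a7 := hf (n + j) (by omega)
      rw [HP_lead] at a6 a7
      have a8 : (((n + j + (d + 1)).choose (d + 1) : ℕ) : ℤ) -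
          ((n + (d + 1)).choose (d + 1) : ℕ) ≤ j * (((n + j : ℕ) : ℤ) + 1) ^ d := by
        have := choose_shift d j n
        have h : (((n + j + (d + 1)).choose (d + 1) : ℕ) : ℤ) ≤
          ((n + (d + 1)).choose (d + 1) : ℕ) + j * (((n + j : ℕ) : ℤ) + 1) ^ d := by
          exact_mod_cast this
        linarith
      have a9 : (((n + (d + 1)).choose (d + 1) : ℕ) : ℤ) ≤ ((n + j + (d + 1)).choose (d + 1) : ℕ) := by
        exact_mod_cast Nat.choose_le_choose _ (by omega)
      have a10 : e 0 * ((((n + j + (d + 1)).choose (d + 1) : ℕ) : ℤ) -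
          ((n + (d + 1)).choose (d + 1) : ℕ)) ≤ |e 0| * (j * (((n + j : ℕ) : ℤ) + 1) ^ d) := by
        calc _ ≤ |e 0| * ((((n + j + (d + 1)).choose (d + 1) : ℕ) : ℤ) -
          ((n + (d + 1)).choose (d + 1) : ℕ)) :=
              mul_le_mul_of_nonneg_right (le_abs_self _) (by linarith)
          _ ≤ _ := mul_le_mul_of_nonneg_left a8 (abs_nonneg _)
      have a11 : C2 * ((n : ℤ) + 1) ^ d ≤ C2 * (((n + j : ℕ) : ℤ) + 1) ^ d := by
        gcongr; omega
      have b1 := neg_abs_le (HP (d + 1) (fun i => if i = 0 then 0 else (e i - e' i)) (n + j))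
      have b2 := le_abs_self (HP (d + 1) (fun i => if i = 0 then 0 else e i) (n + j))
      have b3 := neg_abs_le (HP (d + 1) (fun i => if i = 0 then 0 else e i) n)
      rw [mul_sub] at a10
      have : (|e 0| * j + C2 + C2 + C1) * (((n + j : ℕ) : ℤ) + 1) ^ d =
        |e 0| * (j * (((n + j : ℕ) : ℤ) + 1) ^ d) + C2 * (((n + j : ℕ) : ℤ) + 1) ^ d +
        C2 * (((n + j : ℕ) : ℤ) + 1) ^ d + C1 * (((n + j : ℕ) : ℤ) + 1) ^ d := by ring
      rw [this]
      linarith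
    · have := prin N (e' 0 - e 0) C1 hC1 (fun n hn => ?_)
      · linarith
      have h2 := canc n _ _ (hb1 n)
      have h3 := hdiff n hn
      have h4 : (g n : ℤ) ≤ f n := by exact_mod_cast hgf n
      have h5 := le_abs_self (HP (d + 1) (fun i => if i = 0 then 0 else (e i - e' i)) n)
      nlinarith
  obtain ⟨C, hC, hb⟩ := HP_bound (d + 1) 2 (fun i => e i - e' i) (by
    intro i hi
    interval_cases i
    · simp [hE]
    · simp [h1])
  refine ⟨C, hC, fun n hn => ?_⟩
  have h2 := hb n
  rw [← HP_sub, ← hf n hn, ← hg n hn] at h2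
  have hp : (0 : ℤ) < (n : ℤ) + 1 := by positivity
  refine le_of_mul_le_mul_left ?_ hp
  calc ((n : ℤ) + 1) * (((n : ℤ) + 1) * ((f n : ℤ) - g n))
      = ((n : ℤ) + 1) ^ 2 * ((f n : ℤ) - g n) := by ring
    _ ≤ ((n : ℤ) + 1) ^ 2 * |(f n : ℤ) - g n| := by
      gcongr; exact le_abs_self _
    _ ≤ _ := h2
    _ = _ := by ring

end Asym

end Piece05

section Piece06

open IsLocalRing

section Core
variable {R B : Type*} [CommRing R] [CommRing B] [Algebra R B] {d : ℕ}

theorem hilb_lam {D : ℕ} {J : ℕ → Ideal R} {e : ℕ → ℤ} (h : HasHilbertSeries R D J e) :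
    ∃ N, ∀ n ≥ N, (lam (J (n + 1)) : ℤ) = HP D e n := by
  obtain ⟨N, hN⟩ := h
  refine ⟨N, fun n hn => ?_⟩
  obtain ⟨m, h1, h2⟩ := hN n hn
  rw [moduleLength, ← Module.coe_length] at h1
  have h3 : Module.length R (R ⧸ J (n + 1)) = (m : ℕ∞) := by exact_mod_cast h1
  rw [lam, h3, ENat.toNat_natCast, h2, HP]

theorem JV_range (Q : Ideal R) (n : ℕ) :
    JV Q n (LinearMap.range (Algebra.linearMap R B) ⊔ extSub B Q) = Q ^ n ⊔ IB B Q (n + 1) := by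
  have e1 : (Q ^ n) • LinearMap.range (Algebra.linearMap R B) =
      Submodule.map (Algebra.linearMap R B) (Q ^ n) := by
    rw [LinearMap.range_eq_map, ← Submodule.map_smul'']
    simp
  have e2 : (Q ^ n) • extSub B Q = extSub B (Q ^ (n + 1)) := by
    rw [extSub_eq, extSub_eq, ← mul_smul, ← pow_succ]
  ext a
  rw [mem_JV, Submodule.smul_sup, e1, e2, Submodule.mem_sup, Submodule.mem_sup]
  constructor
  · rintro ⟨_, ⟨c, hc, rfl⟩, v, hv, h⟩
    refine ⟨c, hc, a - c, ?_, by ring⟩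
    rw [mem_IB, map_sub, ← h]
    simpa using hv
  · rintro ⟨c, hc, v, hv, rfl⟩
    exact ⟨_, ⟨c, hc, rfl⟩, _, hv, by simp⟩

theorem core_succ [IsLocalRing R] [IsNoetherianRing R] (x : Fin (d + 1) → R)
    (hreg : REG (fun j => algebraMap R B (x j)))
    (hm : ∃ N, maximalIdeal R ^ N ≤ Ideal.span (Set.range x))
    (hchev : ∀ n, ∃ k, IB B (Ideal.span (Set.range x)) k ≤ Ideal.span (Set.range x) ^ n)
    (eB e : ℕ → ℤ) (hB : HasHilbertSeries R (d + 1) (IB B (Ideal.span (Set.range x))) eB)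
    (hR : HasHilbertSeries R (d + 1) (fun n => Ideal.span (Set.range x) ^ n) e)
    (h1 : eB 1 = e 1) : IB B (Ideal.span (Set.range x)) 1 ≤ Ideal.span (Set.range x) := by
  obtain ⟨N1, hB⟩ := hilb_lam hB
  obtain ⟨N2, hR⟩ := hilb_lam hR
  have hbd : ∃ C N : ℕ, ∀ n ≥ N, lam (IB B (Ideal.span (Set.range x)) (n + 1)) ≤
      C * (n + 1) ^ (d + 1) := by
    obtain ⟨C, hC, hb⟩ := HP_bound (d + 1) 0 eB (by simp)
    refine ⟨C.toNat, N1, fun n hn => ?_⟩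
    have h2 := hb n
    rw [← hB n hn, pow_zero, one_mul, abs_of_nonneg (by positivity)] at h2
    have : ((C.toNat : ℕ) : ℤ) = C := Int.toNat_of_nonneg hC
    rw [← this] at h2
    exact_mod_cast h2
  obtain ⟨V0, hfg, hV⟩ := s1 x hreg hm hbd
  obtain ⟨j, hj⟩ := s2_aux x V0 hfg hV
  have hs2 := s2 _ hchev j hj
  set Q := Ideal.span (Set.range x) with hQ
  have hQfin : ∀ n, Module.length R (R ⧸ Q ^ n) ≠ ⊤ := fun n => by
    obtain ⟨N, hN⟩ := hm
    exact length_quot_ne_top (pow_le_of_le hN n)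
  obtain ⟨C, hC, hCb⟩ := asym d e eB (max N1 N2) j (fun n => lam (Q ^ (n + 1)))
    (fun n => lam (IB B Q (n + 1))) (fun n hn => hR n (le_of_max_le_right hn))
    (fun n hn => hB n (le_of_max_le_left hn))
    (fun n => lam_mono (pow_le_IB Q _) (hQfin _))
    (fun n => by
      have := hs2 (n + j + 1) (by omega)
      have h3 : n + j + 1 - j = n + 1 := by omega
      rw [h3] at this
      exact lam_mono this (IB_fin hm _)) h1
  have key : ∀ s, IB B Q s ≤ Q ^ s ⊔ IB B Q (s + 1) := by
    intro s a ha
    by_contra hna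
    rw [← JV_range] at hna
    set V := LinearMap.range (Algebra.linearMap R B) ⊔ extSub B Q with hVdef
    have hQV : extSub B Q ≤ V := le_sup_right
    have hg : ∀ t, lam (IB B Q (s + t)) + (t + d).choose d ≤ lam (Q ^ (s + t)) := by
      intro t
      have h2 := growth x hreg hm V hQV s t a ha hna (IB B Q (s + t)) (JV_le _ _ _)
        (fun q hq => IB_mul Q ha hq)
      rw [card_Dg] at h2
      have hf := JV_fin (B := B) hm (s + t) V hQV
      have h3 : lam (IB B Q (s + t)) + (t + d).choose d ≤ lam (JV Q (s + t) V) := by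
        have h4 := ENat.toNat_le_toNat h2 hf
        rwa [ENat.toNat_add (IB_fin hm _) (ENat.natCast_ne_top _), ENat.toNat_natCast] at h4
      refine h3.trans (lam_mono ?_ (hQfin _))
      rw [hVdef, JV_range]
      exact le_sup_left
    set K := (d.factorial * C * 2 ^ d).toNat with hK
    have hK' : (d.factorial * C * 2 ^ d : ℤ) ≤ K := Int.self_le_toNat _
    set t := max N1 N2 + s + K + 1 with ht
    have h2 := hg t
    obtain ⟨n, hn⟩ : ∃ n, s + t = n + 1 := ⟨s + t - 1, by omega⟩
    rw [hn] at h2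
    have h3 := hCb n (by omega)
    have h4 : ((t + d).choose d : ℤ) ≤ (lam (Q ^ (n + 1)) : ℤ) - lam (IB B Q (n + 1)) := by
      have : ((lam (IB B Q (n + 1)) + (t + d).choose d : ℕ) : ℤ) ≤ (lam (Q ^ (n + 1)) : ℕ) := by
        exact_mod_cast h2
      push_cast at this
      linarith
    have h5 : ((t : ℤ) + 1) ^ d ≤ (d.factorial : ℤ) * ((t + d).choose d : ℤ) := by
      exact_mod_cast pow_le_choose' t d
    have h6 : ((n : ℤ) + 1) ^ d ≤ 2 ^ d * ((t : ℤ) + 1) ^ d := by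
      rw [← mul_pow]
      gcongr
      have : n + 1 ≤ 2 * (t + 1) := by omega
      exact_mod_cast this
    have h7 : ((n : ℤ) + 1) * ((t : ℤ) + 1) ^ d ≤ (d.factorial * C * 2 ^ d) * ((t : ℤ) + 1) ^ d := by
      calc ((n : ℤ) + 1) * ((t : ℤ) + 1) ^ d
          ≤ ((n : ℤ) + 1) * ((d.factorial : ℤ) * ((t + d).choose d : ℤ)) := by gcongr
        _ = (d.factorial : ℤ) * (((n : ℤ) + 1) * ((t + d).choose d : ℤ)) := by ring
        _ ≤ (d.factorial : ℤ) * (C * (2 ^ d * ((t : ℤ) + 1) ^ d)) := by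
          refine mul_le_mul_of_nonneg_left ?_ (by positivity)
          exact (mul_le_mul_of_nonneg_left h4 (by positivity)).trans
            (h3.trans (mul_le_mul_of_nonneg_left h6 hC))
        _ = _ := by ring
    have h8 := le_of_mul_le_mul_right h7 (by positivity)
    have : (K : ℤ) < n + 1 := by
      have : K < n + 1 := by omega
      exact_mod_cast this
    linarith
  have h2 := s2 (B := B) Q hchev 0 (fun n _ => by simpa using key n) 1 (by omega)
  simpa using h2

theorem core [IsLocalRing R] [IsNoetherianRing R] (x : Fin d → R)
    (hreg : REG (fun j => algebraMap R B (x j)))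
    (hm : ∃ N, maximalIdeal R ^ N ≤ Ideal.span (Set.range x))
    (hchev : ∀ n, ∃ k, IB B (Ideal.span (Set.range x)) k ≤ Ideal.span (Set.range x) ^ n)
    (eB e : ℕ → ℤ) (hB : HasHilbertSeries R d (IB B (Ideal.span (Set.range x))) eB)
    (hR : HasHilbertSeries R d (fun n => Ideal.span (Set.range x) ^ n) e)
    (h1 : eB 1 = e 1) : IB B (Ideal.span (Set.range x)) 1 ≤ Ideal.span (Set.range x) := by
  cases d with
  | succ d => exact core_succ x hreg hm hchev eB e hB hR h1
  | zero =>
    obtain ⟨k, hk⟩ := hchev 1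
    have hQ : Ideal.span (Set.range x) = ⊥ := by simp
    have h2 : IB B (Ideal.span (Set.range x)) 1 ≤ IB B (Ideal.span (Set.range x)) k := by
      cases k with
      | zero => intro a _; rw [mem_IB, mem_extSub]; exact Ideal.mem_map_of_mem _ (by simp)
      | succ k =>
        rw [hQ]
        intro a ha
        rw [mem_IB, mem_extSub] at *
        rw [← Ideal.zero_eq_bot] at *
        simpa using ha
    simpa using h2.trans hk

end Core

end Piece06

section Piece07

open IsLocalRing RingTheory.Sequence

section Contr

theorem weakReg_ofFn_iff {A : Type*} [CommRing A] {d : ℕ} (x : Fin d → A) :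
    IsWeaklyRegular A (List.ofFn x) ↔ ∀ i b, x i * b ∈ Ideal.span (x '' {j | j < i}) →
      b ∈ Ideal.span (x '' {j | j < i}) := by
  have hl : (List.ofFn x).length = d := List.length_ofFn
  have htake : ∀ i : Fin d, Ideal.ofList ((List.ofFn x).take i) = Ideal.span (x '' {j | j < i}) := by
    intro i
    unfold Ideal.ofList
    congr 1
    ext z
    simp only [List.mem_take_iff_getElem, Set.mem_image, Set.mem_ofPred_eq, List.getElem_ofFn]
    constructor
    · rintro ⟨k, hk, rfl⟩
      have : k < d := by omega
      exact ⟨⟨k, this⟩, by simp [Fin.lt_def]; omega, rfl⟩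
    · rintro ⟨j, hj, rfl⟩
      exact ⟨j, by have := j.2; have : (j : ℕ) < i := hj; simp; omega, rfl⟩
  have hreg : ∀ (I : Ideal A) (r : A), IsSMulRegular (A ⧸ (I • (⊤ : Submodule A A))) r ↔
      ∀ b, r * b ∈ I → b ∈ I := by
    intro I r
    have hI : I • (⊤ : Submodule A A) = I := by simp
    rw [isSMulRegular_quotient_iff_mem_of_smul_mem, hI]
    rfl
  constructor
  · intro h i b hb
    have h1 := h.regular_mod_prev i (by rw [hl]; exact i.2)
    rw [htake, hreg] at h1
    simp only [List.getElem_ofFn] at h1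
    exact h1 b hb
  · intro h
    refine ⟨fun i hi => ?_⟩
    have hi' : i < d := by rwa [hl] at hi
    have h1 := htake ⟨i, hi'⟩
    simp only at h1
    rw [h1, hreg]
    simp only [List.getElem_ofFn]
    exact h ⟨i, hi'⟩

variable {R B : Type*} [CommRing R] [CommRing B] [Algebra R B] {d : ℕ}

theorem krull_closed [IsLocalRing R] [IsNoetherianRing R] (J : Ideal R) (a : R)
    (h : ∀ n, a ∈ J ⊔ maximalIdeal R ^ n) : a ∈ J := by
  have h1 : (Ideal.Quotient.mk J a) ∈ (⨅ i : ℕ, maximalIdeal R ^ i • ⊤ : Submodule R (R ⧸ J)) := by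
    rw [Submodule.mem_iInf]
    intro n
    obtain ⟨u, hu, v, hv, rfl⟩ := Submodule.mem_sup.1 (h n)
    have : Ideal.Quotient.mk J (u + v) = v • (1 : R ⧸ J) := by
      rw [map_add, Ideal.Quotient.eq_zero_iff_mem.2 hu, zero_add, Algebra.smul_def, mul_one]; rfl
    rw [this]
    exact Submodule.smul_mem_smul hv trivial
  rw [Ideal.iInf_pow_smul_eq_bot_of_isLocalRing _ (Ideal.IsPrime.ne_top'), Submodule.mem_bot] at h1
  exact Ideal.Quotient.eq_zero_iff_mem.1 h1

theorem REG.sub [IsLocalRing R] [IsNoetherianRing R] {x : Fin d → R} (h : REG x)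
    (hx : ∀ i, x i ∈ maximalIdeal R) (T : Set (Fin d)) (i : Fin d) (hi : i ∉ T) (b : R)
    (hb : x i * b ∈ Ideal.span (x '' T)) : b ∈ Ideal.span (x '' T) := by
  classical
  refine krull_closed _ _ fun n => ?_
  have h1 := h i (fun j => if j ∈ T then 1 else n) b (by
    refine Ideal.span_mono ?_ hb
    rintro _ ⟨j, hj, rfl⟩
    exact ⟨j, fun h => hi (h ▸ hj), by simp [hj]⟩)
  refine (Ideal.span_le.2 ?_) h1
  rintro _ ⟨j, -, rfl⟩
  by_cases hj : j ∈ T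
  · simp only [hj, if_true, pow_one]
    exact Ideal.mem_sup_left (Ideal.subset_span ⟨j, hj, rfl⟩)
  · simp only [hj, if_false]
    exact Ideal.mem_sup_right (Ideal.pow_mem_pow (hx j) n)

theorem REG.weak [IsLocalRing R] [IsNoetherianRing R] {x : Fin d → R} (h : REG x)
    (hx : ∀ i, x i ∈ maximalIdeal R) : IsWeaklyRegular R (List.ofFn x) := by
  rw [weakReg_ofFn_iff]
  exact fun i b hb => h.sub hx _ i (by simp) b hb

theorem REG.isRegular [IsLocalRing R] [IsNoetherianRing R] {x : Fin d → R} (h : REG x)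
    (hx : ∀ i, x i ∈ maximalIdeal R) : IsRegular R (List.ofFn x) := by
  refine ⟨h.weak hx, fun h1 => ?_⟩
  have h2 : Ideal.ofList (List.ofFn x) ≤ maximalIdeal R := by
    refine Ideal.span_le.2 fun z hz => ?_
    simp only [Set.mem_ofPred_eq, List.mem_ofFn] at hz
    obtain ⟨i, rfl⟩ := hz
    exact hx i
  have h3 : Ideal.ofList (List.ofFn x) = ⊤ := by rw [h1]; simp
  exact Ideal.IsPrime.ne_top' (top_le_iff.1 (h3 ▸ h2))

theorem IsSOP.mem [IsLocalRing R] {x : Fin d → R} (h : IsSOP R x) (i) : x i ∈ maximalIdeal R := by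
  rw [← h.2]; exact Ideal.le_radical (Ideal.subset_span ⟨i, rfl⟩)

theorem REG.isCM [IsLocalRing R] [IsNoetherianRing R] {x : Fin d → R} (h : REG x)
    (hx : IsSOP R x) : IsCohenMacaulayLocalRing R := by
  refine ⟨inferInstance, inferInstance, d, hx.1, List.ofFn x, List.length_ofFn, ?_, h.isRegular hx.mem⟩
  intro r hr
  obtain ⟨i, rfl⟩ := (List.mem_ofFn' _ _).1 hr
  exact maximalIdeal_le_jacobson _ (hx.mem i)

theorem IsSOP.pow [IsLocalRing R] {x : Fin d → R} (h : IsSOP R x) (s : Fin d → ℕ)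
    (hs : ∀ i, 0 < s i) : IsSOP R (fun i => x i ^ s i) := by
  refine ⟨h.1, le_antisymm ?_ ?_⟩
  · rw [← h.2]
    refine Ideal.radical_mono (Ideal.span_le.2 ?_)
    rintro _ ⟨i, rfl⟩
    exact Ideal.pow_mem_of_mem _ (Ideal.subset_span (Set.mem_range_self i)) _ (hs i)
  · rw [← h.2, Ideal.radical_le_radical_iff, Ideal.span_le]
    rintro _ ⟨i, rfl⟩
    exact ⟨s i, Ideal.subset_span ⟨i, rfl⟩⟩

theorem IsSOP.perm [IsLocalRing R] {x : Fin d → R} (h : IsSOP R x) (σ : Equiv.Perm (Fin d)) :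
    IsSOP R (fun i => x (σ i)) := by
  refine ⟨h.1, ?_⟩
  rw [← h.2]
  congr 2
  exact σ.surjective.range_comp x

theorem balanced_REG [IsLocalRing R] (hB : IsBalancedBigCM R B) {x : Fin d → R} (hx : IsSOP R x) :
    REG (fun j => algebraMap R B (x j)) := by
  classical
  intro i s b hb
  by_cases hs : ∃ j, j ≠ i ∧ s j = 0
  · obtain ⟨j, hj, h0⟩ := hs
    have : Ideal.span {z | ∃ j, j ≠ i ∧ z = (fun j => algebraMap R B (x j)) j ^ s j} = ⊤ := by
      rw [Ideal.eq_top_iff_one]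
      exact Ideal.subset_span ⟨j, hj, by simp [h0]⟩
    rw [this]; trivial
  push Not at hs
  obtain ⟨d, rfl⟩ : ∃ d', d = d' + 1 := ⟨d - 1, by have := i.2; omega⟩
  let s' : Fin (d + 1) → ℕ := fun j => if j = i then 1 else s j
  have hs' : ∀ j, 0 < s' j := fun j => by
    by_cases h : j = i
    · simp [s', h]
    · simp [s', h, Nat.pos_of_ne_zero (hs j h)]
  let σ : Equiv.Perm (Fin (d + 1)) := Equiv.swap i (Fin.last d)
  have h1 := (hB.1 _ _ ((hx.pow s' hs').perm σ)).toIsWeaklyRegular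
  rw [weakReg_ofFn_iff] at h1
  have h2 := h1 (Fin.last d) b
  have h3 : (fun k => algebraMap R B (x (σ k) ^ s' (σ k))) '' {j | j < Fin.last d} =
      {z | ∃ j, j ≠ i ∧ z = (fun j => algebraMap R B (x j)) j ^ s j} := by
    ext z
    simp only [Set.mem_image, Set.mem_ofPred_eq]
    constructor
    · rintro ⟨k, hk, rfl⟩
      have : σ k ≠ i := by
        intro h
        have : k = Fin.last d := by rw [← σ.injective.eq_iff, h]; simp [σ]
        exact absurd this (ne_of_lt hk)
      exact ⟨σ k, this, by simp [s', this]⟩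
    · rintro ⟨j, hj, rfl⟩
      refine ⟨σ.symm j, ?_, by simp [s', hj]⟩
      refine lt_of_le_of_ne (Fin.le_last _) ?_
      intro h
      apply hj
      rw [Equiv.symm_apply_eq] at h
      rw [h]; simp [σ]
  rw [h3] at h2
  have h4 : σ (Fin.last d) = i := by simp [σ]
  simp only [h4, s', if_true, pow_one] at h2
  exact h2 hb

/-- contraction of powers of parameters -/
theorem contr_pow {x : Fin d → R} (hreg : REG (fun j => algebraMap R B (x j)))
    (h1 : IB B (Ideal.span (Set.range x)) 1 ≤ Ideal.span (Set.range x)) (s : Fin d → ℕ) (a : R)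
    (ha : algebraMap R B a ∈ Ideal.span (Set.range fun j => algebraMap R B (x j) ^ s j)) :
    a ∈ Ideal.span (Set.range fun j => x j ^ s j) := by
  classical
  induction hn : ∑ j, s j using Nat.strong_induction_on generalizing s a with
  | _ n ih =>
  by_cases h0 : ∃ j, s j = 0
  · obtain ⟨j, h0⟩ := h0
    have : Ideal.span (Set.range fun j => x j ^ s j) = ⊤ := by
      rw [Ideal.eq_top_iff_one]
      exact Ideal.subset_span ⟨j, by simp [h0]⟩
    rw [this]; trivial
  push Not at h0
  by_cases h2 : ∃ i, 2 ≤ s i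
  · obtain ⟨i, hi⟩ := h2
    obtain ⟨m, hm⟩ : ∃ m, s i = m + 1 := ⟨s i - 1, by omega⟩
    have hs : s = Function.update s i (m + 1) := by rw [← hm]; simp
    have hsum : ∀ t, t < s i → ∑ j, (Function.update s i t) j < n := by
      intro t ht
      rw [← hn]
      refine Finset.sum_lt_sum (fun j _ => ?_) ⟨i, Finset.mem_univ _, by simpa using ht⟩
      by_cases hj : j = i
      · subst hj; simpa using ht.le
      · simp [hj]
    have hle : Ideal.span (Set.range fun j => algebraMap R B (x j) ^ s j) ≤
        Ideal.span (Set.range fun j => algebraMap R B (x j) ^ (Function.update s i m) j) := by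
      refine Ideal.span_le.2 ?_
      rintro _ ⟨j, rfl⟩
      by_cases hj : j = i
      · subst hj
        simp only [hm]
        rw [pow_succ]
        exact Ideal.mul_mem_right _ _ (Ideal.subset_span ⟨j, by simp⟩)
      · exact Ideal.subset_span ⟨j, by simp [hj]⟩
    have h3 := ih _ (hsum m (by omega)) _ a (hle ha) rfl
    rw [span_update, Submodule.mem_sup] at h3
    obtain ⟨u, hu, v, hv, rfl⟩ := h3
    obtain ⟨r, rfl⟩ := Ideal.mem_span_singleton'.1 hu
    have hvB : algebraMap R B v ∈ Ideal.span (Set.range fun j => algebraMap R B (x j) ^ s j) := by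
      have := Ideal.mem_map_of_mem (algebraMap R B) hv
      rw [Ideal.map_span] at this
      refine Ideal.span_mono ?_ this
      rintro _ ⟨_, ⟨j, -, rfl⟩, rfl⟩
      exact ⟨j, by simp⟩
    have hr : (fun j => algebraMap R B (x j)) i ^ m * algebraMap R B r ∈ Ideal.span (Set.range fun j =>
        (fun j => algebraMap R B (x j)) j ^ (Function.update s i (m + 1)) j) := by
      rw [← hs]
      have := sub_mem ha hvB
      rw [map_add, add_sub_cancel_right, map_mul, map_pow, mul_comm] at this
      exact this
    have h4 := hreg.step i s m 1 _ hr
    have h5 := ih _ (hsum 1 (by omega)) _ r h4 rfl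
    rw [hs, span_update]
    rw [span_update] at h5
    obtain ⟨u', hu', v', hv', rfl⟩ := Submodule.mem_sup.1 h5
    obtain ⟨r', rfl⟩ := Ideal.mem_span_singleton'.1 hu'
    refine add_mem ?_ (Ideal.mem_sup_right hv)
    rw [add_mul]
    refine add_mem (Ideal.mem_sup_left (Ideal.mem_span_singleton'.2 ⟨r', by ring⟩))
      (Ideal.mem_sup_right (Ideal.mul_mem_right _ _ hv'))
  · push Not at h2
    have : ∀ j, s j = 1 := fun j => by have := h0 j; have := h2 j; omega
    simp only [this, pow_one] at *
    apply h1
    rw [mem_IB, mem_extSub, pow_one, Ideal.map_span, ← Set.range_comp]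
    exact ha

theorem contr_REG [IsLocalRing R] [IsNoetherianRing R] {x : Fin d → R}
    (hx : ∀ i, x i ∈ maximalIdeal R) (hreg : REG (fun j => algebraMap R B (x j)))
    (h1 : IB B (Ideal.span (Set.range x)) 1 ≤ Ideal.span (Set.range x)) : REG x := by
  classical
  intro i s b hb
  refine krull_closed _ _ fun n => ?_
  have h2 := Ideal.mem_map_of_mem (algebraMap R B) hb
  rw [Ideal.map_span] at h2
  have e : (algebraMap R B) '' {z | ∃ j, j ≠ i ∧ z = x j ^ s j} =
      {z | ∃ j, j ≠ i ∧ z = (algebraMap R B (x j)) ^ s j} := by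
    ext z
    constructor
    · rintro ⟨_, ⟨j, hj, rfl⟩, rfl⟩; exact ⟨j, hj, by simp⟩
    · rintro ⟨j, hj, rfl⟩; exact ⟨_, ⟨j, hj, rfl⟩, by simp⟩
  rw [e, map_mul] at h2
  have h3 := hreg i s _ h2
  have h4 : algebraMap R B b ∈ Ideal.span (Set.range fun j => algebraMap R B (x j) ^
      (Function.update s i n) j) := by
    rw [span_update (fun j => algebraMap R B (x j))]
    exact Ideal.mem_sup_right h3
  have h5 := contr_pow hreg h1 _ _ h4
  rw [span_update, sup_comm] at h5
  have h6 : Ideal.span {x i ^ n} ≤ maximalIdeal R ^ n := by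
    rw [Ideal.span_singleton_le_iff_mem]
    exact Ideal.pow_mem_pow (hx i) n
  exact (sup_le_sup_left h6 (Ideal.span {z | ∃ j, j ≠ i ∧ z = x j ^ s j}) :) h5

end Contr

end Piece07

section Piece08

open IsLocalRing

theorem exists_ev {n : ℕ} {k S : Type*} [CommRing k] [CommRing S] (I : Ideal S)
    [IsAdicComplete I S] (φ : k →+* S) (y : Fin n → S) (hy : ∀ i, y i ∈ I) :
    ∃ F : MvPowerSeries (Fin n) k →+* S, ∀ p : MvPolynomial (Fin n) k,
      F (p : MvPowerSeries (Fin n) k) = MvPolynomial.eval₂Hom φ y p := by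
  classical
  set J := MvPolynomial.idealOfVars (Fin n) k with hJ
  have hle : J ≤ I.comap (MvPolynomial.eval₂Hom φ y) := by
    rw [hJ, MvPolynomial.idealOfVars, Ideal.span_le]
    rintro _ ⟨i, rfl⟩
    simpa using hy i
  have hN : ∀ N : ℕ, J ^ N ≤ (I ^ N).comap (MvPolynomial.eval₂Hom φ y) := fun N =>
    (Ideal.pow_right_mono hle N).trans (Ideal.le_comap_pow _ N)
  let T : MvPowerSeries (Fin n) k →+* AdicCompletion J (MvPolynomial (Fin n) k) :=
    (MvPowerSeries.toAdicCompletionAlgEquiv (Fin n) k : _ →+* _)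
  let f : (N : ℕ) → AdicCompletion J (MvPolynomial (Fin n) k) →+* S ⧸ I ^ N := fun N =>
    (Ideal.quotientMap (I ^ N) (MvPolynomial.eval₂Hom φ y) (hN N)).comp
      (AdicCompletion.evalₐ J N : _ →+* _)
  have hf : ∀ {a b : ℕ} (hab : a ≤ b),
      (Ideal.Quotient.factorPow I hab).comp (f b) = f a := by
    intro a b hab
    refine RingHom.ext fun z => ?_
    obtain ⟨z, rfl⟩ := AdicCompletion.mk_surjective _ _ z
    simp only [f, RingHom.comp_apply, RingHom.coe_coe, AdicCompletion.evalₐ_mk,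
      Ideal.quotientMap_mk]
    have := AdicCompletion.Ideal.mk_eq_mk (I := J) hab z
    rw [Ideal.Quotient.eq] at this
    have h2 := hN a this
    rw [Ideal.mem_comap, map_sub, ← Ideal.Quotient.eq] at h2
    exact h2
  refine ⟨(IsAdicComplete.liftRingHom I f hf).comp T, fun p => ?_⟩
  suffices h : (fun p : MvPolynomial (Fin n) k =>
      ((IsAdicComplete.liftRingHom I f hf).comp T) (p : MvPowerSeries (Fin n) k)) =
      (fun p => MvPolynomial.eval₂Hom φ y p) from congrFun h p
  refine IsHausdorff.funext' I ?_
  intro N p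
  simp only [RingHom.comp_apply, IsAdicComplete.mk_liftRingHom, f, T]
  have : (MvPowerSeries.toAdicCompletionAlgEquiv (Fin n) k : _ →+* _) (p : MvPowerSeries (Fin n) k)
    = AdicCompletion.of J _ p := MvPowerSeries.toAdicCompletion_coe p
  rw [this]
  simp

theorem noeth_of_complete {R S : Type*} [CommRing R] [IsNoetherianRing R] [CommRing S]
    [Algebra R S] (I : Ideal R) [IsAdicComplete (I.map (algebraMap R S)) S]
    (hs : ∀ z : S, ∃ a : R, algebraMap R S a - z ∈ I.map (algebraMap R S)) :
    IsNoetherianRing S := by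
  obtain ⟨n, y, hy⟩ : ∃ n, ∃ y : Fin n → R, Ideal.span (Set.range y) = I := by
    obtain ⟨n, y, hy⟩ := Submodule.fg_iff_exists_fin_generating_family.mp
      (IsNoetherian.noetherian I)
    exact ⟨n, y, hy⟩
  set I' : Ideal S := I.map (algebraMap R S)
  have hy' : ∀ i, algebraMap R S (y i) ∈ I' := fun i =>
    Ideal.mem_map_of_mem _ (hy ▸ Ideal.subset_span (Set.mem_range_self i))
  obtain ⟨F, hF⟩ := exists_ev I' (algebraMap R S) (fun i => algebraMap R S (y i)) hy'
  have hC : ∀ a, F (MvPowerSeries.C a) = algebraMap R S a := fun a => by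
    rw [← MvPolynomial.coe_C, hF]; simp
  have hX : ∀ a, F (MvPowerSeries.X a) = algebraMap R S (y a) := fun a => by
    rw [← MvPolynomial.coe_X, hF]; simp
  set K : Ideal (MvPowerSeries (Fin n) R) := Ideal.span (Set.range MvPowerSeries.X)
  have hK : K.map F = I' := by
    simp only [K, I', Ideal.map_span, ← hy, ← Set.range_comp]
    congr 1
    ext z; simp [hX]
  have : IsHausdorff (K.map F) S := by rw [hK]; infer_instance
  have hs : Function.Surjective F := by
    refine surjective_of_mk_map_comp_surjective (I := K) F ?_
    intro z
    obtain ⟨z, rfl⟩ := Ideal.Quotient.mk_surjective z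
    obtain ⟨a, ha⟩ := hs z
    refine ⟨MvPowerSeries.C a, ?_⟩
    rw [RingHom.comp_apply, hC, Ideal.Quotient.eq, hK]
    exact ha
  exact isNoetherianRing_of_surjective _ _ F hs

theorem completion_dense {R : Type*} [CommRing R] [IsNoetherianRing R] (I : Ideal R)
    (z : AdicCompletion I R) : ∃ a : R, algebraMap R (AdicCompletion I R) a - z ∈
      I.map (algebraMap R (AdicCompletion I R)) := by
  obtain ⟨a, ha⟩ := Ideal.Quotient.mk_surjective (AdicCompletion.evalOneₐ I z)
  refine ⟨a, ?_⟩
  rw [← AdicCompletion.ker_evalOneₐ_eq_map I (IsNoetherian.noetherian I)]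
  have h2 : AdicCompletion.evalOneₐ I (algebraMap R (AdicCompletion I R) a) =
    Ideal.Quotient.mk I a := AlgHom.commutes _ a
  change AdicCompletion.evalOneₐ I (algebraMap R (AdicCompletion I R) a - z) = 0
  rw [map_sub, h2, ha, sub_self]

theorem completion_complete {R : Type*} [CommRing R] [IsNoetherianRing R] (I : Ideal R) :
    IsAdicComplete (I.map (algebraMap R (AdicCompletion I R))) (AdicCompletion I R) :=
  (IsAdicComplete.map_algebraMap_iff _ _).mpr
    (AdicCompletion.isAdicComplete (M := R) (IsNoetherian.noetherian I))

theorem completion_noeth (R : Type*) [CommRing R] [IsNoetherianRing R] (I : Ideal R) :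
    IsNoetherianRing (AdicCompletion I R) :=
  have := completion_complete I
  noeth_of_complete I (completion_dense I)

end Piece08

section Piece09

open IsLocalRing

theorem ar_colon {D : Type*} [CommRing D] [IsDomain D] [IsNoetherianRing D] (I : Ideal D)
    (y : D) (hy : y ≠ 0) : ∃ r, ∀ n, r ≤ n → ∀ c, c * y ∈ I ^ n → c ∈ I ^ (n - r) := by
  obtain ⟨r, hr⟩ := Ideal.exists_pow_inf_eq_pow_smul I (M := D) (Ideal.span {y})
  refine ⟨r, fun n hn c hc => ?_⟩
  have h1 : c * y ∈ (I ^ n • ⊤ ⊓ (Ideal.span {y} : Ideal D) : Ideal D) :=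
    ⟨by simpa using hc, Ideal.mul_mem_left _ _ (Ideal.mem_span_singleton_self y)⟩
  rw [hr n hn] at h1
  have h2 : I ^ (n - r) • (I ^ r • ⊤ ⊓ (Ideal.span {y} : Ideal D) : Ideal D) ≤
      I ^ (n - r) * Ideal.span {y} := by
    rw [smul_eq_mul]; exact Ideal.mul_mono_right inf_le_right
  have h3 := h2 h1
  rw [Ideal.mem_mul_span_singleton] at h3
  obtain ⟨z, hz, hzy⟩ := h3
  rwa [← mul_right_cancel₀ hy hzy]

theorem ar_contra {D : Type*} [CommRing D] [IsDomain D] [IsNoetherianRing D] [IsLocalRing D]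
    (I : Ideal D) (hI : I ≠ ⊤) (y : D) (hy : y ≠ 0)
    (h : ∀ s, ∃ c ≠ 0, ∀ t, ∃ j ≥ t, c * y ^ j ∈ I ^ (s * j)) : False := by
  obtain ⟨r, hr⟩ := ar_colon I y hy
  have key : ∀ j n c, c * y ^ j ∈ I ^ (r * j + n) → c ∈ I ^ n := by
    intro j
    induction j with
    | zero => intro n c hc; simpa using hc
    | succ j ih =>
      intro n c hc
      refine ih n c ?_
      have := hr (r * (j + 1) + n) (by nlinarith) (c * y ^ j) (by rwa [mul_assoc, ← pow_succ])
      rwa [show r * (j + 1) + n - r = r * j + n by rw [mul_add]; omega] at this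
  obtain ⟨c, hc, h⟩ := h (r + 1)
  apply hc
  have : c ∈ (⨅ n, I ^ n : Ideal D) := by
    rw [Ideal.mem_iInf]
    intro n
    obtain ⟨j, hj, h⟩ := h n
    refine Ideal.pow_le_pow_right hj (key j j c ?_)
    convert h using 2; ring
  rwa [Ideal.iInf_pow_eq_bot_of_isLocalRing I hI] at this

/-- Mittag-Leffler / Chevalley. -/
theorem chev_aux {R C : Type*} [CommRing R] [IsLocalRing R] [IsNoetherianRing R] [CommRing C]
    [IsNoetherianRing C] [IsLocalRing C] [Algebra R C]
    (hmax : (maximalIdeal R).map (algebraMap R C) = maximalIdeal C)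
    [IsAdicComplete (maximalIdeal C) C]
    (hcontr : ∀ N : ℕ, (maximalIdeal C ^ N).comap (algebraMap R C) ≤ maximalIdeal R ^ N)
    (J : ℕ → Ideal R) (hJ : Antitone J) (n : ℕ) (hn : ∀ k, ¬ J k ≤ maximalIdeal R ^ n) :
    ∃ y : C, y ≠ 0 ∧ ∀ s, y ∈ (J s).map (algebraMap R C) := by
  set m := maximalIdeal R
  -- stabilization
  have hst : ∀ N : ℕ, ∃ k, ∀ l, k ≤ l → J l ⊔ m ^ N = J k ⊔ m ^ N := by
    intro N
    have hart : IsArtinianRing (R ⧸ m ^ N) := by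
      have h1 := Module.length_ne_top_iff.mp (length_quot_ne_top (J := m ^ N) (N := N) le_rfl)
      have := (isFiniteLength_iff_isNoetherian_isArtinian.mp h1).2
      exact isArtinian_of_tower R this
    let f : ℕ →o (Ideal (R ⧸ m ^ N))ᵒᵈ :=
      ⟨fun l => OrderDual.toDual ((J l).map (Ideal.Quotient.mk (m ^ N))), fun a b hab =>
        Ideal.map_mono (hJ hab)⟩
    obtain ⟨k, hk⟩ := IsArtinian.monotone_stabilizes f
    refine ⟨k, fun l hl => ?_⟩
    have := congrArg (Ideal.comap (Ideal.Quotient.mk (m ^ N))) (hk l hl)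
    simp only [f] at this
    have h2 : ∀ l, Ideal.comap (Ideal.Quotient.mk (m ^ N)) ((J l).map (Ideal.Quotient.mk (m ^ N)))
      = J l ⊔ m ^ N := fun l => by
        rw [Ideal.comap_map_of_surjective _ Ideal.Quotient.mk_surjective, ← RingHom.ker_eq_comap_bot,
          Ideal.mk_ker]
    rw [← h2, ← h2]
    exact this.symm
  choose κ hκ using hst
  have hL : ∀ N l a, a ∈ J (κ N) ⊔ m ^ N → a ∈ J l ⊔ m ^ N := by
    intro N l a ha
    rcases le_total (κ N) l with h | h
    · rwa [hκ N l h]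
    · exact sup_le_sup_right (hJ h) _ ha
  obtain ⟨y0, hy0, hy0'⟩ : ∃ y0 ∈ J (κ n) ⊔ m ^ n, y0 ∉ m ^ n := by
    by_contra hcon
    push Not at hcon
    exact hn (κ n) (le_sup_left.trans hcon)
  have hstep : ∀ N a, a ∈ J (κ N) ⊔ m ^ N → ∃ b ∈ J (κ (N + 1)) ⊔ m ^ (N + 1), a - b ∈ m ^ N := by
    intro N a ha
    obtain ⟨b, hb, c, hc, rfl⟩ := Submodule.mem_sup.mp (hL N (κ (N + 1)) a ha)
    exact ⟨b, Ideal.mem_sup_left hb, by simpa using hc⟩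
  choose! g hg1 hg2 using hstep
  let Y : ℕ → R := fun t => Nat.rec y0 (fun t a => g (n + t) a) t
  have hY : ∀ t, Y t ∈ J (κ (n + t)) ⊔ m ^ (n + t) := by
    intro t
    induction t with
    | zero => exact hy0
    | succ t ih => exact hg1 (n + t) _ ih
  have hY2 : ∀ t, Y t - Y (t + 1) ∈ m ^ (n + t) := fun t => hg2 (n + t) _ (hY t)
  have hY3 : ∀ t u, t ≤ u → Y t - Y u ∈ m ^ (n + t) := by
    intro t u htu
    induction u, htu using Nat.le_induction with
    | base => simp
    | succ u hu ih =>
      have := Ideal.add_mem _ ih (Ideal.pow_le_pow_right (by omega) (hY2 u))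
      simpa using this
  set f := algebraMap R C
  have hmap : ∀ N a, a ∈ m ^ N → f a ∈ maximalIdeal C ^ N := by
    intro N a ha
    rw [← hmax, ← Ideal.map_pow]; exact Ideal.mem_map_of_mem _ ha
  obtain ⟨y, hy⟩ := IsPrecomplete.prec (I := maximalIdeal C) (M := C) inferInstance
    (f := fun t => f (Y t)) (by
      intro a b hab
      rw [SModEq.sub_mem]
      simp only [smul_eq_mul, Ideal.mul_top, ← map_sub]
      exact Ideal.pow_le_pow_right (by omega) (hmap _ _ (hY3 a b hab)))
  have hy' : ∀ t, f (Y t) - y ∈ maximalIdeal C ^ t := by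
    intro t
    have := hy t
    rw [SModEq.sub_mem] at this
    simpa using this
  refine ⟨y, ?_, fun s => ?_⟩
  · rintro rfl
    have h1 := hcontr n (Ideal.mem_comap.mpr (by simpa using hy' n))
    have h2 := Ideal.add_mem _ (hY3 0 n (by omega)) h1
    simp only [sub_add_cancel] at h2
    exact hy0' h2
  · refine krull_closed _ _ fun t => ?_
    have h1 : f (Y t) ∈ (J s).map f ⊔ maximalIdeal C ^ t := by
      obtain ⟨b, hb, c, hc, hbc⟩ := Submodule.mem_sup.mp (hL _ s _ (hY t))
      rw [← hbc, map_add]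
      exact Ideal.add_mem _ (Ideal.mem_sup_left (Ideal.mem_map_of_mem _ hb))
        (Ideal.mem_sup_right (Ideal.pow_le_pow_right (by omega) (hmap _ _ hc)))
    have := Ideal.sub_mem _ h1 (Ideal.mem_sup_right (hy' t))
    simpa using this

theorem chev_main {R C : Type*} [CommRing R] [IsLocalRing R] [IsNoetherianRing R] [CommRing C]
    [IsNoetherianRing C] [IsLocalRing C] [Algebra R C] [IsReduced C]
    (hmax : (maximalIdeal R).map (algebraMap R C) = maximalIdeal C)
    [IsAdicComplete (maximalIdeal C) C]
    (hcontr : ∀ N : ℕ, (maximalIdeal C ^ N).comap (algebraMap R C) ≤ maximalIdeal R ^ N)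
    (Q : Ideal R) (hQ : Q ≤ maximalIdeal R)
    (J : ℕ → Ideal R) (hJ : Antitone J)
    (H : ∀ s, ∀ y ∈ (J s).map (algebraMap R C), ∀ P ∈ minimalPrimes C, y ∉ P →
      ∃ c ∉ P, ∀ t, ∃ j ≥ t, c * y ^ j ∈ (Q.map (algebraMap R C)) ^ (s * j)) (n : ℕ) :
    ∃ k, J k ≤ maximalIdeal R ^ n := by
  by_contra hcon
  push Not at hcon
  obtain ⟨y, hy0, hy⟩ := chev_aux hmax hcontr J hJ n hcon
  obtain ⟨P, hP, hyP⟩ : ∃ P ∈ minimalPrimes C, y ∉ P := by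
    by_contra hc
    push Not at hc
    apply hy0
    have : y ∈ sInf (minimalPrimes C) := by
      rw [Submodule.mem_sInf]; exact hc
    have h2 : sInf (minimalPrimes C) = nilradical C := by
      rw [nilradical, ← Ideal.sInf_minimalPrimes]; rfl
    rw [h2, nilradical_eq_zero] at this
    simp at this
    exact this
  have : P.IsPrime := hP.1.1
  have : Nontrivial (C ⧸ P) := Ideal.Quotient.nontrivial_iff.2 this.ne_top
  have : IsLocalRing (C ⧸ P) := .of_surjective' (Ideal.Quotient.mk P) Ideal.Quotient.mk_surjective
  refine ar_contra (((Q.map (algebraMap R C))).map (Ideal.Quotient.mk P)) ?_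
    (Ideal.Quotient.mk P y) (by rwa [Ne, Ideal.Quotient.eq_zero_iff_mem]) ?_
  · intro htop
    have h1 : (1 : C ⧸ P) ∈ ((Q.map (algebraMap R C))).map (Ideal.Quotient.mk P) := by
      rw [htop]; trivial
    rw [Ideal.mem_map_iff_of_surjective _ Ideal.Quotient.mk_surjective] at h1
    obtain ⟨q, hq, hq1⟩ := h1
    have hqm : q ∈ maximalIdeal C := hmax ▸ Ideal.map_mono hQ hq
    rw [← map_one (Ideal.Quotient.mk P), Ideal.Quotient.eq] at hq1
    have : (1 : C) ∈ maximalIdeal C := by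
      have := Ideal.sub_mem _ hqm (IsLocalRing.le_maximalIdeal ‹P.IsPrime›.ne_top hq1)
      simpa using this
    exact (Ideal.ne_top_iff_one _).mp (maximalIdeal.isMaximal C).ne_top this
  · intro s
    obtain ⟨c, hc, h⟩ := H s y (hy s) P hP hyP
    refine ⟨Ideal.Quotient.mk P c, by rwa [Ne, Ideal.Quotient.eq_zero_iff_mem], fun t => ?_⟩
    obtain ⟨j, hj, h⟩ := h t
    refine ⟨j, hj, ?_⟩
    rw [← Ideal.map_pow, ← map_pow, ← map_mul]
    exact Ideal.mem_map_of_mem _ h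

/-- reduction-type bound for integral elements -/
theorem intCl_pow {R : Type*} [CommRing R] (I : Ideal R) (a : R) (ha : a ∈ intClSet R I) :
    ∃ M, ∀ j, Ideal.span {a} ^ (M + j) ≤ I ^ j := by
  obtain ⟨n, hn, c, hc, h⟩ := ha
  refine ⟨n, fun j => ?_⟩
  rw [Ideal.span_singleton_pow, Ideal.span_singleton_le_iff_mem]
  induction j using Nat.strong_induction_on with
  | _ j ih =>
    have h1 : a ^ n = - ∑ k ∈ Finset.Icc 1 n, c k * a ^ (n - k) := eq_neg_of_add_eq_zero_left h
    rw [pow_add, h1, neg_mul, Finset.sum_mul]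
    refine Ideal.neg_mem_iff _ |>.mpr (Ideal.sum_mem _ fun k hk => ?_)
    have hk' := Finset.mem_Icc.mp hk
    rcases le_or_gt k j with hkj | hkj
    · have := Ideal.mul_mem_mul (hc k hk) (ih (j - k) (by omega))
      rw [← pow_add, Nat.add_sub_cancel' hkj] at this
      convert this using 1
      rw [mul_assoc, ← pow_add]
      congr 2; omega
    · exact Ideal.mul_mem_right _ _ (Ideal.mul_mem_right _ _ (Ideal.pow_le_pow_right hkj.le (hc k hk)))

theorem red_sup {R : Type*} [CommRing R] {I K K' : Ideal R} (h : ∃ M, ∀ j, K ^ (M + j) ≤ I ^ j)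
    (h' : ∃ M, ∀ j, K' ^ (M + j) ≤ I ^ j) : ∃ M, ∀ j, (K ⊔ K') ^ (M + j) ≤ I ^ j := by
  obtain ⟨M, h⟩ := h
  obtain ⟨M', h'⟩ := h'
  refine ⟨M + M', fun j => ?_⟩
  rw [← Submodule.add_eq_sup, add_pow]
  refine Finset.sum_induction _ (· ≤ I ^ j) (fun a b ha hb => sup_le ha hb) bot_le ?_
  intro i hi
  refine Ideal.mul_le_left.trans ?_
  rcases lt_or_ge i M with h1 | h1
  · refine Ideal.mul_le_right.trans ?_
    refine (Ideal.pow_le_pow_right (?_ : M' + j ≤ _)).trans (h' j)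
    omega
  rcases lt_or_ge (M + M' + j - i) M' with h2 | h2
  · refine Ideal.mul_le_left.trans ?_
    refine (Ideal.pow_le_pow_right (?_ : M + j ≤ _)).trans (h j)
    omega
  · obtain ⟨u, rfl⟩ := Nat.exists_eq_add_of_le h1
    obtain ⟨v, hv⟩ := Nat.exists_eq_add_of_le h2
    rw [hv]
    refine (Ideal.mul_mono (h u) (h' v)).trans ?_
    rw [← pow_add]
    have := Finset.mem_range.mp hi
    exact Ideal.pow_le_pow_right (by omega)

theorem red_fg {R : Type*} [CommRing R] {I : Ideal R} (s : Finset R)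
    (h : ∀ a ∈ s, a ∈ intClSet R I) : ∃ M, ∀ j, Ideal.span (s : Set R) ^ (M + j) ≤ I ^ j := by
  classical
  induction s using Finset.induction_on with
  | empty => refine ⟨1, fun j => ?_⟩; simp [pow_add]
  | insert a s ha ih =>
    rw [Finset.coe_insert, Ideal.span_insert]
    exact red_sup (intCl_pow I a (h a (by simp))) (ih fun b hb => h b (by simp [hb]))

theorem completion_contr {R : Type*} [CommRing R] [IsLocalRing R] [IsNoetherianRing R] (N : ℕ) :
    (maximalIdeal (AdicCompletion (maximalIdeal R) R) ^ N).comap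
      (algebraMap R (AdicCompletion (maximalIdeal R) R)) ≤ maximalIdeal R ^ N := by
  intro a ha
  rw [Ideal.mem_comap, AdicCompletion.maximalIdeal_eq_map, ← Ideal.map_pow] at ha
  have h1 := Ideal.mem_map_of_mem
    (AdicCompletion.evalₐ (maximalIdeal R) N : _ →+* R ⧸ maximalIdeal R ^ N) ha
  rw [Ideal.map_map] at h1
  have h2 : (AdicCompletion.evalₐ (maximalIdeal R) N : _ →+* R ⧸ maximalIdeal R ^ N).comp
      (algebraMap R (AdicCompletion (maximalIdeal R) R)) = Ideal.Quotient.mk _ :=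
    RingHom.ext fun r => AlgHom.commutes (AdicCompletion.evalₐ (maximalIdeal R) N) r
  rw [h2, Ideal.map_quotient_self] at h1
  have h3 : (AdicCompletion.evalₐ (maximalIdeal R) N : _ →+* R ⧸ maximalIdeal R ^ N)
      (algebraMap R (AdicCompletion (maximalIdeal R) R) a) = Ideal.Quotient.mk _ a :=
    AlgHom.commutes (AdicCompletion.evalₐ (maximalIdeal R) N) a
  rw [h3] at h1
  exact Ideal.Quotient.eq_zero_iff_mem.mp h1

theorem completion_complete' {R : Type*} [CommRing R] [IsLocalRing R] [IsNoetherianRing R] :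
    IsAdicComplete (maximalIdeal (AdicCompletion (maximalIdeal R) R))
      (AdicCompletion (maximalIdeal R) R) := by
  rw [AdicCompletion.maximalIdeal_eq_map]
  exact completion_complete _

theorem chev_dagger {R B : Type*} [CommRing R] [IsLocalRing R] [IsNoetherianRing R] [CommRing B]
    [Algebra R B] (hred : IsReduced (AdicCompletion (maximalIdeal R) R))
    (hd : SatisfiesDagger R (algebraMap R B)) (Q : Ideal R) (hQ : Q.radical = maximalIdeal R)
    (n : ℕ) : ∃ k, IB B Q k ≤ maximalIdeal R ^ n := by
  have := completion_noeth R (maximalIdeal R)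
  have := completion_complete' (R := R)
  refine chev_main (C := AdicCompletion (maximalIdeal R) R)
    AdicCompletion.maximalIdeal_eq_map.symm completion_contr Q
    (hQ ▸ Ideal.le_radical) (IB B Q) (fun a b h => IB_anti Q h) ?_ n
  intro s y hy P hP hyP
  have hPp : P.IsPrime := hP.1.1
  rcases Nat.eq_zero_or_pos s with rfl | hs
  · exact ⟨1, (Ideal.ne_top_iff_one _).mp hPp.ne_top, fun t => ⟨t, le_rfl, by simp⟩⟩
  obtain ⟨S, hS⟩ := (IsNoetherian.noetherian (IB B Q s) : (IB B Q s).FG)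
  obtain ⟨M, hM⟩ := red_fg (I := Q ^ s) S (fun a ha => by
    refine hd (Q ^ s) (by rw [Ideal.radical_pow _ hs.ne', hQ]) ?_
    have : a ∈ IB B Q s := hS ▸ Ideal.subset_span ha
    exact this)
  change Ideal.span (S : Set R) = _ at hS
  rw [hS] at hM
  refine ⟨y ^ M, fun h => hyP (hPp.mem_of_pow_mem _ h), fun t => ⟨t, le_rfl, ?_⟩⟩
  rw [← pow_add, pow_mul, ← Ideal.map_pow, ← Ideal.map_pow]
  refine Ideal.map_mono (hM t) ?_
  rw [Ideal.map_pow]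
  exact Ideal.pow_mem_pow hy _

end Piece09

section Piece10

open IsLocalRing RingTheory.Sequence
open scoped Pointwise

section ConcreteExt

variable {R : Type*} [CommRing R]

theorem div_reg {X M : Type*} [AddCommGroup X] [Module R X] [AddCommGroup M] [Module R M] {r : R}
    (hr : IsSMulRegular M r) (φ : X →ₗ[R] M) (h : ∀ x, φ x ∈ r • (⊤ : Submodule R M)) :
    ∃ θ : X →ₗ[R] M, φ = r • θ := by
  have h' : ∀ x, ∃ m, r • m = φ x := fun x => by
    obtain ⟨m, -, hm⟩ := (Submodule.mem_smul_pointwise_iff_exists _ _ _).mp (h x)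
    exact ⟨m, hm⟩
  choose θ hθ using h'
  refine ⟨⟨⟨θ, fun x y => hr ?_⟩, fun c x => hr ?_⟩, LinearMap.ext fun x => (hθ x).symm⟩
  · simp [hθ]
  · simp only [RingHom.id_apply]
    rw [hθ, smul_comm, hθ, map_smul]

variable (P : ℕ → Type*) [∀ n, AddCommGroup (P n)] [∀ n, Module R (P n)]
  (D : ∀ n, P (n + 1) →ₗ[R] P n)

def NullH (y : R) : Prop := ∃ h : ∀ n, P n →ₗ[R] P (n + 1),
  (D 0 ∘ₗ h 0 = y • LinearMap.id) ∧
    ∀ n, D (n + 1) ∘ₗ h (n + 1) + h n ∘ₗ D n = y • LinearMap.id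

def ExAt (M : Type*) [AddCommGroup M] [Module R M] : ℕ → Prop
  | 0 => ∀ φ : P 0 →ₗ[R] M, φ ∘ₗ D 0 = 0 → φ = 0
  | j + 1 => ∀ φ : P (j + 1) →ₗ[R] M, φ ∘ₗ D (j + 1) = 0 → ∃ ψ : P j →ₗ[R] M, φ = ψ ∘ₗ D j

def InjAt {M N : Type*} [AddCommGroup M] [Module R M] [AddCommGroup N] [Module R N]
    (f : M →ₗ[R] N) : ℕ → Prop
  | 0 => ∀ φ : P 0 →ₗ[R] M, φ ∘ₗ D 0 = 0 → f ∘ₗ φ = 0 → φ = 0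
  | j + 1 => ∀ (φ : P (j + 1) →ₗ[R] M) (ψ : P j →ₗ[R] N), φ ∘ₗ D (j + 1) = 0 →
      f ∘ₗ φ = ψ ∘ₗ D j → ∃ ψ' : P j →ₗ[R] M, φ = ψ' ∘ₗ D j

theorem nullh_mul {M : Type*} [AddCommGroup M] [Module R M] {y : R}
    {h : ∀ n, P n →ₗ[R] P (n + 1)}
    (h1 : ∀ n, D (n + 1) ∘ₗ h (n + 1) + h n ∘ₗ D n = y • LinearMap.id)
    {j : ℕ} {φ : P (j + 1) →ₗ[R] M} (hφ : φ ∘ₗ D (j + 1) = 0) :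
    (φ ∘ₗ h j) ∘ₗ D j = y • φ := by
  have := congrArg (fun g => φ ∘ₗ g) (h1 j)
  simp only [LinearMap.comp_add, ← LinearMap.comp_assoc, hφ, LinearMap.zero_comp, zero_add,
    LinearMap.comp_smul, LinearMap.comp_id] at this
  exact this

/-- division step: a cochain `φ'` which modulo `y` is a coboundary. -/
theorem div_step [∀ n, Module.Projective R (P n)] (hDD : ∀ n, D n ∘ₗ D (n + 1) = 0)
    {M : Type*} [AddCommGroup M] [Module R M] {y : R} (hy : IsSMulRegular M y)
    {j : ℕ} {φ : P (j + 2) →ₗ[R] M} {φ' : P (j + 1) →ₗ[R] M} (hφ : φ' ∘ₗ D (j + 1) = y • φ)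
    (χ : P j →ₗ[R] QuotSMulTop y M) (hχ : (y • (⊤ : Submodule R M)).mkQ ∘ₗ φ' = χ ∘ₗ D j) :
    ∃ θ : P (j + 1) →ₗ[R] M, φ = θ ∘ₗ D (j + 1) := by
  obtain ⟨χ', hχ'⟩ := Module.projective_lifting_property (y • (⊤ : Submodule R M)).mkQ χ
    (Submodule.mkQ_surjective _)
  obtain ⟨θ, hθ⟩ := div_reg hy (φ' - χ' ∘ₗ D j) (fun x => by
    rw [← Submodule.ker_mkQ (y • (⊤ : Submodule R M)), LinearMap.mem_ker, LinearMap.sub_apply,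
      map_sub]
    have h1 := LinearMap.congr_fun hχ x
    have h2 := LinearMap.congr_fun hχ' (D j x)
    simp only [LinearMap.comp_apply] at h1 h2 ⊢
    rw [h1, h2, sub_self])
  refine ⟨θ, LinearMap.ext fun x => hy ?_⟩
  have h1 := LinearMap.congr_fun hθ (D (j + 1) x)
  have h2 := LinearMap.congr_fun hφ x
  have h3 := LinearMap.congr_fun (hDD j) x
  simp only [LinearMap.comp_apply, LinearMap.sub_apply, LinearMap.smul_apply,
    LinearMap.zero_apply] at h1 h2 h3 ⊢
  rw [← h1, h3, map_zero, sub_zero, h2]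

theorem div_step0
    {M : Type*} [AddCommGroup M] [Module R M] {y : R} (hy : IsSMulRegular M y)
    {φ : P 1 →ₗ[R] M} {φ' : P 0 →ₗ[R] M} (hφ : φ' ∘ₗ D 0 = y • φ)
    (hχ : (y • (⊤ : Submodule R M)).mkQ ∘ₗ φ' = 0) :
    ∃ θ : P 0 →ₗ[R] M, φ = θ ∘ₗ D 0 := by
  obtain ⟨θ, hθ⟩ := div_reg hy φ' (fun x => by
    rw [← Submodule.ker_mkQ (y • (⊤ : Submodule R M)), LinearMap.mem_ker]
    exact LinearMap.congr_fun hχ x)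
  refine ⟨θ, LinearMap.ext fun x => hy ?_⟩
  have h1 := LinearMap.congr_fun hθ (D 0 x)
  have h2 := LinearMap.congr_fun hφ x
  simp only [LinearMap.comp_apply, LinearMap.smul_apply] at h1 h2 ⊢
  rw [← h1, h2]

theorem mod_coc {M : Type*} [AddCommGroup M] [Module R M] {y : R} {j : ℕ}
    {φ : P (j + 1) →ₗ[R] M} {φ' : P j →ₗ[R] M} (hφ : φ' ∘ₗ D j = y • φ) :
    ((y • (⊤ : Submodule R M)).mkQ ∘ₗ φ') ∘ₗ D j = 0 := by
  rw [LinearMap.comp_assoc, hφ]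
  ext x
  simp only [LinearMap.comp_apply, LinearMap.smul_apply, LinearMap.zero_apply,
    Submodule.mkQ_apply, Submodule.Quotient.mk_eq_zero]
  exact Submodule.smul_mem_pointwise_smul _ _ _ trivial

theorem exAt_of_reg [∀ n, Module.Projective R (P n)] (hDD : ∀ n, D n ∘ₗ D (n + 1) = 0) (rs : List R)
    (hrs : ∀ y ∈ rs, NullH P D y) : ∀ {M : Type*} [AddCommGroup M] [Module R M]
    (_ : IsWeaklyRegular M rs) (i : ℕ), i < rs.length → ExAt P D M i := by
  induction rs with
  | nil => intro M _ _ _ i hi; simp at hi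
  | cons y rs ih =>
    intro M _ _ hreg i hi
    rw [isWeaklyRegular_cons_iff] at hreg
    obtain ⟨h, h0, h1⟩ := hrs y (by simp)
    have ih' := fun i hi => ih (fun z hz => hrs z (by simp [hz])) hreg.2 i hi
    match i with
    | 0 =>
      intro φ hφ
      refine LinearMap.ext fun x => hreg.1 ?_
      have := LinearMap.congr_fun (congrArg (fun g => g ∘ₗ h 0) hφ) x
      have h2 := LinearMap.congr_fun h0 x
      simp only [LinearMap.comp_apply, LinearMap.smul_apply, LinearMap.id_apply] at this h2
      rw [h2] at this
      simpa using this
    | 1 =>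
      intro φ hφ
      have h3 := nullh_mul P D h1 hφ
      exact div_step0 P D hreg.1 h3 (ih' 0 (by simp at hi; omega) _ (mod_coc P D h3))
    | j + 2 =>
      intro φ hφ
      have h3 := nullh_mul P D h1 hφ
      obtain ⟨χ, hχ⟩ := ih' (j + 1) (by simp at hi; omega) _ (mod_coc P D h3)
      exact div_step P D hDD hreg.1 h3 χ hχ

theorem quot_key {M : Type*} [AddCommGroup M] [Module R M] (y : R) (rs : List R) (z : M) :
    (y • (⊤ : Submodule R M)).mkQ z ∈ Ideal.ofList rs • (⊤ : Submodule R (QuotSMulTop y M)) ↔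
        z ∈ Ideal.ofList (y :: rs) • (⊤ : Submodule R M) := by
  have h2 : Ideal.ofList rs • (⊤ : Submodule R (QuotSMulTop y M)) =
      (Ideal.ofList rs • (⊤ : Submodule R M)).map (y • (⊤ : Submodule R M)).mkQ := by
    rw [Submodule.map_smul'', Submodule.map_top, Submodule.range_mkQ]
  rw [h2, ← Submodule.mem_comap, Submodule.comap_map_mkQ, Ideal.ofList_cons, Submodule.sup_smul,
    Submodule.ideal_span_singleton_smul]

theorem injAt_of_reg [∀ n, Module.Projective R (P n)] (hDD : ∀ n, D n ∘ₗ D (n + 1) = 0) (rs : List R)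
    (hrs : ∀ y ∈ rs, NullH P D y) : ∀ {M N : Type*} [AddCommGroup M] [Module R M]
    [AddCommGroup N] [Module R N] (f : M →ₗ[R] N)
    (_ : IsWeaklyRegular M rs) (_ : IsWeaklyRegular N rs)
    (_ : ∀ z, f z ∈ Ideal.ofList rs • (⊤ : Submodule R N) →
      z ∈ Ideal.ofList rs • (⊤ : Submodule R M)), InjAt P D f rs.length := by
  induction rs with
  | nil =>
    intro M N _ _ _ _ f _ _ hf φ _ hφ
    refine LinearMap.ext fun x => ?_
    have := hf (φ x) (by
      have := LinearMap.congr_fun hφ x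
      simp only [LinearMap.comp_apply] at this
      rw [this]; exact Submodule.zero_mem _)
    simpa using this
  | cons y rs ih =>
    intro M N _ _ _ _ f hM hN hf
    have hex := exAt_of_reg P D hDD (y :: rs) hrs hN
    rw [isWeaklyRegular_cons_iff] at hM hN
    obtain ⟨h, h0, h1⟩ := hrs y (by simp)
    have ih' := ih (fun z hz => hrs z (by simp [hz])) (QuotSMulTop.map y f) hM.2 hN.2 (by
      intro z hz
      obtain ⟨z, rfl⟩ := Submodule.mkQ_surjective _ z
      rw [quot_key]
      apply hf
      rw [← quot_key]
      exact hz)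
    have hmod : ∀ {X : Type _} [AddCommGroup X] [Module R X] (g : X →ₗ[R] M),
        QuotSMulTop.map y f ∘ₗ ((y • (⊤ : Submodule R M)).mkQ ∘ₗ g) =
          (y • (⊤ : Submodule R N)).mkQ ∘ₗ (f ∘ₗ g) := by
      intro X _ _ g
      rw [← LinearMap.comp_assoc, QuotSMulTop.map_comp_mkQ, LinearMap.comp_assoc]
    have hmy : ∀ {X : Type _} [AddCommGroup X] [Module R X] (g : X →ₗ[R] N),
        (y • (⊤ : Submodule R N)).mkQ ∘ₗ (y • g) = 0 := by
      intro X _ _ g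
      ext x
      simp only [LinearMap.comp_apply, LinearMap.smul_apply, LinearMap.zero_apply,
        Submodule.mkQ_apply, Submodule.Quotient.mk_eq_zero]
      exact Submodule.smul_mem_pointwise_smul _ _ _ trivial
    have hl := hex rs.length (by simp)
    change InjAt P D f (rs.length + 1)
    generalize rs.length = l at ih' hl
    match l, ih', hl with
    | 0, ih', hl =>
      intro φ ψ hφ hψ
      have h3 := nullh_mul P D h1 hφ
      have h4 : f ∘ₗ (φ ∘ₗ h 0) - y • ψ = 0 := by
        apply hl
        rw [LinearMap.sub_comp, LinearMap.comp_assoc, h3, LinearMap.comp_smul, hψ,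
          LinearMap.smul_comp, sub_self]
      refine div_step0 P D hM.1 h3 (ih' _ (mod_coc P D h3) ?_)
      rw [hmod, sub_eq_zero.mp h4, hmy]
    | j + 1, ih', hl =>
      intro φ ψ hφ hψ
      have h3 := nullh_mul P D h1 hφ
      obtain ⟨χ, h4⟩ := hl (f ∘ₗ (φ ∘ₗ h (j + 1)) - y • ψ) (by
        rw [LinearMap.sub_comp, LinearMap.comp_assoc, h3, LinearMap.comp_smul, hψ,
          LinearMap.smul_comp, sub_self])
      obtain ⟨χ', h5⟩ := ih' _ ((y • (⊤ : Submodule R N)).mkQ ∘ₗ χ) (mod_coc P D h3) (by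
        rw [hmod, sub_eq_iff_eq_add.mp h4, LinearMap.comp_add, hmy, add_zero,
          LinearMap.comp_assoc])
      exact div_step P D hDD hM.1 h3 χ' h5

end ConcreteExt

end Piece10

section Piece11

open IsLocalRing RingTheory.Sequence
open scoped Pointwise

section Bridge
open CategoryTheory CategoryTheory.Limits Opposite

variable {R : Type u} [CommRing R]

/-- Concrete criterion for a map on homology to be mono. -/
theorem mono_homologyMap_concrete {S T : ShortComplex (ModuleCat.{u} R)} (ψ : S ⟶ T)
    (h : ∀ z : S.X₂, S.g z = 0 → ∀ w : T.X₁, T.f w = ψ.τ₂ z → ∃ w' : S.X₁, S.f w' = z) :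
    Mono (ShortComplex.homologyMap ψ) := by
  rw [ModuleCat.mono_iff_injective, injective_iff_map_eq_zero]
  intro a ha
  obtain ⟨b, rfl⟩ := (ModuleCat.epi_iff_surjective S.homologyπ).mp inferInstance a
  rw [← ConcreteCategory.comp_apply, ShortComplex.homologyπ_naturality,
    ConcreteCategory.comp_apply] at ha
  have e1 : ∀ (U : ShortComplex (ModuleCat.{u} R)) (c : U.cycles), U.homologyπ c = 0 →
      ∃ w, U.toCycles w = c := fun U c hc => by
    have := (ShortComplex.moduleCat_exact_iff (ShortComplex.mk U.toCycles U.homologyπ (by simp))).mp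
      (ShortComplex.exact_of_g_is_cokernel _ U.homologyIsCokernel) c hc
    exact this
  obtain ⟨w, hw⟩ := e1 _ _ ha
  have h1 : T.f w = ψ.τ₂ (S.iCycles b) := by
    rw [← ConcreteCategory.comp_apply, ← ShortComplex.cyclesMap_i, ConcreteCategory.comp_apply,
      ← hw, ← ConcreteCategory.comp_apply, ShortComplex.toCycles_i]
  obtain ⟨w', hw'⟩ := h (S.iCycles b) (by
    rw [← ConcreteCategory.comp_apply, ShortComplex.iCycles_g]; rfl) w h1
  have : b = S.toCycles w' := by
    apply (ModuleCat.mono_iff_injective S.iCycles).mp inferInstance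
    rw [← hw', ← ConcreteCategory.comp_apply, ShortComplex.toCycles_i]
  rw [this, ← ConcreteCategory.comp_apply, ShortComplex.toCycles_comp_homologyπ]
  rfl

theorem epi_homologyMap_op {S T : ShortComplex (ModuleCat.{u} R)ᵒᵖ} (φ : S ⟶ T)
    (h : Mono (ShortComplex.homologyMap (ShortComplex.unopMap φ))) :
    Epi (ShortComplex.homologyMap φ) := by
  have := ShortComplex.homologyMap_op (ShortComplex.unopMap φ)
  have e : (S.unop.homologyOpIso).hom ≫ (ShortComplex.homologyMap (ShortComplex.unopMap φ)).op ≫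
     (T.unop.homologyOpIso).inv = ShortComplex.homologyMap φ := by
    rw [this]; simp
    rfl
  have e1 : Epi (ShortComplex.homologyMap (ShortComplex.unopMap φ)).op := inferInstance
  have e2 : Epi ((ShortComplex.homologyMap (ShortComplex.unopMap φ)).op ≫
     (T.unop.homologyOpIso).inv) := @epi_comp _ _ _ _ _ _ e1 _ (IsIso.epi_of_iso _)
  rw [← e]
  exact @epi_comp _ _ _ _ _ _ (@IsIso.epi_of_iso _ _ _ _ _ (Iso.isIso_hom _)) _ e2

theorem ext_mono_aux (n : ℕ) {X : ModuleCat.{u} R} (P : ProjectiveResolution X)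
    {Y Z : ModuleCat.{u} R} (f : Y ⟶ Z)
    (h : InjAt (fun n => P.complex.X n) (fun n => (P.complex.d (n + 1) n).hom) f.hom n)
    (i k : ℕ) (hi : (ComplexShape.down ℕ).prev n = i) (hk : (ComplexShape.down ℕ).next n = k)
    (z : P.complex.X n ⟶ Y) (hz : P.complex.d i n ≫ z = 0) (w : P.complex.X k ⟶ Z)
    (hw : P.complex.d n k ≫ w = z ≫ f) : ∃ w' : P.complex.X k ⟶ Y, P.complex.d n k ≫ w' = z := by
  have hi' : i = n + 1 := by rw [← hi, ChainComplex.prev]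
  subst hi'
  have hz' : z.hom ∘ₗ (P.complex.d (n + 1) n).hom = 0 := by
    rw [← ModuleCat.hom_comp, hz, ModuleCat.hom_zero]
  rcases n with _ | n
  · have hk' : k = 0 := by rw [← hk, ChainComplex.next_nat_zero]
    subst hk'
    refine ⟨0, ?_⟩
    have : P.complex.d 0 0 = 0 := P.complex.shape _ _ (by simp)
    rw [this, Limits.zero_comp] at hw ⊢
    have := h z.hom hz' (by rw [← ModuleCat.hom_comp, ← hw, ModuleCat.hom_zero])
    exact (ModuleCat.hom_ext this).symm
  · have hk' : k = n := by rw [← hk, ChainComplex.next_nat_succ]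
    subst hk'
    obtain ⟨ψ, hψ⟩ := h z.hom w.hom hz' (by rw [← ModuleCat.hom_comp, ← hw, ModuleCat.hom_comp])
    exact ⟨ModuleCat.ofHom ψ, ModuleCat.hom_ext hψ.symm⟩

theorem ext_mono (n : ℕ) {X : ModuleCat.{u} R} (P : ProjectiveResolution X)
    {Y Z : ModuleCat.{u} R} (f : Y ⟶ Z)
    (h : InjAt (fun n => P.complex.X n) (fun n => (P.complex.d (n + 1) n).hom) f.hom n) :
    Mono (((Ext R (ModuleCat.{u} R) n).obj (op X)).map f) := by
  change Mono (((NatTrans.leftDerived (NatTrans.rightOp ((linearYoneda R (ModuleCat.{u} R)).map f)) n).app X).unop)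
  rw [ProjectiveResolution.leftDerived_app_eq _ P n]
  suffices Epi ((HomologicalComplex.homologyFunctor _ (ComplexShape.down ℕ) n).map
        ((NatTrans.mapHomologicalComplex (NatTrans.rightOp ((linearYoneda R (ModuleCat.{u} R)).map f)) _).app P.complex)) by
    infer_instance
  refine epi_homologyMap_op _ ?_
  apply mono_homologyMap_concrete
  intro z hz w hw
  exact ext_mono_aux n P f h _ _ rfl rfl z hz w hw

theorem nullH_of_kill {X : ModuleCat.{u} R} (P : ProjectiveResolution X) (y : R)
    (hy : ∀ x : X, y • x = 0) :
    NullH (fun n => P.complex.X n) (fun n => (P.complex.d (n + 1) n).hom) y := by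
  have comm : (y • 𝟙 P.complex) ≫ P.π = 0 := by
    rw [Linear.smul_comp, Category.id_comp]
    ext x
    simp only [HomologicalComplex.smul_f_apply, ModuleCat.hom_smul, LinearMap.smul_apply]
    exact hy _
  let H := ProjectiveResolution.liftHomotopyZero _ comm
  refine ⟨fun n => (H.hom n (n + 1)).hom, ?_, fun n => ?_⟩
  · have := H.comm 0
    simp only [Homotopy.dNext_zero_chainComplex, Homotopy.prevD_chainComplex, zero_add,
      HomologicalComplex.smul_f_apply, HomologicalComplex.id_f, HomologicalComplex.zero_f,
      add_zero] at this
    exact (congrArg ModuleCat.Hom.hom this).symm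
  · have := H.comm (n + 1)
    simp only [Homotopy.dNext_succ_chainComplex, Homotopy.prevD_chainComplex,
      HomologicalComplex.smul_f_apply, HomologicalComplex.id_f, HomologicalComplex.zero_f,
      add_zero] at this
    exact (add_comm _ _).trans (congrArg ModuleCat.Hom.hom this).symm

theorem localCohomology_inj (J : Ideal R) (d : ℕ) {Y Z : ModuleCat.{u} R} (f : Y ⟶ Z)
    (h : ∀ t : ℕ, Mono (((Ext R (ModuleCat.{u} R) d).obj (op (ModuleCat.of R (R ⧸ J ^ t)))).map f)) :
    Function.Injective ((localCohomology J d).map f) := by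
  let F := localCohomology.diagram (localCohomology.idealPowersDiagram J) d
  have hF : localCohomology J d = colimit F := rfl
  rw [hF, injective_iff_map_eq_zero]
  intro a ha
  have : PreservesFilteredColimitsOfSize.{0, 0} (forget (ModuleCat.{u} R)) :=
    preservesFilteredColimitsOfSize_shrink.{0, u, 0, u} _
  have : IsFiltered (ℕᵒᵖᵒᵖ) := inferInstance
  have := PreservesFilteredColimitsOfSize.preserves_filtered_colimits
    (F := forget (ModuleCat.{u} R)) (ℕᵒᵖᵒᵖ)
  have hY := isColimitOfPreserves ((evaluation _ _).obj Y) (colimit.isColimit F)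
  have hZ := isColimitOfPreserves ((evaluation _ _).obj Z) (colimit.isColimit F)
  obtain ⟨j, y, rfl⟩ := Concrete.isColimit_exists_rep _ hY a
  have hn := (colimit.ι F j).naturality f
  have h0 : (colimit.ι F j).app Z ((F.obj j).map f y) = (colimit.ι F j).app Z 0 := by
    rw [← ConcreteCategory.comp_apply, hn, map_zero]
    exact ha
  obtain ⟨k, g, g', hg⟩ := Concrete.isColimit_exists_of_rep_eq _ hZ ((F.obj j).map f y) 0 h0
  have hg2 : (F.obj k).map f ((F.map g).app Y y) = 0 := by
    rw [← ConcreteCategory.comp_apply, ← (F.map g).naturality, ConcreteCategory.comp_apply]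
    refine hg.trans ?_
    exact map_zero _
  have hinj := (ModuleCat.mono_iff_injective _).mp (h k.unop.unop)
  have h3 : (F.map g).app Y y = 0 := by
    refine hinj (hg2.trans ?_)
    exact (map_zero (ModuleCat.Hom.hom ((F.obj k).map f))).symm
  change (colimit.ι F j).app Y y = 0
  rw [← colimit.w F g, NatTrans.comp_app, ConcreteCategory.comp_apply, h3, map_zero]

end Bridge

end Piece11

section Piece12

open IsLocalRing RingTheory.Sequence
open scoped Pointwise

section Part1

theorem pow_span_le {R : Type*} [CommRing R] [IsLocalRing R] [IsNoetherianRing R] {Q : Ideal R}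
    (hQ : Q.radical = maximalIdeal R) : ∃ N, maximalIdeal R ^ N ≤ Q := by
  have := Ideal.exists_radical_pow_le_of_fg Q (IsNoetherian.noetherian _)
  rwa [hQ] at this

theorem bcm_inj (R : Type u) [CommRing R] [IsLocalRing R] [IsNoetherianRing R] {d : ℕ}
    (B : Type u) [CommRing B] [Algebra R B] {x : Fin d → R} (hx : IsSOP R x)
    (hB : IsBalancedBigCM R B) (hR : REG x)
    (h1 : IB B (Ideal.span (Set.range x)) 1 ≤ Ideal.span (Set.range x)) :
    Function.Injective
      ((localCohomology (maximalIdeal R) d).map (ModuleCat.ofHom (Algebra.linearMap R B))) := by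
  apply localCohomology_inj
  intro t
  let P := CategoryTheory.projectiveResolution (ModuleCat.of R (R ⧸ maximalIdeal R ^ t))
  apply ext_mono _ P
  have hp : ∀ n, Module.Projective R (P.complex.X n) := fun n =>
    (IsProjective.iff_projective (P.complex.X n)).mpr (P.projective n)
  have key := injAt_of_reg (fun n => P.complex.X n) (fun n => (P.complex.d (n + 1) n).hom)
    (fun n => by
      rw [← ModuleCat.hom_comp, P.complex.d_comp_d, ModuleCat.hom_zero])
    (List.ofFn fun j => x j ^ (t + 1)) (fun y hy => by
      obtain ⟨j, rfl⟩ := (List.mem_ofFn' _ _).1 hy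
      refine nullH_of_kill P _ fun z => ?_
      obtain ⟨z, rfl⟩ := Ideal.Quotient.mk_surjective z
      rw [← Ideal.Quotient.mk_eq_mk, ← Submodule.Quotient.mk_smul, Submodule.Quotient.mk_eq_zero]
      exact Ideal.mul_mem_right _ _ (Ideal.pow_le_pow_right (Nat.le_succ t)
        (Ideal.pow_mem_pow (hx.mem j) _))) (Algebra.linearMap R B) ?_ ?_ ?_
  · rwa [List.length_ofFn] at key
  · exact (REG.weak (fun i s b hb => by
      simp only [← pow_mul] at hb ⊢
      exact hR.pow i _ _ b hb)) (fun j => Ideal.pow_mem_of_mem _ (hx.mem j) _ (Nat.succ_pos t))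
  · rw [← isWeaklyRegular_map_algebraMap_iff B B]
    have := (hB.1 d _ (hx.pow (fun _ => t + 1) fun _ => Nat.succ_pos t)).1
    rwa [List.map_ofFn]
  · intro z hz
    have e1 : Ideal.ofList (List.ofFn fun j => x j ^ (t + 1)) =
        Ideal.span (Set.range fun j => x j ^ (t + 1)) := by
      rw [Ideal.ofList]; congr 1; ext; simp [List.mem_ofFn']
    have := contr_pow (balanced_REG hB hx) h1 (fun _ => t + 1) z (by
      rw [e1, Ideal.smul_top_eq_map, Submodule.restrictScalars_mem, Ideal.map_span] at hz
      convert hz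
      · rw [← Set.range_comp]; ext; simp
      · rfl)
    rw [e1, smul_eq_mul, Ideal.mul_top]; exact this

theorem part1 (R : Type u) [CommRing R] [IsLocalRing R] [IsNoetherianRing R]
    (d : ℕ) (hd : ringKrullDim R = (d : WithBot ℕ∞))
    (hred : IsReduced (AdicCompletion (maximalIdeal R) R))
    (B : Type u) [CommRing B] [Algebra R B]
    (hB : IsBalancedBigCM R B) (hdag : SatisfiesDagger R (algebraMap R B))
    (Q : Ideal R) (hQ : IsParameterIdeal R Q)
    (eB e : ℕ → ℤ)
    (h1 : HasHilbertSeries R d (fun n => contractedExt R (algebraMap R B) (Q ^ n)) eB)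
    (h2 : HasHilbertSeries R d (fun n => Q ^ n) e)
    (h3 : eB 1 = e 1) : IsBCMRational R B d := by
  obtain ⟨d', x, hx, rfl⟩ := hQ
  obtain rfl : d' = d := by
    have := hx.1.symm.trans hd
    exact_mod_cast this
  obtain ⟨N, hN⟩ := pow_span_le hx.2
  have hreg := balanced_REG hB hx
  have hc := core x hreg ⟨N, hN⟩ (fun n => by
    obtain ⟨k, hk⟩ := chev_dagger hred hdag _ hx.2 (N * n)
    refine ⟨k, hk.trans ?_⟩
    rw [pow_mul]
    exact Ideal.pow_right_mono hN n) eB e h1 h2 h3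
  have hR := contr_REG hx.mem hreg hc
  exact ⟨hR.isCM hx, bcm_inj R B hx hB hR hc⟩

end Part1

end Piece12

section Piece13

open IsLocalRing

section Exchange

variable {C : Type*} [CommRing C] {d : ℕ}

/-- The ideal generated by the powers `y j ^ s j` for `j` in `T`. -/
def PS (y : Fin d → C) (s : Fin d → ℕ) (T : Set (Fin d)) : Ideal C :=
  Ideal.span {z | ∃ j, j ∈ T ∧ z = y j ^ s j}

/-- `b` kills all the power colons of the sequence `y`. -/
def KK (b : C) (y : Fin d → C) : Prop :=
  ∀ (i : Fin d) (s : Fin d → ℕ) (n : ℕ) (u : C), y i ^ n * u ∈ PS y s {i}ᶜ → b * u ∈ PS y s {i}ᶜ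

theorem PS_insert (y : Fin d → C) (s : Fin d → ℕ) (T : Set (Fin d)) (k : Fin d) :
    PS y s (insert k T) = Ideal.span {y k ^ s k} ⊔ PS y s T := by
  unfold PS
  rw [← Ideal.span_union]
  congr 1
  ext z
  constructor
  · rintro ⟨j, rfl | hj, rfl⟩
    · exact Or.inl rfl
    · exact Or.inr ⟨j, hj, rfl⟩
  · rintro (h | ⟨j, hj, rfl⟩)
    · exact ⟨k, Or.inl rfl, h⟩
    · exact ⟨j, Or.inr hj, rfl⟩

theorem PS_congr {y y' : Fin d → C} {s s' : Fin d → ℕ} {T : Set (Fin d)}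
    (h : ∀ j ∈ T, y j ^ s j = y' j ^ s' j) : PS y s T = PS y' s' T := by
  unfold PS
  congr 1
  ext z
  constructor
  · rintro ⟨j, hj, rfl⟩; exact ⟨j, hj, h j hj⟩
  · rintro ⟨j, hj, rfl⟩; exact ⟨j, hj, (h j hj).symm⟩

theorem PS_mono (y : Fin d → C) (s : Fin d → ℕ) {T T' : Set (Fin d)} (h : T ⊆ T') :
    PS y s T ≤ PS y s T' := by
  apply Ideal.span_mono
  rintro z ⟨j, hj, rfl⟩
  exact ⟨j, h hj, rfl⟩

theorem PS_mem (y : Fin d → C) (s : Fin d → ℕ) {T : Set (Fin d)} {j : Fin d} (h : j ∈ T) :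
    y j ^ s j ∈ PS y s T := Ideal.subset_span ⟨j, h, rfl⟩

theorem REG_iff_KK (y : Fin d → C) : REG y ↔ KK 1 y := by
  constructor
  · intro h i s n u hu
    rw [one_mul]
    exact h.pow i s n u hu
  · intro h i s u hu
    have := h i s 1 u (by rw [pow_one]; exact hu)
    rwa [one_mul] at this

theorem KK.mul {b : C} {y : Fin d → C} (h : KK b y) (c : C) : KK (c * b) y := by
  intro i s n u hu
  rw [mul_assoc]
  exact Ideal.mul_mem_left _ _ (h i s n u hu)

theorem KK.add {b c : C} {y : Fin d → C} (h : KK b y) (h' : KK c y) : KK (b + c) y := by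
  intro i s n u hu
  rw [add_mul]
  exact Ideal.add_mem _ (h i s n u hu) (h' i s n u hu)

theorem KK.short [IsLocalRing C] [IsNoetherianRing C] {b : C} {y : Fin d → C} (h : KK b y)
    (hy : ∀ j, y j ∈ maximalIdeal C) (i : Fin d) (T : Set (Fin d)) (hT : i ∉ T)
    (s : Fin d → ℕ) (n : ℕ) (u : C) (hu : y i ^ n * u ∈ PS y s T) : b * u ∈ PS y s T := by
  classical
  refine krull_closed _ _ fun N => ?_
  let s' : Fin d → ℕ := fun j => if j ∈ T then s j else N
  have h1 : PS y s T = PS y s' T := PS_congr fun j hj => by simp [s', hj]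
  have h2 : y i ^ n * u ∈ PS y s' {i}ᶜ := by
    rw [h1] at hu
    refine PS_mono _ _ ?_ hu
    rintro j hj rfl
    exact hT hj
  refine (Ideal.span_le.2 ?_ : PS y s' {i}ᶜ ≤ _) (h i s' n u h2)
  rintro z ⟨j, hj, rfl⟩
  by_cases hjT : j ∈ T
  · rw [h1]; exact Ideal.mem_sup_left (PS_mem _ _ hjT)
  · refine Ideal.mem_sup_right ?_
    simp only [s', if_neg hjT]
    exact Ideal.pow_mem_pow (hy j) N

theorem KK.exchange [IsLocalRing C] [IsNoetherianRing C] {b : C} {y : Fin d → C} (h : KK b y)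
    (hy : ∀ j, y j ∈ maximalIdeal C) (k : Fin d) (w : C)
    (hw : (Ideal.span (Set.range (Function.update y k w))).radical = maximalIdeal C) :
    KK (b * b) (Function.update y k w) := by
  classical
  set y' := Function.update y k w with hy'
  have hk : y' k = w := by simp [hy']
  have hne : ∀ j, j ≠ k → y' j = y j := fun j hj => by simp [hy', hj]
  have key : ∀ (s : Fin d → ℕ), ∃ N, y k ^ N ∈ PS y' s Set.univ := by
    intro s
    have h1 : y k ∈ (PS y' s Set.univ).radical := by
      have h2 : Ideal.span (Set.range y') ≤ (PS y' s Set.univ).radical := by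
        rw [Ideal.span_le]
        rintro _ ⟨j, rfl⟩
        exact ⟨s j, PS_mem _ _ trivial⟩
      have h3 := Ideal.radical_mono h2
      rw [hw, Ideal.radical_idem] at h3
      exact h3 (hy k)
    exact h1
  have Hk : ∀ (s : Fin d → ℕ) (u : C), y' k ^ s k * u ∈ PS y' s {k}ᶜ → b * u ∈ PS y' s {k}ᶜ := by
    intro s u hu
    have e : PS y' s {k}ᶜ = PS y s {k}ᶜ := PS_congr fun j hj => by rw [hne j hj]
    obtain ⟨N, hN⟩ := key s
    have e2 : (Set.univ : Set (Fin d)) = insert k {k}ᶜ := by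
      ext j; simp [em]
    rw [e2, PS_insert] at hN
    obtain ⟨v, hv, v', hv', e3⟩ := Submodule.mem_sup.1 hN
    obtain ⟨r, rfl⟩ := Ideal.mem_span_singleton'.1 hv
    have : y k ^ N * u ∈ PS y s {k}ᶜ := by
      rw [← e3, ← e]
      have : (r * y' k ^ s k + v') * u = r * (y' k ^ s k * u) + u * v' := by ring
      rw [this]
      exact Ideal.add_mem _ (Ideal.mul_mem_left _ _ hu) (Ideal.mul_mem_left _ _ hv')
    rw [e]
    exact h k s N u this
  intro i s n u hu
  by_cases hik : i = k
  · subst hik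
    rw [mul_assoc]
    refine Ideal.mul_mem_left _ _ ?_
    have e : PS y' s {i}ᶜ = PS y' (Function.update s i n) {i}ᶜ := PS_congr fun j hj => by
      rw [Function.update_of_ne hj]
    rw [e] at hu ⊢
    exact Hk _ u (by simpa using hu)
  · have e1 : ({i}ᶜ : Set (Fin d)) = insert k {i, k}ᶜ := by
      ext j
      simp only [Set.mem_compl_iff, Set.mem_singleton_iff, Set.mem_insert_iff, not_or]
      constructor
      · intro hj; by_cases hjk : j = k
        · exact Or.inl hjk
        · exact Or.inr ⟨hj, hjk⟩
      · rintro (rfl | h)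
        · exact fun h => hik h.symm
        · exact h.1
    have e1' : ({k}ᶜ : Set (Fin d)) = insert i {i, k}ᶜ := by
      ext j
      simp only [Set.mem_compl_iff, Set.mem_singleton_iff, Set.mem_insert_iff, not_or]
      constructor
      · intro hj; by_cases hjk : j = i
        · exact Or.inl hjk
        · exact Or.inr ⟨hjk, hj⟩
      · rintro (rfl | h)
        · exact hik
        · exact h.2
    have e0 : PS y' s {i, k}ᶜ = PS y s {i, k}ᶜ := PS_congr fun j hj => by
      rw [hne j (fun h => hj (Or.inr h))]
    rw [e1, PS_insert] at hu ⊢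
    obtain ⟨v, hv, e, he, e3⟩ := Submodule.mem_sup.1 hu
    obtain ⟨r, rfl⟩ := Ideal.mem_span_singleton'.1 hv
    let s' := Function.update s i n
    have es : PS y' s' {i, k}ᶜ = PS y' s {i, k}ᶜ := PS_congr fun j hj => by
      simp only [s']
      rw [Function.update_of_ne (fun h => hj (Or.inl h))]
    have h1 : b * r ∈ PS y' s' {k}ᶜ := by
      apply Hk
      rw [e1', PS_insert, es]
      have : y' k ^ s' k * r = y' i ^ n * u - e := by
        have : s' k = s k := by simp only [s']; rw [Function.update_of_ne (Ne.symm hik)]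
        rw [← e3, this]; ring
      rw [this]
      refine Ideal.sub_mem _ (Ideal.mem_sup_left ?_) (Ideal.mem_sup_right he)
      simp only [s', Function.update_self]
      exact Ideal.mul_mem_right _ _ (Ideal.mem_span_singleton_self _)
    rw [e1', PS_insert, es] at h1
    obtain ⟨v', hv', e', he', e4⟩ := Submodule.mem_sup.1 h1
    obtain ⟨v, rfl⟩ := Ideal.mem_span_singleton'.1 hv'
    simp only [s', Function.update_self] at e4
    have h2 : b * (b * u - v * y' k ^ s k) ∈ PS y s {i, k}ᶜ := by
      apply h.short hy i _ (by simp) s n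
      rw [← hne i hik, ← e0]
      have : y' i ^ n * (b * u - v * y' k ^ s k) = y' k ^ s k * e' + b * e := by
        linear_combination (-b) * e3 - y' k ^ s k * e4
      rw [this]
      exact Ideal.add_mem _ (Ideal.mul_mem_left _ _ he') (Ideal.mul_mem_left _ _ he)
    rw [← e0] at h2
    have : b * b * u = b * v * y' k ^ s k + b * (b * u - v * y' k ^ s k) := by ring
    rw [this]
    exact Ideal.add_mem _ (Ideal.mem_sup_left
      (Ideal.mul_mem_left _ _ (Ideal.mem_span_singleton_self _))) (Ideal.mem_sup_right h2)

/-- A one-step replacement: minimal primes argument. -/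
theorem sop_step [IsLocalRing C] [IsNoetherianRing C] {y : Fin d → C} (hy : IsSOP C y) (k : Fin d)
    (w : C) (hw : w ∈ maximalIdeal C)
    (hav : ∀ P ∈ (PS y 1 {k}ᶜ).minimalPrimes, P ≠ maximalIdeal C → w ∉ P) :
    IsSOP C (Function.update y k w) := by
  classical
  refine ⟨hy.1, le_antisymm ?_ ?_⟩
  · rw [Ideal.IsPrime.radical_le_iff inferInstance, Ideal.span_le]
    rintro _ ⟨j, rfl⟩
    by_cases hj : j = k
    · subst hj; simpa using hw
    · simpa [hj] using hy.mem j
  rw [Ideal.radical_eq_sInf]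
  refine le_sInf ?_
  rintro q ⟨hq, hqp⟩
  by_contra hne
  have hqm : q < maximalIdeal C := lt_of_le_of_ne (le_maximalIdeal hqp.ne_top) fun h => hne h.ge
  have h1 : PS y 1 {k}ᶜ ≤ q := by
    unfold PS
    rw [Ideal.span_le]
    rintro _ ⟨j, hj, rfl⟩
    have : Function.update y k w j ∈ q := hq (Ideal.subset_span ⟨j, rfl⟩)
    rw [Function.update_of_ne hj] at this
    simpa using this
  have hwq : w ∈ q := by
    have : Function.update y k w k ∈ q := hq (Ideal.subset_span ⟨k, rfl⟩)
    simpa using this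
  obtain ⟨P, hP, hPq⟩ := Ideal.exists_minimalPrimes_le h1
  have hPq' : P < q := by
    refine lt_of_le_of_ne hPq ?_
    rintro rfl
    exact hav P hP (ne_of_lt hqm) hwq
  have hPP : P.IsPrime := hP.1.1
  -- Krull
  have h2 : maximalIdeal C ∈ (P ⊔ Ideal.span {y k}).minimalPrimes := by
    refine ⟨⟨inferInstance, sup_le (hPq.trans hqm.le) ?_⟩, ?_⟩
    · rw [Ideal.span_singleton_le_iff_mem]; exact hy.mem k
    · rintro J ⟨hJ, hJ2⟩ -
      have : Ideal.span (Set.range y) ≤ J := by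
        rw [Ideal.span_le]
        rintro _ ⟨j, rfl⟩
        by_cases hj : j = k
        · subst hj; exact hJ2 (Ideal.mem_sup_right (Ideal.mem_span_singleton_self _))
        · have := hP.1.2 (PS_mem y 1 (show j ∈ ({k}ᶜ : Set (Fin d)) from hj))
          exact hJ2 (Ideal.mem_sup_left (by simpa using this))
      rw [← hy.2]
      exact (Ideal.IsPrime.radical_le_iff hJ).2 this
  have h3 := Ideal.map_height_le_one_of_mem_minimalPrimes h2
  have hsurj : Function.Surjective (Ideal.Quotient.mk P) := Ideal.Quotient.mk_surjective
  have hker : RingHom.ker (Ideal.Quotient.mk P) = P := Ideal.mk_ker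
  have hq1 : (q.map (Ideal.Quotient.mk P)).IsPrime :=
    Ideal.map_isPrime_of_surjective hsurj (by rw [hker]; exact hPq)
  have hm1 : ((maximalIdeal C).map (Ideal.Quotient.mk P)).IsPrime :=
    Ideal.map_isPrime_of_surjective hsurj (by rw [hker]; exact hPq.trans hqm.le)
  have cq : (q.map (Ideal.Quotient.mk P)).comap (Ideal.Quotient.mk P) = q := by
    rw [Ideal.comap_map_of_surjective' _ hsurj, hker, sup_eq_left.2 hPq]
  have cm : ((maximalIdeal C).map (Ideal.Quotient.mk P)).comap (Ideal.Quotient.mk P) =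
      maximalIdeal C := by
    rw [Ideal.comap_map_of_surjective' _ hsurj, hker, sup_eq_left.2 (hPq.trans hqm.le)]
  have l1 : (⊥ : Ideal (C ⧸ P)) < q.map (Ideal.Quotient.mk P) := by
    rw [bot_lt_iff_ne_bot]
    intro h
    rw [h, ← RingHom.ker_eq_comap_bot, hker] at cq
    exact hPq'.ne cq
  have l2 : q.map (Ideal.Quotient.mk P) < (maximalIdeal C).map (Ideal.Quotient.mk P) := by
    refine lt_of_le_of_ne (Ideal.map_mono hqm.le) ?_
    intro h
    rw [h, cm] at cq
    exact hqm.ne cq.symm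
  have l3 := Ideal.height_strict_mono_of_isPrime_of_isPrime l1
  have l4 := Ideal.height_strict_mono_of_isPrime_of_isPrime l2
  have l5 : (1 : ℕ∞) ≤ (q.map (Ideal.Quotient.mk P)).height := Order.one_le_iff_pos.2 (pos_of_gt l3)
  exact absurd (l5.trans_lt (l4.trans_le h3)) (lt_irrefl _)

theorem sop_avoid [IsLocalRing C] [IsNoetherianRing C] {y : Fin d → C} (hy : IsSOP C y) (k : Fin d) :
    maximalIdeal C ∉ (PS y 1 {k}ᶜ).minimalPrimes := by
  classical
  intro h
  have h1 : ({z | ∃ j, j ∈ ({k}ᶜ : Set (Fin d)) ∧ z = y j ^ (1 : Fin d → ℕ) j} : Set C) =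
      ((Finset.univ.erase k).image y : Finset C) := by
    ext z
    simp [eq_comm]
  unfold PS at h
  rw [h1] at h
  have h2 := Ideal.height_le_card_of_mem_minimalPrimes_span_finset h
  have h3 : ((maximalIdeal C).height : WithBot ℕ∞) = d := by
    rw [maximalIdeal_height_eq_ringKrullDim, hy.1]
  have h4 : ((Finset.univ.erase k).image y).card ≤ d - 1 := by
    refine Finset.card_image_le.trans ?_
    rw [Finset.card_erase_of_mem (Finset.mem_univ _)]; simp
  have h5 : (maximalIdeal C).height = (d : ℕ∞) := by exact_mod_cast h3
  rw [h5] at h2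
  have h6 : d ≤ ((Finset.univ.erase k).image y).card := by exact_mod_cast h2
  have := k.2
  omega

theorem exists_common [IsLocalRing C] [IsNoetherianRing C] {x y : Fin d → C} (hx : IsSOP C x)
    (hy : IsSOP C y) (k : Fin d) : ∃ w, IsSOP C (Function.update x k w) ∧
      IsSOP C (Function.update y k w) := by
  classical
  let F : Set (Ideal C) := (PS x 1 {k}ᶜ).minimalPrimes ∪ (PS y 1 {k}ᶜ).minimalPrimes
  have hF : F.Finite := (Ideal.finite_minimalPrimes_of_isNoetherianRing C _).union
    (Ideal.finite_minimalPrimes_of_isNoetherianRing C _)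
  have hFp : ∀ P ∈ F, P.IsPrime := by
    rintro P (h | h) <;> exact h.1.1
  have hFm : ∀ P ∈ F, P ≠ maximalIdeal C := by
    rintro P (h | h) rfl
    · exact sop_avoid hx k h
    · exact sop_avoid hy k h
  have : ¬ ((maximalIdeal C : Set C) ⊆ ⋃ P ∈ F, (P : Set C)) := by
    intro h
    obtain ⟨P, hP, hle⟩ := (Ideal.subset_union_prime_finite hF (f := id) ⊥ ⊥
      (fun P hP _ _ => hFp P hP)).1 h
    exact hFm P hP (le_antisymm (le_maximalIdeal (hFp P hP).ne_top) hle)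
  obtain ⟨w, hw, hw2⟩ := Set.not_subset.1 this
  simp only [Set.mem_iUnion, not_exists] at hw2
  exact ⟨w, sop_step hx k w hw fun P hP _ => hw2 P (Or.inl hP),
    sop_step hy k w hw fun P hP _ => hw2 P (Or.inr hP)⟩

theorem KK.sop [IsLocalRing C] [IsNoetherianRing C] {b : C} {x y : Fin d → C} (hx : IsSOP C x)
    (hy : IsSOP C y) (h : KK b x) : ∃ N, KK (b ^ N) y := by
  classical
  induction hn : (Finset.univ.filter fun i => x i ≠ y i).card using Nat.strong_induction_on
    generalizing x y b with
  | _ n ih =>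
  by_cases hxy : x = y
  · subst hxy; exact ⟨1, by rwa [pow_one]⟩
  obtain ⟨k, hk⟩ := Function.ne_iff.1 hxy
  obtain ⟨w, hw1, hw2⟩ := exists_common hx hy k
  have h1 := h.exchange hx.mem k w hw1.2
  have hlt : (Finset.univ.filter fun i => Function.update x k w i ≠ Function.update y k w i).card
      < n := by
    rw [← hn]
    refine Finset.card_lt_card ⟨?_, ?_⟩
    · intro i hi
      simp only [Finset.mem_filter, Finset.mem_univ, true_and] at hi ⊢
      by_cases hik : i = k
      · subst hik; exact hk
      · simpa [hik] using hi
    · intro hh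
      have := hh (Finset.mem_filter.2 ⟨Finset.mem_univ k, hk⟩)
      simp at this
  obtain ⟨N, hN⟩ := ih _ hlt hw1 hw2 h1 rfl
  have h2 := hN.exchange hw2.mem k (y k) (by simpa using hy.2)
  refine ⟨N + N + (N + N), ?_⟩
  have e : Function.update (Function.update y k w) k (y k) = y := by simp
  rw [e] at h2
  convert h2 using 1
  ring

theorem REG.sop [IsLocalRing C] [IsNoetherianRing C] {x y : Fin d → C} (hx : IsSOP C x)
    (hy : IsSOP C y) (h : REG x) : REG y := by
  rw [REG_iff_KK] at h ⊢
  obtain ⟨N, hN⟩ := h.sop hx hy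
  rwa [one_pow] at hN

end Exchange

end Piece13

section Piece14

open IsLocalRing

theorem wb_cancel {d : ℕ} {r : WithBot ℕ∞} (h : (d : WithBot ℕ∞) + 1 ≤ r + 1) :
    (d : WithBot ℕ∞) ≤ r := by
  induction r with
  | bot =>
    have : (d : WithBot ℕ∞) + 1 ≤ ⊥ := h
    exact absurd this (by
      rw [le_bot_iff]
      exact_mod_cast WithBot.coe_ne_bot (a := ((d + 1 : ℕ) : ℕ∞)))
  | coe r =>
    have h4 : (d : ℕ∞) + 1 ≤ r + 1 := by exact_mod_cast h
    have h3 : (d : ℕ∞) ≤ r := (ENat.add_le_add_iff_right (by simp)).1 h4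
    exact_mod_cast h3

/-- quotient of a local ring by one of the generators of its maximal ideal -/
theorem RL_quot {S : Type*} [CommRing S] [IsLocalRing S] [IsNoetherianRing S] {d : ℕ}
    {s : Finset S} (hs : Ideal.span (s : Set S) = maximalIdeal S) (hc : s.card ≤ d + 1)
    (hd : ((d + 1 : ℕ) : WithBot ℕ∞) ≤ ringKrullDim S) {z : S} (hz : z ∈ s) :
    ∃ _ : IsLocalRing (S ⧸ Ideal.span {z}), ∃ s' : Finset (S ⧸ Ideal.span {z}),
      Ideal.span (s' : Set (S ⧸ Ideal.span {z})) = maximalIdeal (S ⧸ Ideal.span {z}) ∧ s'.card ≤ d ∧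
      (d : WithBot ℕ∞) ≤ ringKrullDim (S ⧸ Ideal.span {z}) := by
  classical
  have hzm : z ∈ maximalIdeal S := hs ▸ Ideal.subset_span hz
  have hnt : Nontrivial (S ⧸ Ideal.span {z}) := by
    apply Ideal.Quotient.nontrivial_iff.2
    intro h
    rw [Ideal.span_singleton_eq_top] at h
    exact hzm h
  have hsurj : Function.Surjective (Ideal.Quotient.mk (Ideal.span {z})) := Ideal.Quotient.mk_surjective
  have hl : IsLocalRing (S ⧸ Ideal.span {z}) := IsLocalRing.of_surjective' _ hsurj
  refine ⟨hl, (s.erase z).image (Ideal.Quotient.mk (Ideal.span {z})), ?_, ?_, ?_⟩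
  · have h1 : (maximalIdeal S).map (Ideal.Quotient.mk (Ideal.span {z})) =
        maximalIdeal (S ⧸ Ideal.span {z}) := by
      have := IsLocalHom.of_surjective (Ideal.Quotient.mk (Ideal.span {z})) hsurj
      refine le_antisymm ((local_hom_TFAE (Ideal.Quotient.mk (Ideal.span {z}))).out 0 2 |>.1 this) ?_
      intro a ha
      obtain ⟨b, rfl⟩ := hsurj a
      refine Ideal.mem_map_of_mem _ ?_
      exact fun hb => ha (hb.map _)
    rw [← h1, ← hs, Ideal.map_span]
    apply le_antisymm
    · apply Ideal.span_mono
      rw [Finset.coe_image]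
      exact Set.image_mono (by simp)
    · rw [Ideal.span_le]
      rintro _ ⟨a, ha, rfl⟩
      by_cases haz : a = z
      · subst haz
        have : (Ideal.Quotient.mk (Ideal.span {a})) a = 0 :=
          Ideal.Quotient.eq_zero_iff_mem.2 (Ideal.mem_span_singleton_self _)
        simp only [this]
        exact Submodule.zero_mem _
      · exact Ideal.subset_span (by
          rw [Finset.coe_image]
          exact ⟨a, Finset.mem_coe.2 (Finset.mem_erase.2 ⟨haz, ha⟩), rfl⟩)
  · refine Finset.card_image_le.trans ?_
    rw [Finset.card_erase_of_mem hz]; omega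
  · have := ringKrullDim_le_ringKrullDim_quotient_add_card {z} (R := S) (by
      simpa [ringJacobson_eq_maximalIdeal] using hzm)
    rw [Finset.coe_singleton] at this
    simp only [Finset.card_singleton, Nat.cast_one] at this
    have h2 := hd.trans this
    exact wb_cancel (by exact_mod_cast h2)

theorem RL_dom {S : Type*} [CommRing S] [IsLocalRing S] [IsNoetherianRing S] {d : ℕ}
    {s : Finset S} (hs : Ideal.span (s : Set S) = maximalIdeal S) (hc : s.card ≤ d)
    (hd : (d : WithBot ℕ∞) ≤ ringKrullDim S) : IsDomain S := by
  classical
  induction d generalizing S with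
  | zero =>
    have : s = ∅ := by simpa using hc
    subst this
    have h0 : maximalIdeal S = ⊥ := by rw [← hs]; simp
    exact (isField_iff_maximalIdeal_eq.2 h0).isDomain
  | succ d ih =>
    have hdim : ((d + 1 : ℕ) : ℕ∞) ≤ (maximalIdeal S).height := by
      rw [← maximalIdeal_height_eq_ringKrullDim] at hd
      exact_mod_cast hd
    have hnmin : maximalIdeal S ∉ minimalPrimes S := by
      intro h
      have : (maximalIdeal S).height = 0 := by
        exact Ideal.height_eq_zero_iff.2 h
      rw [this] at hdim
      have : d + 1 ≤ 0 := by exact_mod_cast hdim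
      omega
    have hm2 : ¬ maximalIdeal S ≤ maximalIdeal S ^ 2 := by
      intro h
      have h0 : maximalIdeal S = ⊥ := by
        refine Submodule.eq_bot_of_le_smul_of_le_jacobson_bot (maximalIdeal S) _
          (IsNoetherian.noetherian _) ?_ (maximalIdeal_le_jacobson _)
        rw [smul_eq_mul, ← pow_two]; exact h
      apply hnmin
      refine ⟨⟨inferInstance, bot_le⟩, fun J hJ _ => ?_⟩
      rw [h0]; exact bot_le
    have hex : ∃ z ∈ maximalIdeal S, z ∉ maximalIdeal S ^ 2 ∧ ∀ P ∈ minimalPrimes S, z ∉ P := by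
      have hfin : (insert (maximalIdeal S ^ 2) (minimalPrimes S)).Finite :=
        (minimalPrimes.finite_of_isNoetherianRing S).insert _
      have : ¬ ((maximalIdeal S : Set S) ⊆ ⋃ P ∈ insert (maximalIdeal S ^ 2) (minimalPrimes S),
          (P : Set S)) := by
        intro h
        obtain ⟨P, hP, hle⟩ := (Ideal.subset_union_prime_finite hfin (f := id) (maximalIdeal S ^ 2)
          (maximalIdeal S ^ 2) (fun P hP h1 _ => (hP.resolve_left h1).1.1)).1 h
        rcases hP with rfl | hP
        · exact hm2 hle
        · have := le_antisymm (le_maximalIdeal hP.1.1.ne_top) hle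
          exact hnmin (this ▸ hP)
      obtain ⟨z, hz, hz2⟩ := Set.not_subset.1 this
      simp only [Set.mem_iUnion, not_exists] at hz2
      exact ⟨z, hz, hz2 _ (Or.inl rfl), fun P hP => hz2 P (Or.inr hP)⟩
    obtain ⟨z, hz, hz2, hzP⟩ := hex
    have hz' := hz
    rw [← hs, Ideal.span, Submodule.mem_span_finset'] at hz'
    obtain ⟨a, ha⟩ := hz'
    obtain ⟨j, hj⟩ : ∃ j : s, IsUnit (a j) := by
      by_contra hcon
      push Not at hcon
      apply hz2
      rw [← ha, pow_two]
      refine Ideal.sum_mem _ fun j _ => ?_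
      exact Ideal.mul_mem_mul (hcon j) (hs ▸ Ideal.subset_span j.2)
    let s' := insert z (s.erase j)
    have hs' : Ideal.span (s' : Set S) = maximalIdeal S := by
      apply le_antisymm
      · rw [Ideal.span_le]
        intro x hx
        rcases Finset.mem_insert.1 hx with rfl | hx
        · exact hz
        · exact hs ▸ Ideal.subset_span (Finset.mem_of_mem_erase hx)
      · have hoth : ∀ x ∈ s, x ≠ j → x ∈ Ideal.span (s' : Set S) := fun x hx hxj =>
          Ideal.subset_span (Finset.mem_insert_of_mem (Finset.mem_erase.2 ⟨hxj, hx⟩))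
        rw [← hs, Ideal.span_le]
        intro x hx
        by_cases hxj : x = j
        · subst hxj
          have h1 : a j * j ∈ Ideal.span (s' : Set S) := by
            have : a j * (j : S) = z - ∑ i ∈ Finset.univ.erase j, a i • (i : S) := by
              rw [← ha, ← Finset.add_sum_erase _ _ (Finset.mem_univ j)]; simp
            rw [this]
            refine Ideal.sub_mem _ (Ideal.subset_span (Finset.mem_insert_self _ _))
              (Ideal.sum_mem _ fun i hi => Ideal.mul_mem_left _ _ (hoth i i.2 ?_))
            intro h
            exact (Finset.mem_erase.1 hi).1 (Subtype.ext h)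
          exact (Ideal.unit_mul_mem_iff_mem _ hj).1 h1
        · exact hoth x hx hxj
    have hc' : s'.card ≤ d + 1 := by
      refine (Finset.card_insert_le _ _).trans ?_
      rw [Finset.card_erase_of_mem j.2]
      have := Finset.card_pos.2 ⟨_, j.2⟩
      omega
    obtain ⟨hl, t, ht, htc, htd⟩ := RL_quot hs' hc' hd (Finset.mem_insert_self z _)
    have hdom : IsDomain (S ⧸ Ideal.span {z}) := ih ht htc htd
    have hzprime : (Ideal.span {z}).IsPrime := (Ideal.Quotient.isDomain_iff_prime _).1 hdom
    obtain ⟨q, hq, hqz⟩ := Ideal.exists_minimalPrimes_le (bot_le : ⊥ ≤ Ideal.span {z})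
    have hqp : q.IsPrime := hq.1.1
    have hq0 : q = ⊥ := by
      refine Submodule.eq_bot_of_le_smul_of_le_jacobson_bot (Ideal.span {z}) _
        (IsNoetherian.noetherian _) ?_ ?_
      · intro x hx
        obtain ⟨b, rfl⟩ := Ideal.mem_span_singleton'.1 (hqz hx)
        rw [mul_comm, smul_eq_mul]
        exact Ideal.mul_mem_mul (Ideal.mem_span_singleton_self _)
          ((hqp.mem_or_mem hx).resolve_right (hzP q hq))
      · rw [Ideal.span_singleton_le_iff_mem]
        exact maximalIdeal_le_jacobson _ hz
    subst hq0
    exact (IsDomain.of_bot_isPrime S)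

theorem quot_max {S : Type*} [CommRing S] [IsLocalRing S] (J : Ideal S) (hJ : J ≤ maximalIdeal S) :
    ∃ _ : IsLocalRing (S ⧸ J), (maximalIdeal S).map (Ideal.Quotient.mk J) = maximalIdeal (S ⧸ J) := by
  have hnt : Nontrivial (S ⧸ J) := by
    apply Ideal.Quotient.nontrivial_iff.2
    rintro rfl
    exact (Ideal.IsPrime.ne_top (inferInstance : (maximalIdeal S).IsPrime)) (top_le_iff.1 hJ)
  have hsurj : Function.Surjective (Ideal.Quotient.mk J) := Ideal.Quotient.mk_surjective
  have hl : IsLocalRing (S ⧸ J) := IsLocalRing.of_surjective' _ hsurj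
  refine ⟨hl, ?_⟩
  have := IsLocalHom.of_surjective (Ideal.Quotient.mk J) hsurj
  refine le_antisymm ((local_hom_TFAE (Ideal.Quotient.mk J)).out 0 2 |>.1 this) ?_
  intro a ha
  obtain ⟨b, rfl⟩ := hsurj a
  refine Ideal.mem_map_of_mem _ ?_
  exact fun hb => ha (hb.map _)

theorem wb_cancel' {d n : ℕ} {r : WithBot ℕ∞} (h : (d : WithBot ℕ∞) + n ≤ r + n) :
    (d : WithBot ℕ∞) ≤ r := by
  induction n with
  | zero => simpa using h
  | succ n ih =>
    apply ih
    have : ((d + n : ℕ) : WithBot ℕ∞) + 1 ≤ (r + n) + 1 := by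
      push_cast at h ⊢
      rwa [← add_assoc, ← add_assoc] at h
    have := wb_cancel this
    exact_mod_cast this

theorem RL_prime {S : Type*} [CommRing S] [IsLocalRing S] [IsNoetherianRing S] {d : ℕ}
    {s : Finset S} (hs : Ideal.span (s : Set S) = maximalIdeal S) (hc : s.card ≤ d)
    (hd : (d : WithBot ℕ∞) ≤ ringKrullDim S) (t : Finset S) (ht : t ⊆ s) :
    (Ideal.span (t : Set S)).IsPrime := by
  classical
  have htm : Ideal.span (t : Set S) ≤ maximalIdeal S := hs ▸ Ideal.span_mono (by simpa using ht)
  obtain ⟨hl, hm⟩ := quot_max _ htm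
  rw [← Ideal.Quotient.isDomain_iff_prime]
  have hct := Finset.card_le_card ht
  refine RL_dom (d := d - t.card) (s := (s \ t).image (Ideal.Quotient.mk _)) ?_ ?_ ?_
  · rw [← hm, ← hs, Ideal.map_span]
    apply le_antisymm
    · apply Ideal.span_mono
      rw [Finset.coe_image]
      exact Set.image_mono (by simp)
    · rw [Ideal.span_le]
      rintro _ ⟨a, ha, rfl⟩
      by_cases haz : a ∈ t
      · have : (Ideal.Quotient.mk (Ideal.span (t : Set S))) a = 0 :=
          Ideal.Quotient.eq_zero_iff_mem.2 (Ideal.subset_span haz)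
        simp only [this]
        exact Submodule.zero_mem _
      · exact Ideal.subset_span (by
          rw [Finset.coe_image]
          exact ⟨a, Finset.mem_coe.2 (Finset.mem_sdiff.2 ⟨ha, haz⟩), rfl⟩)
  · refine Finset.card_image_le.trans ?_
    rw [Finset.card_sdiff_of_subset ht]; omega
  · have := ringKrullDim_le_ringKrullDim_quotient_add_card t (R := S) (by
      rw [ringJacobson_eq_maximalIdeal]
      exact fun x hx => htm (Ideal.subset_span hx))
    have h2 := hd.trans this
    refine wb_cancel' (n := t.card) (le_trans (le_of_eq ?_) h2)
    have : d = d - t.card + t.card := by omega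
    conv_rhs => rw [this]
    push_cast
    rfl

theorem RL_notMem {S : Type*} [CommRing S] [IsLocalRing S] [IsNoetherianRing S] {d : ℕ}
    {s : Finset S} (hs : Ideal.span (s : Set S) = maximalIdeal S) (hc : s.card ≤ d)
    (hd : (d : WithBot ℕ∞) ≤ ringKrullDim S) (t : Finset S) (ht : t ⊆ s) (z : S) (hz : z ∈ s)
    (hzt : z ∉ t) : z ∉ Ideal.span (t : Set S) := by
  classical
  intro h
  have h1 : Ideal.span ((s.erase z : Finset S) : Set S) = maximalIdeal S := by
    rw [← hs]
    apply le_antisymm (Ideal.span_mono (by simp))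
    rw [Ideal.span_le]
    intro a ha
    by_cases haz : a = z
    · subst haz
      refine (Ideal.span_mono ?_ : Ideal.span (t : Set S) ≤ _) h
      intro b hb
      refine Finset.mem_coe.2 (Finset.mem_erase.2 ⟨?_, ht hb⟩)
      rintro rfl
      exact hzt hb
    · exact Ideal.subset_span (Finset.mem_coe.2 (Finset.mem_erase.2 ⟨haz, ha⟩))
  have h2 := ringKrullDim_le_spanFinrank_maximalIdeal (R := S)
  have h3 : (maximalIdeal S).spanFinrank ≤ (s.erase z).card := by
    rw [← h1]
    refine (Submodule.spanFinrank_span_le_ncard_of_finite (Finset.finite_toSet _)).trans ?_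
    rw [Set.ncard_coe_finset]
  have h4 : (d : WithBot ℕ∞) ≤ ((maximalIdeal S).spanFinrank : WithBot ℕ∞) := hd.trans h2
  have h5 : d ≤ (maximalIdeal S).spanFinrank := by exact_mod_cast h4
  rw [Finset.card_erase_of_mem hz] at h3
  have := Finset.card_pos.2 ⟨_, hz⟩
  omega

end Piece14

section Piece15

open IsLocalRing

section FlatStep

variable {A S : Type*} [CommRing A] [CommRing S] [Algebra A S]

/-- relations of `f` modulo `J`, mapped to `S`. -/
def RelS (S : Type*) [CommRing S] [Algebra A S] (J : Ideal A) {ι : Type} [Fintype ι] (f : ι → A) :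
    Submodule S (ι → S) :=
  Submodule.span S {v | ∃ r : ι → A, ∑ i, f i * r i ∈ J ∧ v = fun i => algebraMap A S (r i)}

/-- Elementary form of the flatness of `S/JS` over `A/J`. -/
def FL (S : Type*) [CommRing S] [Algebra A S] (J : Ideal A) : Prop :=
  ∀ (ι : Type) [Fintype ι] (f : ι → A) (s : ι → S),
    ∑ i, algebraMap A S (f i) * s i ∈ J.map (algebraMap A S) → s ∈ RelS S J f

theorem RelS_mem {J : Ideal A} {ι : Type} [Fintype ι] {f : ι → A} {r : ι → A}
    (h : ∑ i, f i * r i ∈ J) : (fun i => algebraMap A S (r i)) ∈ RelS S J f :=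
  Submodule.subset_span ⟨r, h, rfl⟩

theorem FL_step [IsNoetherianRing A] [IsLocalRing S] [IsNoetherianRing S] (J : Ideal A) (y : A)
    (hy : algebraMap A S y ∈ maximalIdeal S)
    (hreg : ∀ u, algebraMap A S y * u ∈ J.map (algebraMap A S) → u ∈ J.map (algebraMap A S))
    (h : FL S (J ⊔ Ideal.span {y})) : FL S J := by
  classical
  suffices H : ∀ I : Ideal A, ∀ (ι : Type) [Fintype ι] (f : ι → A),
      I = Ideal.span (Set.range f) ⊔ J → ∀ s : ι → S,
      ∑ i, algebraMap A S (f i) * s i ∈ J.map (algebraMap A S) → s ∈ RelS S J f by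
    intro ι _ f s hs
    exact H _ ι f rfl s hs
  intro I
  induction I using WellFoundedGT.induction with
  | _ I ih =>
  intro ι _ f hI
  let Z : Submodule S (ι → S) :=
    { carrier := {s | ∑ i, algebraMap A S (f i) * s i ∈ J.map (algebraMap A S)}
      zero_mem' := by simp
      add_mem' := by
        intro a b ha hb
        simp only [Set.mem_ofPred_eq] at ha hb ⊢
        convert Ideal.add_mem _ ha hb using 1
        rw [← Finset.sum_add_distrib]
        exact Finset.sum_congr rfl fun i _ => by simp [mul_add]
      smul_mem' := by
        intro c a ha
        simp only [Set.mem_ofPred_eq] at ha ⊢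
        convert Ideal.mul_mem_left _ c ha using 1
        rw [Finset.mul_sum]
        exact Finset.sum_congr rfl fun i _ => by simp; ring }
  have hZ : ∀ s, s ∈ Z ↔ ∑ i, algebraMap A S (f i) * s i ∈ J.map (algebraMap A S) := fun s => Iff.rfl
  suffices hle : Z ≤ RelS S J f ⊔ (Ideal.span {algebraMap A S y}) • Z by
    intro s hs
    have := Submodule.le_of_le_smul_of_le_jacobson_bot (IsNoetherian.noetherian Z) (by
      rw [Ideal.span_singleton_le_iff_mem]
      exact maximalIdeal_le_jacobson _ hy) hle
    exact this hs
  intro s hs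
  have h1 : s ∈ RelS S (J ⊔ Ideal.span {y}) f := by
    apply h
    exact Ideal.map_mono le_sup_left ((hZ s).1 hs)
  obtain ⟨m, c, g, hg⟩ := Submodule.mem_span_set'.1 h1
  choose r hr hr' using fun l => (g l).2
  have hr2 : ∀ l, ∃ j ∈ J, ∃ a, ∑ i, f i * r l i = j + y * a := by
    intro l
    obtain ⟨j, hj, b, hb, e⟩ := Submodule.mem_sup.1 (hr l)
    obtain ⟨a, rfl⟩ := Ideal.mem_span_singleton'.1 hb
    exact ⟨j, hj, a, by rw [← e]; ring⟩
  choose j hj a ha using hr2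
  have hs' : ∀ i, s i = ∑ l, c l * algebraMap A S (r l i) := by
    intro i
    rw [← hg, Finset.sum_apply]
    exact Finset.sum_congr rfl fun l _ => by rw [Pi.smul_apply, hr' l, smul_eq_mul]
  have hca : ∑ l, algebraMap A S (a l) * c l ∈ J.map (algebraMap A S) := by
    apply hreg
    have : algebraMap A S y * ∑ l, algebraMap A S (a l) * c l =
        ∑ i, algebraMap A S (f i) * s i - ∑ l, c l * algebraMap A S (j l) := by
      have e1 : ∑ i, algebraMap A S (f i) * s i = ∑ l, c l * algebraMap A S (j l + y * a l) := by
        simp_rw [← ha, hs', map_sum, map_mul, Finset.mul_sum]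
        rw [Finset.sum_comm]
        exact Finset.sum_congr rfl fun l _ => Finset.sum_congr rfl fun i _ => by ring
      rw [e1, ← Finset.sum_sub_distrib, Finset.mul_sum]
      exact Finset.sum_congr rfl fun l _ => by simp; ring
    rw [this]
    exact Ideal.sub_mem _ ((hZ s).1 hs) (Ideal.sum_mem _ fun l _ =>
      Ideal.mul_mem_left _ _ (Ideal.mem_map_of_mem _ (hj l)))
  by_cases hall : ∀ l, a l ∈ I
  · -- all in I
    have ht : ∀ l, ∃ t : ι → A, a l - ∑ i, f i * t i ∈ J := by
      intro l
      have := hall l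
      rw [hI] at this
      obtain ⟨b, hb, b', hb', e⟩ := Submodule.mem_sup.1 this
      obtain ⟨t, ht⟩ := Submodule.mem_span_range_iff_exists_fun A |>.1 hb
      refine ⟨t, ?_⟩
      have : a l - ∑ i, f i * t i = b' := by
        rw [← e, ← ht]
        simp [mul_comm]
      rwa [this]
    choose t ht using ht
    have h2 : (fun i => ∑ l, c l * algebraMap A S (r l i - y * t l i)) ∈ RelS S J f := by
      have : (fun i => ∑ l, c l * algebraMap A S (r l i - y * t l i)) =
          ∑ l, c l • (fun i => algebraMap A S (r l i - y * t l i)) := by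
        ext i; simp
      rw [this]
      refine Submodule.sum_mem _ fun l _ => Submodule.smul_mem _ _ (RelS_mem ?_)
      have : ∑ i, f i * (r l i - y * t l i) = j l + y * (a l - ∑ i, f i * t l i) := by
        simp_rw [mul_sub, Finset.sum_sub_distrib, ha, Finset.mul_sum]
        rw [add_sub_assoc]
        congr 2
        exact Finset.sum_congr rfl fun i _ => by ring
      rw [this]
      exact Ideal.add_mem _ (hj l) (Ideal.mul_mem_left _ _ (ht l))
    have h2Z : (fun i => ∑ l, c l * algebraMap A S (r l i - y * t l i)) ∈ Z := by
      refine (Submodule.span_le.2 ?_ : RelS S J f ≤ Z) h2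
      rintro _ ⟨r, hr, rfl⟩
      change _ ∈ J.map _
      have := Ideal.mem_map_of_mem (algebraMap A S) hr
      simpa using this
    have h3 : s = (fun i => ∑ l, c l * algebraMap A S (r l i - y * t l i)) +
        algebraMap A S y • (fun i => ∑ l, c l * algebraMap A S (t l i)) := by
      ext i
      simp only [Pi.add_apply, Pi.smul_apply, smul_eq_mul]
      rw [hs', Finset.mul_sum, ← Finset.sum_add_distrib]
      exact Finset.sum_congr rfl fun l _ => by simp; ring
    have h4 : (fun i => ∑ l, c l * algebraMap A S (t l i)) ∈ Z := by
      have h5 := Submodule.sub_mem _ hs h2Z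
      rw [h3, add_sub_cancel_left, hZ] at h5
      rw [hZ]
      apply hreg
      convert h5 using 1
      rw [Finset.mul_sum]
      exact Finset.sum_congr rfl fun i _ => by simp only [Pi.smul_apply, smul_eq_mul]; ring
    rw [h3]
    exact Submodule.add_mem_sup h2 (Submodule.smul_mem_smul (Ideal.mem_span_singleton_self _) h4)
  · -- larger ideal
    refine Submodule.mem_sup_left ?_
    push Not at hall
    obtain ⟨l0, hl0⟩ := hall
    have hlt : I < Ideal.span (Set.range (Sum.elim a f)) ⊔ J := by
      refine lt_of_le_of_ne ?_ ?_
      · rw [hI]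
        refine sup_le_sup_right (Ideal.span_mono ?_) _
        rintro _ ⟨i, rfl⟩
        exact ⟨Sum.inr i, rfl⟩
      · intro e
        apply hl0
        rw [e]
        exact Ideal.mem_sup_left (Ideal.subset_span ⟨Sum.inl l0, rfl⟩)
    have h2 := ih _ hlt (Fin m ⊕ ι) (Sum.elim a f) rfl (Sum.elim c 0) (by
      simpa using hca)
    obtain ⟨m', σ, g', hg'⟩ := Submodule.mem_span_set'.1 h2
    choose ρ hρ hρ' using fun k => (g' k).2
    have hc : ∀ l, c l = ∑ k, σ k * algebraMap A S (ρ k (Sum.inl l)) := by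
      intro l
      have := congrFun hg' (Sum.inl l)
      rw [Finset.sum_apply] at this
      simp only [Sum.elim_inl] at this
      rw [← this]
      exact Finset.sum_congr rfl fun k _ => by rw [Pi.smul_apply, hρ' k, smul_eq_mul]
    have h0 : ∀ i, 0 = ∑ k, σ k * algebraMap A S (ρ k (Sum.inr i)) := by
      intro i
      have := congrFun hg' (Sum.inr i)
      rw [Finset.sum_apply] at this
      simp only [Sum.elim_inr, Pi.zero_apply] at this
      rw [← this]
      exact Finset.sum_congr rfl fun k _ => by rw [Pi.smul_apply, hρ' k, smul_eq_mul]
    have h3 : s = ∑ k, σ k • (fun i => algebraMap A S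
        (∑ l, ρ k (Sum.inl l) * r l i + y * ρ k (Sum.inr i))) := by
      ext i
      rw [Finset.sum_apply, hs']
      simp_rw [hc]
      have : ∑ k, σ k * algebraMap A S (y * ρ k (Sum.inr i)) = 0 := by
        rw [← mul_zero (algebraMap A S y), h0 i, Finset.mul_sum]
        exact Finset.sum_congr rfl fun l _ => by simp; ring
      simp only [Pi.smul_apply, smul_eq_mul, map_add, mul_add, Finset.sum_add_distrib, this, add_zero]
      simp only [map_sum, map_mul, Finset.mul_sum, Finset.sum_mul]
      rw [Finset.sum_comm]
      exact Finset.sum_congr rfl fun l _ => Finset.sum_congr rfl fun i _ => by ring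
    rw [h3]
    refine Submodule.sum_mem _ fun k _ => Submodule.smul_mem _ _ (RelS_mem ?_)
    have h4 := hρ k
    simp only [Fintype.sum_sum_type, Sum.elim_inl, Sum.elim_inr] at h4
    have : ∑ i, f i * (∑ l, ρ k (Sum.inl l) * r l i + y * ρ k (Sum.inr i)) =
        ∑ l, ρ k (Sum.inl l) * j l +
        y * (∑ l, a l * ρ k (Sum.inl l) + ∑ i, f i * ρ k (Sum.inr i)) := by
      have e1 : ∑ i, f i * (∑ l, ρ k (Sum.inl l) * r l i) =
          ∑ l, ρ k (Sum.inl l) * (j l + y * a l) := by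
        simp_rw [← ha, Finset.mul_sum]
        rw [Finset.sum_comm]
        exact Finset.sum_congr rfl fun l _ => Finset.sum_congr rfl fun i _ => by ring
      simp_rw [mul_add, Finset.sum_add_distrib]
      rw [e1]
      simp_rw [mul_add, Finset.sum_add_distrib, Finset.mul_sum]
      rw [add_assoc]
      congr 2
      · exact Finset.sum_congr rfl fun l _ => by ring
      · exact Finset.sum_congr rfl fun l _ => by ring
    rw [this]
    exact Ideal.add_mem _ (Ideal.sum_mem _ fun l _ => Ideal.mul_mem_left _ _ (hj l))
      (Ideal.mul_mem_left _ _ h4)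

/-- base case -/
theorem FL_base (J : Ideal A) (hJ : ∀ f : A, f ∉ J → IsUnit (algebraMap A S f)) : FL S J := by
  classical
  intro ι _ f s hs
  by_cases hall : ∀ i, f i ∈ J
  · have : s = ∑ i, s i • (fun k => algebraMap A S (if k = i then 1 else 0)) := by
      ext k
      simp [Finset.sum_apply, apply_ite]
    rw [this]
    refine Submodule.sum_mem _ fun i _ => Submodule.smul_mem _ _ (RelS_mem ?_)
    simpa using hall i
  push Not at hall
  obtain ⟨i0, hi0⟩ := hall
  obtain ⟨w, hw⟩ := hJ _ hi0
  have h1 : algebraMap A S (f i0) • s ∈ RelS S J f := by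
    have e : algebraMap A S (f i0) • s = ∑ i, s i • (fun k => algebraMap A S
        ((if k = i then f i0 else 0) - (if k = i0 then f i else 0))) +
        (∑ i, algebraMap A S (f i) * s i) • (fun k => algebraMap A S (if k = i0 then 1 else 0)) := by
      ext k
      by_cases hk : k = i0
      · subst hk
        have e2 : ∑ i, s i * algebraMap A S (f i) = ∑ i, algebraMap A S (f i) * s i :=
          Finset.sum_congr rfl fun _ _ => mul_comm _ _
        simp [Finset.sum_apply, apply_ite (algebraMap A S), mul_sub, Finset.sum_sub_distrib, e2]
        ring
      · simp [Finset.sum_apply, apply_ite (algebraMap A S), hk]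
        ring
    rw [e]
    refine Submodule.add_mem _ (Submodule.sum_mem _ fun i _ => Submodule.smul_mem _ _
      (RelS_mem ?_)) ?_
    · simp [mul_sub, Finset.sum_sub_distrib, mul_comm]
    · generalize ∑ i, algebraMap A S (f i) * s i = b at hs
      refine Submodule.span_induction (p := fun b _ => b • (fun k => algebraMap A S
        (if k = i0 then 1 else 0)) ∈ RelS S J f) ?_ ?_ ?_ ?_ hs
      · rintro _ ⟨x, hx, rfl⟩
        have : algebraMap A S x • (fun k => algebraMap A S (if k = i0 then 1 else 0)) =
            fun k => algebraMap A S (if k = i0 then x else 0) := by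
          ext k; by_cases hk : k = i0 <;> simp [hk]
        rw [this]
        refine RelS_mem ?_
        simpa using Ideal.mul_mem_left _ _ hx
      · simp
      · intro x y _ _ hx hy
        rw [add_smul]; exact Submodule.add_mem _ hx hy
      · intro c x _ hx
        rw [smul_assoc]; exact Submodule.smul_mem _ _ hx
  rw [← hw] at h1
  have h2 := Submodule.smul_mem _ (↑w⁻¹ : S) h1
  rwa [smul_smul, Units.inv_mul, one_smul] at h2

theorem FL_flat (h : FL S (⊥ : Ideal A)) : Module.Flat A S := by
  rw [Module.Flat.iff_forall_isTrivialRelation]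
  intro l f x hx
  have h1 := h (Fin l) f x (by
    rw [Ideal.map_bot, Ideal.mem_bot]
    simpa [Algebra.smul_def] using hx)
  obtain ⟨m, c, g, hg⟩ := Submodule.mem_span_set'.1 h1
  choose r hr hr' using fun k => (g k).2
  refine ⟨m, fun i k => r k i, c, ?_, ?_⟩
  · intro i
    rw [← hg, Finset.sum_apply]
    exact Finset.sum_congr rfl fun k _ => by
      rw [Pi.smul_apply, hr' k, smul_eq_mul, Algebra.smul_def, mul_comm]
  · intro k
    simpa using hr k

end FlatStep

end Piece15

section Piece16

open IsLocalRing

section RLtuple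

variable {S : Type*} [CommRing S] [IsLocalRing S] [IsNoetherianRing S] {d : ℕ}

theorem dim_le_card {s : Finset S} (hs : Ideal.span (s : Set S) = maximalIdeal S) :
    ringKrullDim S ≤ s.card := by
  have h2 := ringKrullDim_le_spanFinrank_maximalIdeal (R := S)
  have h3 : (maximalIdeal S).spanFinrank ≤ s.card := by
    rw [← hs]
    refine (Submodule.spanFinrank_span_le_ncard_of_finite (Finset.finite_toSet _)).trans ?_
    rw [Set.ncard_coe_finset]
  exact h2.trans (by exact_mod_cast h3)

/-- tuple generating the maximal ideal of a regular local ring -/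
def RLS {S : Type*} [CommRing S] [IsLocalRing S] {d : ℕ} (x : Fin d → S) : Prop :=
  Ideal.span (Set.range x) = maximalIdeal S ∧ (d : WithBot ℕ∞) ≤ ringKrullDim S

theorem RLS.dim {x : Fin d → S} (h : RLS x) : ringKrullDim S = d := by
  classical
  refine le_antisymm ?_ h.2
  refine (dim_le_card (s := Finset.univ.image x) (by simpa using h.1)).trans ?_
  have := Finset.card_image_le (s := Finset.univ) (f := x)
  simp only [Finset.card_univ, Fintype.card_fin] at this
  exact_mod_cast this

theorem RLS.inj {x : Fin d → S} (h : RLS x) : Function.Injective x := by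
  classical
  have h1 := h.2.trans (dim_le_card (s := Finset.univ.image x) (by simpa using h.1))
  have h2 : d ≤ (Finset.univ.image x).card := by exact_mod_cast h1
  have := Finset.card_image_le (s := Finset.univ) (f := x)
  simp only [Finset.card_univ, Fintype.card_fin] at this
  have h3 : (Finset.univ.image x).card = (Finset.univ : Finset (Fin d)).card := by simp; omega
  have := Finset.card_image_iff.1 h3
  simpa using this

theorem RLS.fin {x : Fin d → S} (h : RLS x) :
    Ideal.span ((Finset.univ.map ⟨x, h.inj⟩ : Finset S) : Set S) = maximalIdeal S := by
  simpa using h.1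

theorem RLS.prime {x : Fin d → S} (h : RLS x) (T : Set (Fin d)) :
    (Ideal.span (x '' T)).IsPrime := by
  classical
  have := RL_prime h.fin (by simp) h.2 ((Finset.univ.filter (· ∈ T)).map ⟨x, h.inj⟩)
    (Finset.map_subset_map.2 (Finset.filter_subset _ _))
  simpa [Set.image] using this

theorem RLS.notMem {x : Fin d → S} (h : RLS x) (T : Set (Fin d)) (i : Fin d) (hi : i ∉ T) :
    x i ∉ Ideal.span (x '' T) := by
  classical
  have := RL_notMem h.fin (by simp) h.2 ((Finset.univ.filter (· ∈ T)).map ⟨x, h.inj⟩)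
    (Finset.map_subset_map.2 (Finset.filter_subset _ _)) (x i) (by simp) (by
      simp only [Finset.mem_map, Finset.mem_filter, Finset.mem_univ, true_and,
        Function.Embedding.coeFn_mk, not_exists, not_and]
      intro j hj hji
      exact hi (h.inj hji ▸ hj))
  simpa [Set.image] using this

theorem RLS.isDomain {x : Fin d → S} (h : RLS x) : IsDomain S :=
  RL_dom h.fin (by simp) h.2

theorem RLS.pow_nzd {x : Fin d → S} (h : RLS x) (s : Fin d → ℕ) (T : Finset (Fin d)) :
    ∀ (U : Set (Fin d)) (i : Fin d), i ∉ T → i ∉ U → (∀ j ∈ T, j ∉ U) → ∀ b : S,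
      x i * b ∈ PS x s T ⊔ Ideal.span (x '' U) → b ∈ PS x s T ⊔ Ideal.span (x '' U) := by
  classical
  induction T using Finset.induction_on with
  | empty =>
    intro U i _ hiU _ b hb
    have e : PS x s ((∅ : Finset (Fin d)) : Set (Fin d)) = ⊥ := by
      unfold PS
      rw [Ideal.span_eq_bot]
      rintro z ⟨j, hj, -⟩
      simp at hj
    rw [e, bot_sup_eq] at hb ⊢
    exact ((h.prime U).mem_or_mem hb).resolve_left (h.notMem U i hiU)
  | insert j T hjT ih =>
    intro U i hi hiU hTU b hb
    have hij : i ≠ j := fun e => hi (by simp [e])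
    have hiT : i ∉ T := fun e => hi (by simp [e])
    have hjU : j ∉ U := hTU j (by simp)
    have hTU' : ∀ k ∈ T, k ∉ U := fun k hk => hTU k (by simp [hk])
    rw [Finset.coe_insert, PS_insert, sup_assoc] at hb ⊢
    set K := PS x s (T : Set (Fin d)) ⊔ Ideal.span (x '' U) with hK
    have hj : ∀ n c, x j ^ n * c ∈ K → c ∈ K := by
      intro n
      induction n with
      | zero => intro c hc; simpa using hc
      | succ n ihn =>
        intro c hc
        apply ih U j hjT hjU hTU'
        apply ihn
        rwa [← mul_assoc, ← pow_succ]
    have hU' : K ⊔ Ideal.span {x j} = PS x s (T : Set (Fin d)) ⊔ Ideal.span (x '' (insert j U)) := by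
      rw [Set.image_insert_eq, Ideal.span_insert, hK, sup_assoc, sup_comm (Ideal.span {x j})]
    have hi' : ∀ c, x i * c ∈ K ⊔ Ideal.span {x j} → c ∈ K ⊔ Ideal.span {x j} := by
      rw [hU']
      refine ih (insert j U) i hiT (by simp [hij, hiU]) ?_
      intro k hk hkU
      rcases Set.mem_insert_iff.1 hkU with rfl | h'
      · exact hjT hk
      · exact hTU' k hk h'
    suffices H : ∀ r b, x i * b ∈ Ideal.span {x j ^ r} ⊔ K → b ∈ Ideal.span {x j ^ r} ⊔ K from
      H _ _ hb
    intro r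
    induction r with
    | zero => intro b _; simp
    | succ r ihr =>
      intro b hb
      have hb1 : b ∈ Ideal.span {x j ^ r} ⊔ K := by
        apply ihr
        refine (sup_le_sup_right ?_ K) hb
        rw [Ideal.span_singleton_le_span_singleton]
        exact pow_dvd_pow _ (Nat.le_succ r)
      obtain ⟨u, hu, w, hw, rfl⟩ := Submodule.mem_sup.1 hb1
      obtain ⟨b', rfl⟩ := Ideal.mem_span_singleton.1 hu
      obtain ⟨u2, hu2, w2, hw2, e⟩ := Submodule.mem_sup.1 hb
      obtain ⟨c, rfl⟩ := Ideal.mem_span_singleton.1 hu2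
      have h1 : x j ^ r * (x i * b' - x j * c) ∈ K := by
        have : x j ^ r * (x i * b' - x j * c) = w2 - x i * w := by
          linear_combination -e
        rw [this]
        exact K.sub_mem hw2 (K.mul_mem_left _ hw)
      have h2 := hj _ _ h1
      have h3 : b' ∈ K ⊔ Ideal.span {x j} := by
        apply hi'
        have : x i * b' = (x i * b' - x j * c) + x j * c := by ring
        rw [this]
        exact Submodule.add_mem_sup h2 (Ideal.mem_span_singleton.2 ⟨c, rfl⟩)
      obtain ⟨v, hv, v2, hv2, rfl⟩ := Submodule.mem_sup.1 h3
      obtain ⟨c2, rfl⟩ := Ideal.mem_span_singleton.1 hv2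
      have : x j ^ r * (v + x j * c2) + w = x j ^ (r+1) * c2 + (x j ^ r * v + w) := by ring
      rw [this]
      exact Submodule.add_mem_sup (Ideal.mem_span_singleton.2 ⟨c2, rfl⟩)
        (K.add_mem (K.mul_mem_left _ hv) hw)

theorem RLS.reg {x : Fin d → S} (h : RLS x) : REG x := by
  classical
  intro i s b hb
  have e : Ideal.span {z | ∃ j, j ≠ i ∧ z = x j ^ s j} =
      PS x s ((Finset.univ.erase i : Finset (Fin d)) : Set (Fin d)) ⊔ Ideal.span (x '' ∅) := by
    rw [Set.image_empty, Ideal.span_empty, sup_bot_eq]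
    unfold PS
    congr 1
    ext z
    simp
  rw [e] at hb ⊢
  exact h.pow_nzd s _ ∅ i (by simp) (by simp) (by simp) b hb

theorem RLS.height {x : Fin d → S} (h : RLS x) (T : Finset (Fin d)) :
    (T.card : ℕ∞) ≤ (Ideal.span (x '' (T : Set (Fin d)))).height := by
  classical
  induction T using Finset.induction_on with
  | empty => simp
  | insert j T hj ih =>
    have p1 := h.prime (T : Set (Fin d))
    have p2 := h.prime ((insert j T : Finset (Fin d)) : Set (Fin d))
    have hlt : Ideal.span (x '' (T : Set (Fin d))) <
        Ideal.span (x '' ((insert j T : Finset (Fin d)) : Set (Fin d))) := by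
      refine lt_of_le_not_ge (Ideal.span_mono (Set.image_mono (by simp))) fun hle => ?_
      exact h.notMem T j (by simpa using hj) (hle (Ideal.subset_span ⟨j, by simp, rfl⟩))
    rw [Finset.card_insert_of_notMem hj]
    have hfin := Ideal.height_ne_top p1.ne_top
    have := Ideal.height_add_one_le_of_lt_of_isPrime hlt
    refine le_trans ?_ this
    push_cast
    gcongr

end RLtuple

/-- complete integral closedness -/
def CIC (S : Type*) [CommRing S] : Prop :=
  ∀ f g c : S, c ≠ 0 → g ≠ 0 → (∀ n : ℕ, g ^ n ∣ c * f ^ n) → g ∣ f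

theorem RLS_cic (d : ℕ) : ∀ {S : Type u} [CommRing S] [IsLocalRing S] [IsNoetherianRing S]
    {s : Finset S} (hs : Ideal.span (s : Set S) = maximalIdeal S) (hc : s.card ≤ d)
    (hd : (d : WithBot ℕ∞) ≤ ringKrullDim S), CIC S := by
  classical
  induction d with
  | zero =>
    intro S _ _ _ s hs hc hd f g c _ hg _
    have : s = ∅ := by simpa using hc
    subst this
    have hm : maximalIdeal S = ⊥ := by rw [← hs]; simp
    have : IsUnit g := by
      by_contra hu
      have : g ∈ maximalIdeal S := hu
      rw [hm] at this
      exact hg this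
    exact this.dvd
  | succ d ih =>
    intro S _ _ _ s hs hc hd
    have hdom := RL_dom hs hc hd
    have hne : s.Nonempty := by
      by_contra hne
      rw [Finset.not_nonempty_iff_eq_empty] at hne
      have := hd.trans (dim_le_card hs)
      have : d + 1 ≤ s.card := by exact_mod_cast this
      simp [hne] at this
    obtain ⟨z, hz⟩ := hne
    obtain ⟨hl, s', hs', hc', hd'⟩ := RL_quot hs hc hd hz
    have H := ih hs' hc' hd'
    have hp : (Ideal.span (({z} : Finset S) : Set S)).IsPrime := RL_prime hs hc hd {z} (by simpa using hz)
    have hz0 : z ≠ 0 := by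
      have := RL_notMem hs hc hd ∅ (by simp) z hz (by simp)
      simpa using this
    have hzp : Prime z := by
      rw [Finset.coe_singleton] at hp
      exact (Ideal.span_singleton_prime hz0).1 hp
    have hzm : z ∈ maximalIdeal S := hs ▸ Ideal.subset_span hz
    have hfm : ∀ a : S, a ≠ 0 → ∃ n b, ¬ z ∣ b ∧ a = z ^ n * b := by
      intro a ha
      have hf : FiniteMultiplicity z a := FiniteMultiplicity.of_not_isUnit hzp.not_isUnit ha
      obtain ⟨b, hb, hb'⟩ := hf.exists_eq_pow_mul_and_not_dvd
      exact ⟨_, b, hb', hb⟩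
    intro f g c hc0 hg0 hdiv
    suffices ∀ n : ℕ, ∃ h r, f - h * g = z ^ n * r by
      have : f ∈ Ideal.span {g} := by
        apply krull_closed
        intro n
        obtain ⟨h, r, e⟩ := this n
        have : f = h * g + z ^ n * r := by linear_combination e
        rw [this]
        exact Submodule.add_mem_sup (Ideal.mem_span_singleton.2 ⟨h, mul_comm _ _⟩)
          (Ideal.mul_mem_right _ _ (Ideal.pow_mem_pow hzm n))
      exact Ideal.mem_span_singleton.1 this
    intro n
    induction n with
    | zero => exact ⟨0, f, by simp⟩
    | succ n ihn =>
      obtain ⟨h, r, e⟩ := ihn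
      -- `f1 = f - h g` satisfies the same divisibilities
      have hdiv1 : ∃ c1, c1 ≠ 0 ∧ ∀ k, g ^ k ∣ c1 * (f - h * g) ^ k := by
        refine ⟨c, hc0, fun k => ?_⟩
        rw [sub_eq_add_neg, add_pow, Finset.mul_sum]
        refine Finset.dvd_sum fun j hj => ?_
        have hj' : j ≤ k := by simpa [Nat.lt_succ_iff] using hj
        have h1 : g ^ k = g ^ j * g ^ (k - j) := by rw [← pow_add]; congr 1; omega
        rw [h1]
        have h2 : c * (f ^ j * (-(h * g)) ^ (k - j) * (k.choose j : S)) =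
            (c * f ^ j) * g ^ (k - j) * ((-h) ^ (k-j) * (k.choose j : S)) := by
          rw [show -(h * g) = (-h) * g by ring, mul_pow]; ring
        rw [h2]
        exact Dvd.dvd.mul_right (mul_dvd_mul_right (hdiv j) _) _
      obtain ⟨c1, hc1, hdiv1⟩ := hdiv1
      by_cases hf0 : f - h * g = 0
      · exact ⟨h, 0, by simp [hf0]⟩
      obtain ⟨a, g', hg', rfl⟩ := hfm g hg0
      obtain ⟨b, f', hf', ef⟩ := hfm _ hf0
      obtain ⟨m, c', hc', rfl⟩ := hfm c1 hc1
      have hbn : n ≤ b := by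
        by_contra hlt
        push Not at hlt
        apply hf'
        have : z ^ b * f' = z ^ b * (z * (z ^ (n - b - 1) * r)) := by
          rw [← ef, e]
          rw [show z ^ n = z ^ b * (z * z ^ (n-b-1)) by rw [← pow_succ', ← pow_add]; congr 1; omega]
          ring
        exact ⟨_, mul_left_cancel₀ (pow_ne_zero _ hz0) this⟩
      rw [ef] at hdiv1
      have key : ∀ k, a * k ≤ m + b * k ∧ g' ^ k ∣ c' * f' ^ k := by
        intro k
        obtain ⟨w, hw⟩ := hdiv1 k
        have hw' : z ^ (m + b * k) * (c' * f' ^ k) = z ^ (a * k) * (g' ^ k * w) := by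
          rw [mul_pow, mul_pow, ← pow_mul, ← pow_mul] at hw
          rw [pow_add]; linear_combination hw
        have hnd : ¬ z ∣ c' * f' ^ k := fun hd => by
          rcases hzp.dvd_or_dvd hd with h | h
          · exact hc' h
          · exact hf' (hzp.dvd_of_dvd_pow h)
        have hle : a * k ≤ m + b * k := by
          by_contra hlt
          push Not at hlt
          apply hnd
          have : z ^ (m + b * k) * (c' * f' ^ k) = z ^ (m + b * k) * (z *
              (z ^ (a * k - (m + b * k) - 1) * (g' ^ k * w))) := by
            rw [hw', show z ^ (a * k) = z ^ (m + b * k) * (z * z ^ (a * k - (m + b * k) - 1)) by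
              rw [← pow_succ', ← pow_add]; congr 1; omega]
            ring
          exact ⟨_, mul_left_cancel₀ (pow_ne_zero _ hz0) this⟩
        refine ⟨hle, ?_⟩
        have h3 : z ^ (m + b * k - a * k) * (c' * f' ^ k) = g' ^ k * w := by
          apply mul_left_cancel₀ (pow_ne_zero (a * k) hz0)
          rw [← hw', ← mul_assoc, ← pow_add]; congr 2; omega
        have hcop : ∀ t, z ^ t ∣ g' ^ k * w → z ^ t ∣ w := by
          intro t ht
          exact hzp.pow_dvd_of_dvd_mul_left t (fun h => hg' (hzp.dvd_of_dvd_pow h)) ht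
        obtain ⟨w', rfl⟩ := hcop _ ⟨_, h3.symm⟩
        refine ⟨w', mul_left_cancel₀ (pow_ne_zero (m + b * k - a * k) hz0) ?_⟩
        rw [h3]; ring
      have hab : a ≤ b := by
        have := (key (m + 1)).1
        by_contra hlt
        push Not at hlt
        nlinarith
      have hq := H (Ideal.Quotient.mk _ f') (Ideal.Quotient.mk _ g') (Ideal.Quotient.mk _ c')
        (by rwa [Ne, Ideal.Quotient.eq_zero_iff_mem, Ideal.mem_span_singleton])
        (by rwa [Ne, Ideal.Quotient.eq_zero_iff_mem, Ideal.mem_span_singleton])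
        (fun k => by
          have := map_dvd (Ideal.Quotient.mk (Ideal.span {z})) (key k).2
          simpa using this)
      obtain ⟨w, hw⟩ := hq
      obtain ⟨w, rfl⟩ := Ideal.Quotient.mk_surjective w
      rw [← map_mul, Ideal.Quotient.eq, Ideal.mem_span_singleton] at hw
      obtain ⟨v, hv⟩ := hw
      refine ⟨h + z ^ (b - a) * w, z ^ (b - n) * v, ?_⟩
      have e1 : z ^ b = z ^ (b - a) * z ^ a := by rw [← pow_add]; congr 1; omega
      have e2 : z ^ (n + 1) * (z ^ (b - n) * v) = z ^ b * (z * v) := by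
        rw [show z ^ b = z ^ n * z ^ (b - n) by rw [← pow_add]; congr 1; omega]; ring
      rw [e2, ← hv]
      linear_combination ef + w * g' * e1

theorem RLS.integrallyClosed {S : Type u} [CommRing S] [IsLocalRing S] [IsNoetherianRing S] {d : ℕ}
    {x : Fin d → S} (h : RLS x) : IsIntegrallyClosed S := by
  have hd := h.isDomain
  have hcic : CIC S := RLS_cic d h.fin (by simp) h.2
  rw [isIntegrallyClosed_iff (FractionRing S)]
  intro q hq
  obtain ⟨f, g, hg, rfl⟩ := IsFractionRing.div_surjective (A := S) q
  have hg0 : g ≠ 0 := nonZeroDivisors.ne_zero hg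
  have hgK : algebraMap S (FractionRing S) g ≠ 0 := by
    simpa using hg0
  obtain ⟨c, hc, hinteg⟩ := IsIntegral.isAlmostIntegral hq
  have : g ∣ f := by
    refine hcic f g c (nonZeroDivisors.ne_zero hc) hg0 fun n => ?_
    obtain ⟨w, hw⟩ := hinteg n
    refine ⟨w, IsFractionRing.injective S (FractionRing S) ?_⟩
    rw [Algebra.smul_def, div_pow] at hw
    rw [map_mul, map_mul, map_pow, map_pow, hw]
    field_simp
  obtain ⟨w, rfl⟩ := this
  refine ⟨w, ?_⟩
  rw [map_mul]
  field_simp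

end Piece16

section Piece17

open IsLocalRing

section CoeffField

open Polynomial

variable {k B : Type*} [Field k] [CommRing B] (p : ℕ)

theorem frob_eq [Fact p.Prime] [CharP B p] (I : Ideal B) (hI : I ^ 2 = ⊥) {u v : B}
    (h : u - v ∈ I) : u ^ p = v ^ p := by
  have h1 : (u - v) ^ p = 0 := by
    have h2 : (u - v) ^ 2 ∈ I ^ 2 := Ideal.pow_mem_pow h 2
    rw [hI, Ideal.mem_bot] at h2
    exact pow_eq_zero_of_le (Fact.out : p.Prime).two_le h2
  rw [sub_pow_char] at h1
  exact sub_eq_zero.1 h1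

theorem frob_hom [Fact p.Prime] [CharP B p] (I : Ideal B) (hI : I ^ 2 = ⊥) (φ : k →+* B ⧸ I) :
    ∃ h : k →+* B, ∀ a u, Ideal.Quotient.mk I u = φ a → h a = u ^ p := by
  choose l hl using fun a => Ideal.Quotient.mk_surjective (φ a)
  refine ⟨⟨⟨⟨fun a => l a ^ p, ?_⟩, ?_⟩, ?_, ?_⟩, ?_⟩
  · have : l 1 ^ p = (1 : B) ^ p :=
      frob_eq p I hI (by rw [← Ideal.Quotient.eq, hl]; simp)
    simpa using this
  · intro a b
    simp only
    rw [← mul_pow]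
    exact frob_eq p I hI (by rw [← Ideal.Quotient.eq, hl]; simp [hl])
  · simp only
    have := (Fact.out : p.Prime).pos
    rw [← zero_pow (M₀ := B) this.ne']
    exact frob_eq p I hI (by rw [← Ideal.Quotient.eq, hl]; simp)
  · intro a b
    simp only
    rw [← add_pow_char]
    exact frob_eq p I hI (by rw [← Ideal.Quotient.eq, hl]; simp [hl])
  · intro a u hu
    exact frob_eq p I hI (by rw [← Ideal.Quotient.eq, hl, hu])

theorem sqzero_lift [Fact p.Prime] [CharP k p] [CharP B p] (I : Ideal B) (hI : I ^ 2 = ⊥)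
    (φ : k →+* B ⧸ I) : ∃ ψ : k →+* B, (Ideal.Quotient.mk I).comp ψ = φ := by
  classical
  have hp : p.Prime := Fact.out
  obtain ⟨h, hh⟩ := frob_hom p I hI φ
  let Good : Set (Subring (k × B)) := {G | (∀ z ∈ G, Ideal.Quotient.mk I z.2 = φ z.1) ∧
    (∀ z ∈ G, z.1 = 0 → z.2 = 0)}
  let G0 : Subring (k × B) := (RingHom.prod (frobenius k p) h).range
  have hG0 : G0 ∈ Good := by
    constructor
    · rintro _ ⟨a, rfl⟩
      obtain ⟨u, hu⟩ := Ideal.Quotient.mk_surjective (φ a)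
      simp [hh a u hu, hu, frobenius_def]
    · rintro _ ⟨a, rfl⟩ ha
      have : a = 0 := by simpa [frobenius_def, hp.ne_zero] using ha
      simp [this]
  obtain ⟨G, hG0G, hG⟩ := zorn_le_nonempty₀ Good (by
    intro c hc hch y hy
    refine ⟨sSup c, ?_, fun z hz => le_sSup hz⟩
    have hmem : ∀ z, z ∈ sSup c ↔ ∃ s ∈ c, z ∈ s := fun z =>
      Subring.mem_sSup_of_directedOn ⟨y, hy⟩ hch.directedOn
    constructor
    · intro z hz
      obtain ⟨s, hs, hzs⟩ := (hmem z).1 hz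
      exact (hc hs).1 z hzs
    · intro z hz
      obtain ⟨s, hs, hzs⟩ := (hmem z).1 hz
      exact (hc hs).2 z hzs) G0 hG0
  obtain ⟨⟨hGa, hGb⟩, hmax⟩ := hG
  have hfrob : ∀ a u, Ideal.Quotient.mk I u = φ a → ((a ^ p, u ^ p) : k × B) ∈ G := by
    intro a u hu
    apply hG0G
    exact ⟨a, by simp [hh a u hu, frobenius_def]⟩
  -- the projection as a subfield
  let L : Subfield k := { (G.map (RingHom.fst k B)) with
    inv_mem' := by
      rintro x ⟨z, hz, rfl⟩
      by_cases h0 : z.1 = 0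
      · refine ⟨0, G.zero_mem, ?_⟩
        simp [h0]
      obtain ⟨u, hu⟩ := Ideal.Quotient.mk_surjective (φ (z.1)⁻¹)
      refine ⟨z ^ (p - 1) * _, G.mul_mem (G.pow_mem hz _) (hfrob _ u hu), ?_⟩
      have : z.1 ^ p = z.1 ^ (p - 1) * z.1 := by
        rw [← pow_succ]; congr 1; have := hp.pos; omega
      simp only [RingHom.coe_fst, Prod.fst_mul, inv_pow, this]
      have h2 : (z ^ (p - 1)).1 = z.1 ^ (p - 1) := rfl
      rw [h2]
      field_simp }
  have hL : ∀ x, x ∈ L ↔ ∃ z ∈ G, z.1 = x := fun x => Iff.rfl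
  have hsurj : ∀ a : k, ∃ b, (a, b) ∈ G := by
    intro a
    by_contra hna
    have haL : a ∉ L := by
      rintro ⟨z, hz, rfl⟩
      exact hna ⟨z.2, hz⟩
    obtain ⟨t, ht⟩ := Ideal.Quotient.mk_surjective (φ a)
    have hep : ((a, t) : k × B) ^ p ∈ G := hfrob a t ht
    let ev : G[X] →+* k × B := eval₂RingHom G.subtype (a, t)
    have hgood : ev.range ∈ Good := by
      constructor
      · rintro _ ⟨f, rfl⟩
        have : (((Ideal.Quotient.mk I).comp (RingHom.snd k B)).comp ev) =
            ((φ.comp (RingHom.fst k B)).comp ev) := by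
          apply Polynomial.ringHom_ext
          · intro g
            simpa [ev] using hGa g.1 g.2
          · simpa [ev] using ht
        exact congr($this f)
      · rintro _ ⟨f, rfl⟩ hf0
        let m : G[X] := X ^ p - C ⟨_, hep⟩
        have hm : m.Monic := monic_X_pow_sub_C _ hp.ne_zero
        have hevm : ev m = 0 := by
          simp [m, ev]
        have hfr : ev f = ev (f %ₘ m) := by
          conv_lhs => rw [← modByMonic_add_div f m]
          rw [map_add, map_mul, hevm, zero_mul, add_zero]
        rw [hfr] at hf0 ⊢
        have hdeg : (f %ₘ m).degree < p := by
          have : Nontrivial G := ⟨0, 1, fun e => by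
            have := congrArg (fun z : G => z.1.1) e
            simp at this⟩
          have := degree_modByMonic_lt f hm
          rwa [degree_X_pow_sub_C hp.pos] at this
        set r := f %ₘ m
        let π : G →+* L := ((RingHom.fst k B).comp G.subtype).codRestrict L
          (fun z => ⟨z.1, z.2, rfl⟩)
        have hr0 : r.map π = 0 := by
          by_contra hne
          have hap : a ^ p ∈ L := ⟨_, hep, rfl⟩
          have hirr : Irreducible (X ^ p - C (⟨a ^ p, hap⟩ : L)) := by
            apply X_pow_sub_C_irreducible_of_prime hp
            intro b hb
            have hb' : (b : k) ^ p = a ^ p := congrArg Subtype.val hb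
            have : (b : k) = a := frobenius_inj k p (by simpa [frobenius_def] using hb')
            exact haL (this ▸ b.2)
          have hmp := minpoly.eq_of_irreducible_of_monic hirr (x := a) (by
              simp only [map_sub, map_pow, aeval_X, aeval_C]
              exact sub_self _)
            (monic_X_pow_sub_C _ hp.ne_zero)
          have hroot : aeval a (r.map π) = 0 := by
            have : ((RingHom.fst k B).comp ev) =
                ((aeval (R := L) a : L[X] →+* k)).comp (mapRingHom π) := by
              apply Polynomial.ringHom_ext
              · intro g
                simp [ev, π]
                rfl
              · simp [ev]
            have := congr($this r)
            simp only [RingHom.comp_apply, coe_mapRingHom] at this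
            exact this.symm.trans hf0
          have h1 := minpoly.degree_le_of_ne_zero L a hne hroot
          rw [← hmp, degree_X_pow_sub_C hp.pos] at h1
          exact absurd (h1.trans (degree_map_le)) (not_le.2 hdeg)
        have : r = 0 := by
          ext n
          · have := congrArg (fun q => ((q.coeff n : L) : k)) hr0
            have h2 : (r.coeff n).1.1 = 0 := by
              simp only [coeff_map, coeff_zero] at this
              exact this
            simpa using h2
          · have := congrArg (fun q => ((q.coeff n : L) : k)) hr0
            have h2 : (r.coeff n).1.1 = 0 := by
              simp only [coeff_map, coeff_zero] at this
              exact this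
            have := hGb _ (r.coeff n).2 h2
            simpa using this
        rw [this]; simp
    have hle : G ≤ ev.range := by
      intro g hg
      exact ⟨C ⟨g, hg⟩, by simp [ev]⟩
    have := hmax hgood hle
    exact hna ⟨t, this ⟨X, by simp [ev]⟩⟩
  choose ψ hψ using hsurj
  have huniq : ∀ a b, (a, b) ∈ G → ψ a = b := by
    intro a b hab
    have := hGb _ (G.sub_mem (hψ a) hab) (by simp)
    simpa [sub_eq_zero] using this
  refine ⟨⟨⟨⟨ψ, huniq 1 1 G.one_mem⟩, fun a b => huniq _ _ (G.mul_mem (hψ a) (hψ b))⟩,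
    huniq 0 0 G.zero_mem, fun a b => huniq _ _ (G.add_mem (hψ a) (hψ b))⟩, ?_⟩
  ext a
  exact hGa _ (hψ a)

end CoeffField

theorem charP_formallySmooth (p : ℕ) [Fact p.Prime] (k : Type*) [Field k] [Algebra (ZMod p) k] :
    Algebra.FormallySmooth (ZMod p) k := by
  have hk : CharP k p := charP_of_injective_algebraMap (algebraMap (ZMod p) k).injective p
  apply Algebra.FormallySmooth.of_comp_surjective
  intro B _ _ I hI φ
  rcases subsingleton_or_nontrivial B with hB | hB
  · have h1 : (1 : B ⧸ I) = 0 := by rw [← map_one (Ideal.Quotient.mk I), Subsingleton.elim (1 : B) 0, map_zero]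
    have : Subsingleton (B ⧸ I) := subsingleton_of_zero_eq_one h1.symm
    have : Subsingleton (B ⧸ I) := subsingleton_of_zero_eq_one h1.symm
    exact ⟨{ toFun := fun _ => 0, map_one' := Subsingleton.elim _ _,
             map_mul' := fun _ _ => Subsingleton.elim _ _, map_zero' := rfl,
             map_add' := fun _ _ => Subsingleton.elim _ _,
             commutes' := fun _ => Subsingleton.elim _ _ },
      AlgHom.ext fun a => Subsingleton.elim _ _⟩
  have hB : CharP B p := charP_of_injective_algebraMap (algebraMap (ZMod p) B).injective p
  obtain ⟨ψ, hψ⟩ := sqzero_lift p I hI φ.toRingHom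
  refine ⟨⟨ψ, fun r => ?_⟩, ?_⟩
  · exact congr($(Subsingleton.elim (ψ.comp (algebraMap (ZMod p) k)) (algebraMap (ZMod p) B)) r)
  · ext a
    exact congr($hψ a)

/-- existence of a coefficient field -/
theorem exists_coeff (p : ℕ) [Fact p.Prime] (C : Type*) [CommRing C] [IsLocalRing C] [CharP C p]
    [IsAdicComplete (maximalIdeal C) C] :
    ∃ φ : ResidueField C →+* C, ∀ a, residue C (φ a) = a := by
  let _ : Algebra (ZMod p) C := ZMod.algebra C p
  let _ : Algebra (ZMod p) (ResidueField C) := ((residue C).comp (algebraMap (ZMod p) C)).toAlgebra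
  have := charP_formallySmooth p (ResidueField C)
  obtain ⟨g, hg⟩ := Algebra.FormallySmooth.exists_mkₐ_comp_eq_of_isAdicComplete (R := ZMod p)
    (A := ResidueField C) (I := maximalIdeal C) (⟨RingHom.id _, fun r => rfl⟩ : ResidueField C →ₐ[ZMod p] C ⧸ maximalIdeal C)
  exact ⟨g, fun a => congr($hg a)⟩

end Piece17

section Piece18

open IsLocalRing

section Dim

variable {D : Type*} [CommRing D]

theorem dimq_le_iff (I : Ideal D) (n : ℕ) : ringKrullDim (D ⧸ I) ≤ n ↔
    ∀ l : LTSeries (PrimeSpectrum D), I ≤ l.head.asIdeal → l.length ≤ n := by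
  rw [ringKrullDim_quotient]
  constructor
  · intro h l hl
    let l' : LTSeries (PrimeSpectrum.zeroLocus (I : Set D)) :=
      ⟨l.length, fun i => ⟨l i, fun a ha => (l.head_le i : l.head.asIdeal ≤ _) (hl ha)⟩,
        fun i => l.step i⟩
    have := (Order.LTSeries.length_le_krullDim l').trans h
    exact_mod_cast this
  · intro h
    refine iSup_le fun l => ?_
    have := h (l.map Subtype.val (fun _ _ h => h)) (fun a ha => l.head.2 ha)
    exact_mod_cast this

theorem dimq_anti {I J : Ideal D} (h : I ≤ J) : ringKrullDim (D ⧸ J) ≤ ringKrullDim (D ⧸ I) :=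
  ringKrullDim_le_of_surjective (Ideal.Quotient.factor h) (Ideal.Quotient.factor_surjective h)

theorem dimq_lt {J : Ideal D} {P I : Ideal D} [hP : P.IsPrime] (hJP : J ≤ P) (n : ℕ)
    (h : P < I) (hn : ringKrullDim (D ⧸ J) ≤ (n + 1 : ℕ)) :
    ringKrullDim (D ⧸ I) ≤ n := by
  rw [dimq_le_iff] at hn ⊢
  intro l hl
  have h1 : (⟨P, hP⟩ : PrimeSpectrum D) < l.head := by
    change P < l.head.asIdeal
    exact h.trans_le hl
  have := hn (l.cons ⟨P, hP⟩ h1) (by simpa using hJP)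
  simpa using this

theorem avoid_step [IsNoetherianRing D] {P J : Ideal D} [hP : P.IsPrime] (hJ : J ≤ P) (n : ℕ)
    (hJn : ringKrullDim (D ⧸ J) ≤ (n + 1 : ℕ)) (hPn : ringKrullDim (D ⧸ P) ≤ n) :
    ∃ y ∈ P, ringKrullDim (D ⧸ (J ⊔ Ideal.span {y})) ≤ n := by
  classical
  let F : Set (Ideal D) := {q ∈ J.minimalPrimes | ¬ P ≤ q}
  have hF : F.Finite := (Ideal.finite_minimalPrimes_of_isNoetherianRing D J).subset fun _ h => h.1
  have : ¬ ((P : Set D) ⊆ ⋃ q ∈ F, (q : Set D)) := by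
    intro h
    obtain ⟨q, hq, hle⟩ := (Ideal.subset_union_prime_finite hF (f := id) ⊥ ⊥
      (fun q hq _ _ => hq.1.1.1)).1 h
    exact hq.2 hle
  obtain ⟨y, hy, hy2⟩ := Set.not_subset.1 this
  simp only [Set.mem_iUnion, not_exists] at hy2
  refine ⟨y, hy, ?_⟩
  rw [dimq_le_iff] at hPn ⊢
  intro l hl
  have hJl : J ≤ l.head.asIdeal := le_sup_left.trans hl
  obtain ⟨q, hq, hql⟩ := Ideal.exists_minimalPrimes_le hJl
  by_cases hPq : P ≤ q
  · exact hPn l (hPq.trans hql)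
  · have hqp := hq.1.1
    have hyq : y ∉ q := hy2 q ⟨hq, hPq⟩
    have hlt : q < l.head.asIdeal := by
      refine lt_of_le_of_ne hql ?_
      rintro rfl
      exact hyq (hl (Ideal.mem_sup_right (Ideal.mem_span_singleton_self y)))
    have := (dimq_le_iff _ _).1 (dimq_lt (P := q) (n := n) hq.1.2 hlt hJn) l le_rfl
    exact this

theorem avoid_iter [IsNoetherianRing D] {P : Ideal D} [hP : P.IsPrime] (δ n : ℕ) : ∀ {J : Ideal D}
    (_ : J ≤ P) (_ : ringKrullDim (D ⧸ J) ≤ (δ + n : ℕ)) (_ : ringKrullDim (D ⧸ P) ≤ δ),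
    ∃ y : Fin n → D, (∀ i, y i ∈ P) ∧
      ringKrullDim (D ⧸ (J ⊔ Ideal.span (Set.range y))) ≤ δ := by
  induction n with
  | zero =>
    intro J hJ hn hPn
    refine ⟨Fin.elim0, fun i => i.elim0, ?_⟩
    refine (dimq_anti le_sup_left).trans ?_
    simpa using hn
  | succ n ih =>
    intro J hJ hn hPn
    obtain ⟨y, hy, hyn⟩ := avoid_step hJ (δ + n) hn
      (hPn.trans (by exact_mod_cast Nat.le_add_right δ n))
    obtain ⟨z, hz, hzn⟩ := ih (J := J ⊔ Ideal.span {y})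
      (sup_le hJ (by rw [Ideal.span_le]; simpa using hy)) hyn hPn
    refine ⟨Fin.cons y z, ?_, ?_⟩
    · intro i
      refine Fin.cases ?_ ?_ i
      · simpa using hy
      · intro j; simpa using hz j
    · rw [Fin.range_cons, Ideal.span_insert, ← sup_assoc]
      exact hzn

theorem dim_le_of_integral {A C : Type*} [CommRing A] [CommRing C] [Algebra A C]
    [Algebra.IsIntegral A C] : ringKrullDim C ≤ ringKrullDim A := by
  refine Order.krullDim_le_of_strictMono (PrimeSpectrum.comap (algebraMap A C)) ?_
  intro P Q h
  have h' : P.asIdeal < Q.asIdeal := h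
  change P.asIdeal.comap _ < Q.asIdeal.comap _
  exact Ideal.IsIntegral.comap_lt_comap h'

theorem dim_zero_radical [IsLocalRing D] {J : Ideal D} (hJ : J ≤ maximalIdeal D)
    (h : ringKrullDim (D ⧸ J) ≤ (0 : ℕ)) : J.radical = maximalIdeal D := by
  refine le_antisymm ?_ ?_
  · rw [Ideal.IsPrime.radical_le_iff inferInstance]; exact hJ
  · rw [Ideal.radical_eq_sInf]
    refine le_sInf ?_
    rintro P ⟨hJP, hP⟩
    by_contra hne
    have hlt : P < maximalIdeal D := lt_of_le_not_ge (le_maximalIdeal hP.ne_top) hne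
    let l : LTSeries (PrimeSpectrum D) :=
      RelSeries.cons (RelSeries.singleton _ (⟨maximalIdeal D, inferInstance⟩ : PrimeSpectrum D))
        ⟨P, hP⟩ hlt
    have hl : l.head = ⟨P, hP⟩ := RelSeries.head_cons _ _ _
    have hlen : l.length = 1 := by
      exact RelSeries.cons_length _ _ _
    have := (dimq_le_iff _ _).1 h l (by rw [hl]; exact hJP)
    omega

end Dim

end Piece18

section Piece19

open IsLocalRing

section PS19

theorem precomplete_pi {A : Type*} [CommRing A] (I : Ideal A) [IsPrecomplete I A] (r : ℕ) :
    IsPrecomplete I (Fin r → A) := by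
  classical
  refine ⟨fun f hf => ?_⟩
  have key : ∀ i : Fin r, ∃ L : A, ∀ n, f n i ≡ L [SMOD (I ^ n • ⊤ : Submodule A A)] := by
    intro i
    refine IsPrecomplete.prec inferInstance (f := fun n => f n i) ?_
    intro m n hmn
    have h := (hf hmn)
    rw [SModEq.sub_mem] at h ⊢
    have h2 := Submodule.mem_map_of_mem (f := (LinearMap.proj i : (Fin r → A) →ₗ[A] A)) h
    rw [Submodule.map_smul''] at h2
    exact Submodule.smul_mono le_rfl le_top h2
  choose L hL using key
  refine ⟨L, fun n => ?_⟩
  rw [SModEq.sub_mem]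
  have : f n - L = ∑ i, LinearMap.single A (fun _ : Fin r => A) i (f n i - L i) := by
    funext j
    simp [Finset.sum_apply, Pi.single_apply]
  rw [this]
  refine Submodule.sum_mem _ fun i _ => ?_
  have h := hL i n
  rw [SModEq.sub_mem] at h
  have h2 := Submodule.mem_map_of_mem (f := LinearMap.single A (fun _ : Fin r => A) i) h
  rw [Submodule.map_smul''] at h2
  exact Submodule.smul_mono le_rfl le_top h2

variable {k : Type*} [Field k] {d : ℕ}

theorem mvps_dense (z : MvPowerSeries (Fin d) k) : ∃ p : MvPolynomial (Fin d) k,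
    (p : MvPowerSeries (Fin d) k) - z ∈ Ideal.span (Set.range MvPowerSeries.X) := by
  let E := (MvPowerSeries.toAdicCompletionAlgEquiv (Fin d) k).toRingEquiv
  obtain ⟨a, ha⟩ := completion_dense (MvPolynomial.idealOfVars (Fin d) k) (E z)
  have hE : ∀ p : MvPolynomial (Fin d) k, E (p : MvPowerSeries (Fin d) k) = 
      algebraMap _ (AdicCompletion (MvPolynomial.idealOfVars (Fin d) k)
        (MvPolynomial (Fin d) k)) p := by
    intro p
    simp [E, AdicCompletion.algebraMap_apply, MvPowerSeries.toAdicCompletion_coe]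
  have : Ideal.map E (Ideal.span (Set.range MvPowerSeries.X)) =
    (MvPolynomial.idealOfVars (Fin d) k).map (algebraMap ..) := by
    change _ = Ideal.map _ (Ideal.span (Set.range MvPolynomial.X))
    rw [Ideal.map_span, Ideal.map_span, ← Set.range_comp, ← Set.range_comp]
    congr 2; ext1 i
    rw [Function.comp_apply, Function.comp_apply, ← hE, MvPolynomial.coe_X]
  refine ⟨a, ?_⟩
  rw [← this, ← hE, ← map_sub] at ha
  rw [Ideal.mem_map_of_equiv] at ha
  obtain ⟨w, hw, hw2⟩ := ha
  rwa [← E.injective hw2]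

theorem mvps_dense' (z : MvPowerSeries (Fin d) k) : 
    z - MvPowerSeries.C (MvPowerSeries.constantCoeff z) ∈
      Ideal.span (Set.range (MvPowerSeries.X : Fin d → MvPowerSeries (Fin d) k)) := by
  obtain ⟨p, hp⟩ := mvps_dense z
  have hX : ∀ f ∈ Ideal.span (Set.range (MvPowerSeries.X : Fin d → MvPowerSeries (Fin d) k)),
      MvPowerSeries.constantCoeff f = 0 := by
    intro f hf
    have : Ideal.span (Set.range (MvPowerSeries.X : Fin d → MvPowerSeries (Fin d) k)) ≤
      RingHom.ker MvPowerSeries.constantCoeff := by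
      rw [Ideal.span_le]; rintro _ ⟨i, rfl⟩; simp [RingHom.mem_ker]
    exact this hf
  have hpol : ∀ p : MvPolynomial (Fin d) k, ∃ a : k, (p : MvPowerSeries (Fin d) k) - 
      MvPowerSeries.C a ∈ 
      Ideal.span (Set.range (MvPowerSeries.X : Fin d → MvPowerSeries (Fin d) k)) := by
    intro p
    induction p using MvPolynomial.induction_on with
    | C a => exact ⟨a, by simp⟩
    | add p q hp hq =>
      obtain ⟨a, ha⟩ := hp
      obtain ⟨b, hb⟩ := hq
      refine ⟨a + b, ?_⟩
      have := Ideal.add_mem _ ha hb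
      rw [map_add]; push_cast; convert this using 1; ring
    | mul_X p i hp =>
      refine ⟨0, ?_⟩
      rw [map_zero, sub_zero]; push_cast
      exact Ideal.mul_mem_left _ _ (Ideal.subset_span ⟨i, rfl⟩)
  obtain ⟨a, ha⟩ := hpol p
  have h1 : z - MvPowerSeries.C a ∈ 
      Ideal.span (Set.range (MvPowerSeries.X : Fin d → MvPowerSeries (Fin d) k)) := by
    have := Ideal.sub_mem _ ha hp
    convert this using 1; ring
  have h2 := hX _ h1
  simp only [map_sub, MvPowerSeries.constantCoeff_C, sub_eq_zero] at h2
  rwa [h2]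

theorem mvps_max : Ideal.span (Set.range (MvPowerSeries.X : Fin d → MvPowerSeries (Fin d) k)) =
    maximalIdeal (MvPowerSeries (Fin d) k) := by
  refine le_antisymm ?_ ?_
  · rw [Ideal.span_le]; rintro _ ⟨i, rfl⟩
    change MvPowerSeries.X i ∈ maximalIdeal _
    rw [mem_maximalIdeal, mem_nonunits_iff, MvPowerSeries.isUnit_iff_constantCoeff]
    simp
  · intro z hz
    rw [mem_maximalIdeal, mem_nonunits_iff, MvPowerSeries.isUnit_iff_constantCoeff] at hz
    have h := mvps_dense' z
    rw [isUnit_iff_ne_zero, not_not] at hz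
    simpa [hz] using h

theorem mvps_noeth : IsNoetherianRing (MvPowerSeries (Fin d) k) := by
  have hm : (MvPolynomial.idealOfVars (Fin d) k).map (algebraMap (MvPolynomial (Fin d) k) 
      (MvPowerSeries (Fin d) k)) = Ideal.span (Set.range MvPowerSeries.X) := by
    rw [MvPolynomial.idealOfVars, Ideal.map_span, ← Set.range_comp]
    congr 2; ext1 i
    simp [MvPowerSeries.algebraMap_apply']
  have : IsAdicComplete ((MvPolynomial.idealOfVars (Fin d) k).map 
     (algebraMap (MvPolynomial (Fin d) k) (MvPowerSeries (Fin d) k))) (MvPowerSeries (Fin d) k) := by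
    rw [hm]; infer_instance
  refine noeth_of_complete (MvPolynomial.idealOfVars (Fin d) k) ?_
  intro z
  rw [hm]
  obtain ⟨p, hp⟩ := mvps_dense z
  refine ⟨p, ?_⟩
  convert hp using 2
  simp [MvPowerSeries.algebraMap_apply']

end PS19

end Piece19

section Piece20

open IsLocalRing

section Coh
variable {k : Type*} [Field k] {d : ℕ}

theorem fg_approx {C : Type*} [CommRing C] [IsLocalRing C] [IsNoetherianRing C] [Algebra k C]
    (hφ : ∀ c : C, ∃ a : k, c - algebraMap k C a ∈ maximalIdeal C) (n : ℕ) :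
    ∃ V : Submodule k C, V.FG ∧ ∀ c, ∃ u ∈ V, c - u ∈ maximalIdeal C ^ n := by
  classical
  induction n with
  | zero => exact ⟨⊥, Submodule.fg_bot, fun c => ⟨0, Submodule.zero_mem _, by simp⟩⟩
  | succ n ih =>
    obtain ⟨V, hV, h⟩ := ih
    obtain ⟨r, w, hw⟩ := Submodule.fg_iff_exists_fin_generating_family.mp
      (IsNoetherian.noetherian (maximalIdeal C ^ n))
    refine ⟨V ⊔ Submodule.span k (Set.range w), hV.sup (Submodule.fg_span (Set.finite_range w)), ?_⟩
    intro c
    obtain ⟨u, hu, huc⟩ := h c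
    rw [← hw, Submodule.mem_span_range_iff_exists_fun] at huc
    obtain ⟨g, hg⟩ := huc
    choose a ha using fun i => hφ (g i)
    refine ⟨u + ∑ i, a i • w i, Submodule.add_mem _ (Submodule.mem_sup_left hu)
      (Submodule.mem_sup_right (Submodule.sum_mem _ fun i _ => Submodule.smul_mem _ _
        (Submodule.subset_span ⟨i, rfl⟩))), ?_⟩
    have : c - (u + ∑ i, a i • w i) = ∑ i, (g i - algebraMap k C (a i)) * w i := by
      rw [← sub_sub, ← hg, ← Finset.sum_sub_distrib]
      refine Finset.sum_congr rfl fun i _ => ?_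
      rw [smul_eq_mul, Algebra.smul_def]; ring
    rw [this]
    refine Ideal.sum_mem _ fun i _ => ?_
    rw [pow_succ']
    refine Ideal.mul_mem_mul (ha i) ?_
    rw [← hw]; exact Submodule.subset_span ⟨i, rfl⟩

theorem cohen_finite {C : Type*} [CommRing C] [IsLocalRing C] [IsNoetherianRing C]
    [IsAdicComplete (maximalIdeal C) C]
    (φ : k →+* C) (hφ : ∀ c : C, ∃ a : k, c - φ a ∈ maximalIdeal C) (y : Fin d → C)
    (hy : ∃ N, maximalIdeal C ^ N ≤ Ideal.span (Set.range y)) (hym : ∀ i, y i ∈ maximalIdeal C) :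
    ∃ F : MvPowerSeries (Fin d) k →+* C, (∀ i, F (MvPowerSeries.X i) = y i) ∧ F.Finite := by
  classical
  obtain ⟨F, hF⟩ := exists_ev (maximalIdeal C) φ y hym
  have hX : ∀ i, F (MvPowerSeries.X i) = y i := by
    intro i
    rw [← MvPolynomial.coe_X, hF]; simp
  have hC : ∀ a, F (MvPowerSeries.C a) = φ a := by
    intro a
    rw [← MvPolynomial.coe_C, hF]; simp
  refine ⟨F, hX, ?_⟩
  obtain ⟨N, hN⟩ := hy
  let _ := φ.toAlgebra
  obtain ⟨V, ⟨s, hs⟩, hV⟩ := fg_approx (k := k) (C := C) hφ N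
  let _ := F.toAlgebra
  set I : Ideal (MvPowerSeries (Fin d) k) := Ideal.span (Set.range MvPowerSeries.X) with hI
  have hImap : I.map (algebraMap _ C) = Ideal.span (Set.range y) := by
    rw [hI, Ideal.map_span, ← Set.range_comp]
    congr 2
    funext i; exact hX i
  have hprec : IsPrecomplete I (Fin s.card → MvPowerSeries (Fin d) k) := precomplete_pi I _
  have hle : I.map (algebraMap _ C) ≤ maximalIdeal C := by
    rw [hImap, Ideal.span_le]; rintro _ ⟨i, rfl⟩; exact hym i
  have hh : IsHausdorff (I.map (algebraMap _ C)) C := by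
    refine ⟨fun x hx => ?_⟩
    refine IsHausdorff.haus (I := maximalIdeal C) inferInstance x fun n => ?_
    have := hx n
    rw [SModEq.zero] at this ⊢
    exact Submodule.smul_mono (Ideal.pow_right_mono hle n) le_rfl this
  have hh2 : IsHausdorff I C := IsHausdorff.map_algebraMap_iff.mp hh
  let e := s.equivFin
  let f : (Fin s.card → MvPowerSeries (Fin d) k) →ₗ[MvPowerSeries (Fin d) k] C :=
    Fintype.linearCombination _ (fun i => ((e.symm i : s) : C))
  have hf : Function.Surjective f := by
    refine surjective_of_mkQ_comp_surjective (I := I) ?_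
    intro q
    obtain ⟨c, rfl⟩ := Submodule.mkQ_surjective _ q
    obtain ⟨u, hu, huc⟩ := hV c
    have hu2 : ∃ g : Fin s.card → k, ∑ i, g i • ((e.symm i : s) : C) = u := by
      rw [← Submodule.mem_span_range_iff_exists_fun]
      convert hu
      rw [← hs]
      congr 1
      ext z; constructor
      · rintro ⟨i, rfl⟩; exact (e.symm i).2
      · intro hz; exact ⟨e ⟨z, hz⟩, by simp⟩
    obtain ⟨g, hg⟩ := hu2
    refine ⟨fun i => MvPowerSeries.C (g i), ?_⟩
    have hfu : f (fun i => MvPowerSeries.C (g i)) = u := by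
      rw [← hg]
      simp only [f, Fintype.linearCombination_apply]
      refine Finset.sum_congr rfl fun i _ => ?_
      rw [Algebra.smul_def, Algebra.smul_def]
      congr 1
      exact hC _
    rw [LinearMap.comp_apply, hfu, Submodule.mkQ_apply, Submodule.mkQ_apply, eq_comm,
      Submodule.Quotient.eq, Ideal.smul_top_eq_map]
    rw [Submodule.restrictScalars_mem, hImap]
    exact hN huc
  exact Module.Finite.of_surjective f hf

end Coh

end Piece20

section Piece21

open IsLocalRing

section TT

theorem map_PS_mem {A C : Type*} [CommRing A] [CommRing C] [Algebra A C] {d : ℕ}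
    (X : Fin d → A) (s : Fin d → ℕ) (T : Set (Fin d)) (β : C →ₗ[A] A) (z : C)
    (hz : z ∈ PS (fun i => algebraMap A C (X i)) s T) : β z ∈ PS X s T := by
  have : ∀ c : C, β (c * z) ∈ PS X s T := by
    induction hz using Submodule.span_induction with
    | zero => intro c; simp
    | add x y _ _ hx hy => intro c; rw [mul_add, map_add]; exact Ideal.add_mem _ (hx c) (hy c)
    | smul a x _ hx => intro c; rw [smul_eq_mul, ← mul_assoc]; exact hx _
    | mem x hx =>
      intro c
      obtain ⟨l, hl, rfl⟩ := hx
      have : c * algebraMap A C (X l) ^ s l = (X l ^ s l) • c := by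
        rw [Algebra.smul_def, map_pow, mul_comm]
      rw [this, map_smul, smul_eq_mul]
      exact Ideal.mul_mem_right _ _ (PS_mem X s hl)
  simpa using this 1

/-- factoring multiplication through a free module. -/
theorem KK_of_factor {A C : Type*} [CommRing A] [CommRing C] [Algebra A C] {d : ℕ}
    {X : Fin d → A} (hX : REG X) (b : C) {k : ℕ} (β : Fin k → C →ₗ[A] A) (w : Fin k → C)
    (h : ∀ c, b * c = ∑ j, (β j c) • w j) : KK b (fun i => algebraMap A C (X i)) := by
  classical
  rw [REG_iff_KK] at hX
  intro i s n u hu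
  rw [h]
  refine Ideal.sum_mem _ fun j _ => ?_
  have h1 := map_PS_mem X s _ (β j) _ hu
  have h2 : algebraMap A C (X i) ^ n * u = X i ^ n • u := by rw [Algebra.smul_def, map_pow]
  rw [h2, map_smul, smul_eq_mul] at h1
  have h3 := hX i s n _ h1
  rw [one_mul] at h3
  rw [Algebra.smul_def]
  refine Ideal.mul_mem_right _ _ ?_
  have h4 := Ideal.mem_map_of_mem (algebraMap A C) h3
  refine (Ideal.map_le_iff_le_comap.2 ?_ : Ideal.map (algebraMap A C) (PS X s {i}ᶜ) ≤ _) h4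
  rw [PS, Ideal.span_le]
  rintro _ ⟨l, hl, rfl⟩
  rw [SetLike.mem_coe, Ideal.mem_comap]
  rw [map_pow]
  exact PS_mem (fun i => algebraMap A C (X i)) s hl

theorem exists_factor {A C S : Type*} [CommRing A] [IsNoetherianRing A] [CommRing C] [Algebra A C]
    [Module.Finite A C] (P : Ideal C) [P.IsPrime] [CommRing S] [Algebra C S] [Algebra A S]
    [IsScalarTower A C S] [IsLocalization.AtPrime S P] [Module.Flat A S] :
    ∃ b ∉ P, ∃ (k : ℕ) (β : Fin k → C →ₗ[A] A) (w : Fin k → C),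
      ∀ c, b * c = ∑ j, (β j c) • w j := by
  classical
  have : Module.FinitePresentation A C := Module.finitePresentation_of_finite A C
  obtain ⟨k, h2, h3, h⟩ := Module.Flat.exists_factorization_of_finitePresentation
    (IsScalarTower.toAlgHom A C S).toLinearMap
  obtain ⟨t, ht⟩ := IsLocalization.exist_integer_multiples_of_finset P.primeCompl
    (Finset.univ.image fun j : Fin k => h3 (Finsupp.single j 1))
  have ht' : ∀ j, ∃ c : C, algebraMap C S c = (t : C) • h3 (Finsupp.single j 1) := by
    intro j
    exact ht _ (Finset.mem_image_of_mem _ (Finset.mem_univ j))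
  choose w hw using ht'
  obtain ⟨r, g, hg⟩ := Submodule.fg_iff_exists_fin_generating_family.mp
    (Module.Finite.fg_top (R := A) (M := C))
  have hall : ∀ c : C, algebraMap C S (t * c) = algebraMap C S (∑ j, h2 c j • w j) := by
    intro c
    have h4 : algebraMap C S c = h3 (h2 c) := by
      have := LinearMap.congr_fun h c
      simpa using this
    have h5 : h2 c = ∑ j, h2 c j • Finsupp.single j 1 := by
      ext i; simp [Finsupp.single_apply]
    rw [map_mul, h4, map_sum]
    conv_lhs => rw [h5]
    rw [map_sum, Finset.mul_sum]
    refine Finset.sum_congr rfl fun j _ => ?_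
    rw [map_smul, Algebra.smul_def, Algebra.smul_def, map_mul, hw, Algebra.smul_def,
      ← IsScalarTower.algebraMap_apply]
    ring
  have hex : ∀ i, ∃ u : P.primeCompl, (u : C) * (t * g i) = u * ∑ j, h2 (g i) j • w j :=
    fun i => IsLocalization.exists_of_eq (M := P.primeCompl) (hall (g i))
  choose u hu using hex
  let U : P.primeCompl := ∏ i, u i
  have hU : ∀ i, (U : C) * (t * g i) = U * ∑ j, h2 (g i) j • w j := by
    intro i
    have hd : u i ∣ U := Finset.dvd_prod_of_mem u (Finset.mem_univ i)
    obtain ⟨v, hv⟩ := hd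
    rw [hv, Submonoid.coe_mul, mul_comm (u i : C) v, mul_assoc, hu, mul_assoc]
  refine ⟨((U * t : P.primeCompl) : C), (U * t).2, k, fun j => Finsupp.lapply j ∘ₗ h2,
    fun j => U * w j, ?_⟩
  let L1 : C →ₗ[A] C := LinearMap.mulLeft A ((U * t : P.primeCompl) : C)
  let L2 : C →ₗ[A] C := ∑ j, (Finsupp.lapply j ∘ₗ h2).smulRight (U * w j)
  have hL : L1 = L2 := by
    refine LinearMap.ext_on_range (v := g) hg fun i => ?_
    simp only [L1, L2, LinearMap.mulLeft_apply, Submonoid.coe_mul, LinearMap.sum_apply,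
      LinearMap.smulRight_apply, LinearMap.comp_apply, Finsupp.lapply_apply]
    rw [mul_assoc, hU, Finset.mul_sum]
    exact Finset.sum_congr rfl fun j _ => by rw [mul_smul_comm]
  intro c
  have := LinearMap.congr_fun hL c
  simpa [L1, L2, mul_assoc] using this

end TT

end Piece21

section Piece22

open IsLocalRing

section DimT

variable {d : ℕ}

theorem RLS.dimq_le {A : Type*} [CommRing A] [IsLocalRing A] [IsNoetherianRing A] {X : Fin d → A}
    (hX : RLS X) (T : Finset (Fin d)) :
    ringKrullDim (A ⧸ Ideal.span (X '' (T : Set (Fin d)))) ≤ ((d - T.card : ℕ) : WithBot ℕ∞) := by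
  classical
  have hJ : Ideal.span (X '' (T : Set (Fin d))) ≤ maximalIdeal A := by
    rw [← hX.1]; exact Ideal.span_mono (Set.image_subset_range _ _)
  obtain ⟨hl, hm⟩ := quot_max _ hJ
  have h := dim_le_card (S := A ⧸ Ideal.span (X '' (T : Set (Fin d))))
    (s := (Tᶜ).image fun i => Ideal.Quotient.mk _ (X i)) (by
      rw [← hm, ← hX.1, Ideal.map_span, ← Set.range_comp]
      refine le_antisymm ?_ ?_
      · refine Ideal.span_mono ?_
        intro z hz
        simp only [Finset.coe_image, Set.mem_image] at hz
        obtain ⟨i, -, rfl⟩ := hz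
        exact ⟨i, rfl⟩
      · rw [Ideal.span_le]
        rintro _ ⟨i, rfl⟩
        by_cases hi : i ∈ T
        · have : (Ideal.Quotient.mk (Ideal.span (X '' (T : Set (Fin d)))) ∘ X) i = 0 := by
            rw [Function.comp_apply, Ideal.Quotient.eq_zero_iff_mem]
            exact Ideal.subset_span ⟨i, hi, rfl⟩
          rw [this]; exact Ideal.zero_mem _
        · refine Ideal.subset_span ?_
          simp only [Finset.coe_image, Set.mem_image]
          exact ⟨i, by simpa using hi, rfl⟩)
  refine h.trans ?_
  have : (Finset.image (fun i => Ideal.Quotient.mk (Ideal.span (X '' (T : Set (Fin d)))) (X i)) Tᶜ).card ≤ d - T.card := by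
    refine Finset.card_image_le.trans ?_
    rw [Finset.card_compl, Fintype.card_fin]
  exact_mod_cast this

variable {A C : Type*} [CommRing A] [IsLocalRing A] [IsNoetherianRing A] [CommRing C]
  [Algebra A C] [Module.Finite A C]

theorem dimq_comap (P : Ideal C) : ringKrullDim (C ⧸ P) ≤ ringKrullDim (A ⧸ P.comap (algebraMap A C)) := by
  have : Algebra.IsIntegral (A ⧸ P.comap (algebraMap A C)) (C ⧸ P) :=
    Ideal.Quotient.algebra_isIntegral_of_liesOver P (P.comap (algebraMap A C))
  exact dim_le_of_integral

theorem contr_eq {X : Fin d → A} (hX : RLS X) (T : Finset (Fin d)) (P : Ideal C) [P.IsPrime]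
    (hT : ∀ i ∈ T, algebraMap A C (X i) ∈ P)
    (hdim : ((d - T.card : ℕ) : WithBot ℕ∞) ≤ ringKrullDim (C ⧸ P)) :
    P.comap (algebraMap A C) = Ideal.span (X '' (T : Set (Fin d))) := by
  have hle : Ideal.span (X '' (T : Set (Fin d))) ≤ P.comap (algebraMap A C) := by
    rw [Ideal.span_le]; rintro _ ⟨i, hi, rfl⟩; exact hT i hi
  have hpr : (Ideal.span (X '' (T : Set (Fin d)))).IsPrime := hX.prime _
  by_contra hne
  have hlt := lt_of_le_of_ne hle (Ne.symm hne)
  rcases hn : d - T.card with _ | n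
  · have hu : T = Finset.univ := by
      rw [← Finset.card_eq_iff_eq_univ, Fintype.card_fin]
      have := Finset.card_le_univ T
      simp at this; omega
    subst hu
    rw [Finset.coe_univ, Set.image_univ, hX.1] at hlt
    exact not_le_of_gt hlt (le_maximalIdeal (Ideal.IsPrime.comap _).ne_top)
  · have h1 := hX.dimq_le T
    rw [hn] at h1
    have h2 := dimq_lt le_rfl n hlt h1
    have h3 := hdim.trans ((dimq_comap P).trans h2)
    rw [hn] at h3
    have h4 : n + 1 ≤ n := by exact_mod_cast h3
    omega

theorem min_eq {X : Fin d → A} (hX : RLS X) (T : Finset (Fin d)) (P : Ideal C) [P.IsPrime]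
    (hT : ∀ i ∈ T, algebraMap A C (X i) ∈ P)
    (hdim : ((d - T.card : ℕ) : WithBot ℕ∞) ≤ ringKrullDim (C ⧸ P))
    (P' : Ideal C) [P'.IsPrime] (hT' : ∀ i ∈ T, algebraMap A C (X i) ∈ P') (hle : P' ≤ P) :
    P' = P := by
  by_contra hne
  have hlt := lt_of_le_of_ne hle hne
  have h1 : P'.comap (algebraMap A C) < P.comap (algebraMap A C) :=
    Ideal.IsIntegral.comap_lt_comap hlt
  rw [contr_eq hX T P hT hdim] at h1
  refine not_le_of_gt h1 ?_
  rw [Ideal.span_le]; rintro _ ⟨i, hi, rfl⟩; exact hT' i hi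

theorem height_ge {X : Fin d → A} (hX : RLS X) (T : Finset (Fin d)) (P : Ideal C) [P.IsPrime]
    (hT : ∀ i ∈ T, algebraMap A C (X i) ∈ P)
    (hdim : ((d - T.card : ℕ) : WithBot ℕ∞) ≤ ringKrullDim (C ⧸ P)) 
    (P0 : Ideal C) [P0.IsPrime] (hle : P0 ≤ P) (h0 : (d : WithBot ℕ∞) ≤ ringKrullDim (C ⧸ P0)) :
    (T.card : ℕ∞) ≤ P.height := by
  classical
  have hdom := hX.isDomain
  have hic := hX.integrallyClosed
  have hk : P0.comap (algebraMap A C) = ⊥ := by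
    by_contra hne
    rcases d with _ | n
    · have := hX.1
      rw [Set.range_eq_empty, Ideal.span_empty] at this
      refine hne (le_bot_iff.1 ?_)
      rw [this]
      exact le_maximalIdeal (Ideal.IsPrime.comap _).ne_top
    · have h1 : ringKrullDim (A ⧸ (⊥ : Ideal A)) ≤ ((n + 1 : ℕ) : WithBot ℕ∞) := by
        rw [ringKrullDim_eq_of_ringEquiv (RingEquiv.quotientBot A), hX.dim]
      have h2 := dimq_lt (P := ⊥) le_rfl n (bot_lt_iff_ne_bot.2 hne) h1
      have h3 := h0.trans ((dimq_comap P0).trans h2)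
      have h4 : n + 1 ≤ n := by exact_mod_cast h3
      omega
  have hinj : Function.Injective (algebraMap A (C ⧸ P0)) := by
    rw [RingHom.injective_iff_ker_eq_bot, ← hk]
    ext a
    rw [RingHom.mem_ker, IsScalarTower.algebraMap_apply A C (C ⧸ P0), Ideal.Quotient.algebraMap_eq,
      Ideal.Quotient.eq_zero_iff_mem, Ideal.mem_comap]
  have hf : FaithfulSMul A (C ⧸ P0) := (faithfulSMul_iff_algebraMap_injective _ _).2 hinj
  have hinteg : Algebra.IsIntegral A (C ⧸ P0) := inferInstance
  have hgd : Algebra.HasGoingDown A (C ⧸ P0) := inferInstance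
  have hcC : IsNoetherianRing C := IsNoetherianRing.of_finite A C
  let PD := P.map (Ideal.Quotient.mk P0)
  have hPDc : PD.comap (Ideal.Quotient.mk P0) = P := by
    rw [Ideal.comap_map_of_surjective' _ Ideal.Quotient.mk_surjective, Ideal.mk_ker, sup_eq_left.2 hle]
  have hPD : PD.IsPrime := Ideal.map_isPrime_of_surjective Ideal.Quotient.mk_surjective (by
    rwa [Ideal.mk_ker])
  let J := Ideal.span (X '' (T : Set (Fin d)))
  have hJp : J.IsPrime := hX.prime _
  have hlo : PD.LiesOver J := ⟨by
    rw [Ideal.under_def, IsScalarTower.algebraMap_eq A C (C ⧸ P0), ← Ideal.comap_comap, 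
      Ideal.Quotient.algebraMap_eq, hPDc, contr_eq hX T P hT hdim]⟩
  have h1 := Ideal.height_eq_height_add_of_liesOver_of_hasGoingDown J PD
  have h2 : (T.card : ℕ∞) ≤ PD.height := by
    rw [h1]; exact (hX.height T).trans le_self_add
  refine h2.trans ?_
  change (⟨PD, hPD⟩ : PrimeSpectrum (C ⧸ P0)).asIdeal.height ≤ (⟨P, inferInstance⟩ : PrimeSpectrum C).asIdeal.height
  rw [PrimeSpectrum.height_eq_orderHeight, PrimeSpectrum.height_eq_orderHeight]
  have h3 := Order.height_le_height_apply_of_strictMono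
    (PrimeSpectrum.comap (Ideal.Quotient.mk P0)) (RingHom.strictMono_comap_of_surjective Ideal.Quotient.mk_surjective) ⟨PD, hPD⟩
  have h4 : PrimeSpectrum.comap (Ideal.Quotient.mk P0) ⟨PD, hPD⟩ = ⟨P, inferInstance⟩ := by
    ext1; exact hPDc
  rwa [h4] at h3

end DimT

end Piece22

section Piece23

open IsLocalRing

section FlatT

theorem flat_of_REG {A S : Type*} [CommRing A] [IsNoetherianRing A] [CommRing S] [IsLocalRing S]
    [IsNoetherianRing S] [Algebra A S] {h : ℕ} (y : Fin h → A)
    (hm : ∀ i, algebraMap A S (y i) ∈ maximalIdeal S)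
    (hreg : REG (fun i => algebraMap A S (y i)))
    (hu : ∀ f : A, f ∉ Ideal.span (Set.range y) → IsUnit (algebraMap A S f)) :
    Module.Flat A S := by
  classical
  have key : ∀ U : Finset (Fin h), FL S (Ideal.span (y '' ((Uᶜ : Finset (Fin h)) : Set (Fin h)))) := by
    intro U
    induction U using Finset.induction_on with
    | empty =>
      refine FL_base _ ?_
      simpa using hu
    | insert a U ha ih =>
      refine FL_step _ (y a) (hm a) ?_ ?_
      · intro u hu
        have hmap : (Ideal.span (y '' (((insert a U)ᶜ : Finset (Fin h)) : Set (Fin h)))).map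
            (algebraMap A S) = Ideal.span ((fun i => algebraMap A S (y i)) ''
              (((insert a U)ᶜ : Finset (Fin h)) : Set (Fin h))) := by
          rw [Ideal.map_span, Set.image_image]
        rw [hmap] at hu ⊢
        exact hreg.sub hm _ a (by simp) u hu
      · convert ih using 1
        rw [← Ideal.span_union]
        congr 1
        have : ((Uᶜ : Finset (Fin h)) : Set (Fin h)) =
            (((insert a U)ᶜ : Finset (Fin h)) : Set (Fin h)) ∪ {a} := by
          ext i
          by_cases hi : i = a
          · subst hi; simp [ha]
          · simp [hi]
        rw [this, Set.image_union, Set.image_singleton]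
  have := key Finset.univ
  rw [Finset.compl_univ, Finset.coe_empty, Set.image_empty, Ideal.span_empty] at this
  exact FL_flat this

theorem RLS.sop {S : Type*} [CommRing S] [IsLocalRing S] [IsNoetherianRing S] {d : ℕ}
    {x : Fin d → S} (h : RLS x) : IsSOP S x :=
  ⟨h.dim, by rw [h.1]; exact (inferInstance : (maximalIdeal S).IsPrime).radical⟩

theorem thmT_abs {d : ℕ} {A C S : Type*} [CommRing A] [IsLocalRing A] [IsNoetherianRing A]
    [CommRing C] [Algebra A C] [Module.Finite A C] {X : Fin d → A} (hX : RLS X)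
    (T : Finset (Fin d)) (P : Ideal C) [P.IsPrime]
    (hT : ∀ i ∈ T, algebraMap A C (X i) ∈ P)
    (hdim : ((d - T.card : ℕ) : WithBot ℕ∞) ≤ ringKrullDim (C ⧸ P))
    (P0 : Ideal C) [P0.IsPrime] (hle : P0 ≤ P) (h0 : (d : WithBot ℕ∞) ≤ ringKrullDim (C ⧸ P0))
    [CommRing S] [Algebra C S] [IsLocalization.AtPrime S P] [IsLocalRing S] [IsNoetherianRing S]
    {e : ℕ} {z : Fin e → S} (hz : RLS z) :
    ∃ b ∉ P, KK b (fun i => algebraMap A C (X i)) := by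
  classical
  have hcC : IsNoetherianRing C := IsNoetherianRing.of_finite A C
  let _ : Algebra A S := ((algebraMap C S).comp (algebraMap A C)).toAlgebra
  have _ : IsScalarTower A C S := IsScalarTower.of_algebraMap_eq fun _ => rfl
  let E := T.equivFin
  let y : Fin T.card → A := fun i => X (E.symm i : Fin d)
  have hyr : Set.range y = X '' (T : Set (Fin d)) := by
    ext a; constructor
    · rintro ⟨i, rfl⟩; exact ⟨_, (E.symm i).2, rfl⟩
    · rintro ⟨i, hi, rfl⟩; exact ⟨E ⟨i, hi⟩, by simp [y]⟩
  have hcomap : (maximalIdeal S).comap (algebraMap C S) = P :=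
    IsLocalization.AtPrime.under_maximalIdeal S P
  have hm : ∀ i, algebraMap A S (y i) ∈ maximalIdeal S := by
    intro i
    have : algebraMap A C (y i) ∈ (maximalIdeal S).comap (algebraMap C S) := by
      rw [hcomap]; exact hT _ (E.symm i).2
    exact this
  have hht1 := height_ge hX T P hT hdim P0 hle h0
  have hdS : ringKrullDim S = P.height := IsLocalization.AtPrime.ringKrullDim_eq_height P S
  have hrad : (Ideal.span (Set.range fun i => algebraMap A S (y i))).radical = maximalIdeal S := by
    refine le_antisymm ?_ ?_
    · rw [Ideal.IsPrime.radical_le_iff inferInstance, Ideal.span_le]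
      rintro _ ⟨i, rfl⟩; exact hm i
    · rw [Ideal.radical_eq_sInf]
      refine le_sInf ?_
      rintro N ⟨hN, hNp⟩
      have h1 : N.comap (algebraMap C S) ≤ P := by
        rw [← hcomap]; exact Ideal.comap_mono (le_maximalIdeal hNp.ne_top)
      have h2 : N.comap (algebraMap C S) = P := by
        refine min_eq hX T P hT hdim _ ?_ h1
        intro i hi
        have : algebraMap A S (X i) ∈ N := by
          refine hN (Ideal.subset_span ⟨E ⟨i, hi⟩, ?_⟩)
          simp [y]
        exact this
      have e1 : N.under C = (maximalIdeal S).under C := h2.trans hcomap.symm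
      rw [← IsLocalization.map_under P.primeCompl S N, e1,
        IsLocalization.map_under P.primeCompl S]
  have hht2 : ringKrullDim S ≤ T.card := by
    have h3 : maximalIdeal S ∈ (Ideal.span
        ((Finset.univ.image fun i => algebraMap A S (y i) : Finset S) : Set S)).minimalPrimes := by
      rw [Finset.coe_image, Finset.coe_univ, Set.image_univ]
      rw [← Ideal.radical_minimalPrimes, hrad,
        Ideal.minimalPrimes_eq_subsingleton_self]
      rfl
    have h4 := Ideal.height_le_card_of_mem_minimalPrimes_span_finset h3
    rw [← maximalIdeal_height_eq_ringKrullDim]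
    have h5 : (Finset.univ.image fun i => algebraMap A S (y i) : Finset S).card ≤ T.card := by
      refine Finset.card_image_le.trans ?_
      simp
    exact_mod_cast h4.trans (by exact_mod_cast h5)
  have hdim2 : ringKrullDim S = T.card := by
    refine le_antisymm hht2 ?_
    rw [hdS]; exact_mod_cast hht1
  have hsop : IsSOP S (fun i => algebraMap A S (y i)) := ⟨hdim2, hrad⟩
  have he : e = T.card := by
    have := hz.dim
    rw [hdim2] at this
    exact_mod_cast this.symm
  subst he
  have hreg : REG (fun i => algebraMap A S (y i)) := hz.reg.sop hz.sop hsop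
  have hflat : Module.Flat A S := by
    refine flat_of_REG y hm hreg ?_
    intro f hf
    rw [hyr, ← contr_eq hX T P hT hdim] at hf
    exact IsLocalization.map_units S (⟨algebraMap A C f, hf⟩ : P.primeCompl)
  obtain ⟨b, hb, k, β, w, h⟩ := exists_factor (A := A) (S := S) P
  exact ⟨b, hb, KK_of_factor hX.reg b β w h⟩

end FlatT

end Piece23

section Piece24

open IsLocalRing

section TTT

theorem exists_sop_in {C : Type*} [CommRing C] [IsLocalRing C] [IsNoetherianRing C]
    {d : ℕ} (hd : ringKrullDim C = d) (P : Ideal C) [P.IsPrime] :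
    ∃ y : Fin d → C, IsSOP C y ∧ ∃ T : Finset (Fin d), (∀ i ∈ T, y i ∈ P) ∧
      ((d - T.card : ℕ) : WithBot ℕ∞) ≤ ringKrullDim (C ⧸ P) := by
  classical
  have hle : ringKrullDim (C ⧸ P) ≤ d := by
    rw [← hd]; exact ringKrullDim_le_of_surjective _ Ideal.Quotient.mk_surjective
  obtain ⟨δ, hδ⟩ : ∃ δ : ℕ, ringKrullDim (C ⧸ P) = δ := by
    have hne : ringKrullDim (C ⧸ P) ≠ ⊥ := by
      have := ringKrullDim_nonneg_of_nontrivial (R := C ⧸ P)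
      intro hb
      rw [hb] at this
      exact absurd this (by simp)
    obtain ⟨a, ha⟩ := WithBot.ne_bot_iff_exists.1 hne
    rw [← ha] at hle ⊢
    have hle' : a ≤ (d : ℕ∞) := by exact_mod_cast hle
    obtain ⟨m, rfl⟩ := ENat.ne_top_iff_exists.1 (ne_top_of_le_ne_top (ENat.natCast_ne_top d) hle')
    exact ⟨m, rfl⟩
  rw [hδ] at hle
  have hle' : δ ≤ d := by exact_mod_cast hle
  obtain ⟨h, rfl⟩ := Nat.exists_eq_add_of_le hle'
  obtain ⟨y1, hy1, hy1d⟩ := avoid_iter (P := P) δ h (J := ⊥) bot_le (by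
    rw [ringKrullDim_eq_of_ringEquiv (RingEquiv.quotientBot C), hd]) hδ.le
  have hPm := le_maximalIdeal (inferInstance : P.IsPrime).ne_top
  obtain ⟨y2, hy2, hy2d⟩ := avoid_iter (P := maximalIdeal C) 0 δ (J := ⊥ ⊔ Ideal.span (Set.range y1))
    (by rw [bot_sup_eq, Ideal.span_le]; rintro _ ⟨i, rfl⟩; exact hPm (hy1 i)) (by
    rw [zero_add]; exact hy1d) (by
      have : IsField (C ⧸ maximalIdeal C) :=
        (Ideal.Quotient.maximal_ideal_iff_isField_quotient _).1 inferInstance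
      rw [ringKrullDim_eq_zero_of_isField this]; rfl)
  rw [bot_sup_eq] at hy2d
  let y : Fin (δ + h) → C := Fin.append y2 y1
  have hr : Ideal.span (Set.range y) = Ideal.span (Set.range y1) ⊔ Ideal.span (Set.range y2) := by
    rw [← Ideal.span_union]
    congr 1
    ext c; constructor
    · rintro ⟨i, rfl⟩
      refine Fin.addCases (fun j => ?_) (fun j => ?_) i
      · right; exact ⟨j, by simp [y]⟩
      · left; exact ⟨j, by simp [y]⟩
    · rintro (⟨j, rfl⟩ | ⟨j, rfl⟩)
      · exact ⟨Fin.natAdd δ j, by simp [y]⟩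
      · exact ⟨Fin.castAdd h j, by simp [y]⟩
  refine ⟨y, ⟨hd, ?_⟩, Finset.univ.image (Fin.natAdd δ), ?_, ?_⟩
  · refine dim_zero_radical ?_ (by rw [hr]; exact hy2d)
    rw [hr]
    refine sup_le ?_ ?_
    · rw [Ideal.span_le]; rintro _ ⟨i, rfl⟩; exact hPm (hy1 i)
    · rw [Ideal.span_le]; rintro _ ⟨i, rfl⟩; exact hy2 i
  · intro i hi
    obtain ⟨j, -, rfl⟩ := Finset.mem_image.1 hi
    simpa [y] using hy1 j
  · rw [Finset.card_image_of_injective _ (Fin.natAdd_injective _ _), hδ]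
    simp

theorem thmT {C : Type*} [CommRing C] [IsLocalRing C] [IsNoetherianRing C]
    [IsAdicComplete (maximalIdeal C) C] (p : ℕ) [Fact p.Prime] [CharP C p] {d : ℕ}
    (hd : ringKrullDim C = d) (hequi : IsEquidimensional C) (P : Ideal C) [P.IsPrime]
    {S : Type*} [CommRing S] [Algebra C S] [IsLocalization.AtPrime S P] [IsLocalRing S]
    [IsNoetherianRing S] {e : ℕ} {z : Fin e → S} (hz : RLS z) :
    ∃ y : Fin d → C, IsSOP C y ∧ ∃ b ∉ P, KK b y := by
  obtain ⟨y, hy, T, hT, hdim⟩ := exists_sop_in hd P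
  obtain ⟨φ, hφ⟩ := exists_coeff p C
  have hφ' : ∀ c : C, ∃ a, c - φ a ∈ maximalIdeal C := by
    intro c
    refine ⟨residue C c, ?_⟩
    rw [← residue_eq_zero_iff, map_sub, hφ, sub_self]
  obtain ⟨F, hF, hfin⟩ := cohen_finite φ hφ' y (pow_span_le hy.2) hy.mem
  let _ := F.toAlgebra
  have hmf : Module.Finite (MvPowerSeries (Fin d) (ResidueField C)) C := hfin
  have hn : IsNoetherianRing (MvPowerSeries (Fin d) (ResidueField C)) := mvps_noeth
  have hX : RLS (MvPowerSeries.X : Fin d → MvPowerSeries (Fin d) (ResidueField C)) := by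
    refine ⟨mvps_max, ?_⟩
    rw [← hd]
    exact dim_le_of_integral
  obtain ⟨P0, hP0, hle⟩ := Ideal.exists_minimalPrimes_le (bot_le : ⊥ ≤ P)
  have h0 : ringKrullDim (C ⧸ P0) = d := by rw [← hd]; exact hequi P0 hP0
  have hp0 : P0.IsPrime := hP0.1.1
  have hFy : (fun i => algebraMap _ C (MvPowerSeries.X i : MvPowerSeries (Fin d) (ResidueField C))) = y :=
    funext hF
  have := thmT_abs hX T P (by intro i hi; rw [show algebraMap _ C (MvPowerSeries.X i : MvPowerSeries (Fin d) (ResidueField C)) = y i from hF i]; exact hT i hi) hdim P0 hle h0.ge hz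
  rw [hFy] at this
  exact ⟨y, hy, this⟩

end TTT

end Piece24

section Piece25

open IsLocalRing

section CompletionTransport

variable {R R' : Type*} [CommRing R] [CommRing R']

theorem complMap_le (f : R →+* R') {I : Ideal R} {I' : Ideal R'} (h : I ≤ I'.comap f) (n : ℕ) :
    I ^ n ≤ (I' ^ n).comap f :=
  (Ideal.pow_right_mono h n).trans (Ideal.le_comap_pow f n)

theorem complMap_compat (f : R →+* R') {I : Ideal R} {I' : Ideal R'} (h : I ≤ I'.comap f)
    {m n : ℕ} (hle : m ≤ n) :
    (Ideal.Quotient.factorPow I' hle).comp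
      ((Ideal.quotientMap (I' ^ n) f (complMap_le f h n)).comp
        (AdicCompletion.evalₐ I n : AdicCompletion I R →+* R ⧸ I ^ n)) =
      (Ideal.quotientMap (I' ^ m) f (complMap_le f h m)).comp
        (AdicCompletion.evalₐ I m : AdicCompletion I R →+* R ⧸ I ^ m) := by
  ext x
  obtain ⟨c, rfl⟩ := AdicCompletion.mk_surjective I R x
  have h1 := c.2 hle
  have h2 : c.val n - c.val m ∈ I ^ m := by
    have := SModEq.sub_mem.1 h1.symm
    simpa using this
  simp only [RingHom.coe_comp, Function.comp_apply, RingHom.coe_coe, AdicCompletion.evalₐ_mk,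
    Ideal.quotientMap_mk]
  change Ideal.Quotient.mk (I' ^ m) (f (c.val n)) = _
  rw [Ideal.Quotient.eq, ← map_sub]
  exact complMap_le f h m h2

noncomputable def complMap (f : R →+* R') {I : Ideal R} {I' : Ideal R'} (h : I ≤ I'.comap f) :
    AdicCompletion I R →+* AdicCompletion I' R' :=
  AdicCompletion.liftRingHom I'
    (fun n => (Ideal.quotientMap (I' ^ n) f (complMap_le f h n)).comp
      (AdicCompletion.evalₐ I n : AdicCompletion I R →+* R ⧸ I ^ n)) (complMap_compat f h)

theorem evalₐ_complMap (f : R →+* R') {I : Ideal R} {I' : Ideal R'} (h : I ≤ I'.comap f) (n : ℕ)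
    (x : AdicCompletion I R) : AdicCompletion.evalₐ I' n (complMap f h x) =
      Ideal.quotientMap (I' ^ n) f (complMap_le f h n) (AdicCompletion.evalₐ I n x) := by
  unfold complMap
  rw [AdicCompletion.evalₐ_liftRingHom _ _ (complMap_compat f h)]
  rfl

theorem complMap_inv (e : R ≃+* R') {I : Ideal R} {I' : Ideal R'}
    (h : I ≤ I'.comap (e : R →+* R')) (h' : I' ≤ I.comap (e.symm : R' →+* R))
    (x : AdicCompletion I R) :
    complMap (e.symm : R' →+* R) h' (complMap (e : R →+* R') h x) = x := by
  refine AdicCompletion.ext_evalₐ fun n => ?_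
  rw [evalₐ_complMap, evalₐ_complMap]
  obtain ⟨r, hr⟩ := Ideal.Quotient.mk_surjective (AdicCompletion.evalₐ I n x)
  rw [← hr]
  simp

theorem compl_equiv (e : R ≃+* R') {I : Ideal R} {I' : Ideal R'}
    (h : I ≤ I'.comap (e : R →+* R')) (h' : I' ≤ I.comap (e.symm : R' →+* R)) :
    Nonempty (AdicCompletion I R ≃+* AdicCompletion I' R') :=
  ⟨RingEquiv.ofBijective (complMap (e : R →+* R') h)
    ⟨Function.LeftInverse.injective (complMap_inv e h h'),
      Function.RightInverse.surjective (complMap_inv e.symm h' h)⟩⟩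

theorem IsEquidimensional.equiv (e : R ≃+* R') (h : IsEquidimensional R) :
    IsEquidimensional R' := by
  intro P hP
  have hQ : P.comap (e : R →+* R') ∈ minimalPrimes R := by
    refine ⟨⟨Ideal.comap_isPrime _ _ (H := hP.1.1), bot_le⟩, fun J hJ hJP => ?_⟩
    have := hJ.1
    have h1 : (J.comap (e.symm : R' →+* R)) ≤ P := by
      intro a ha
      have := hJP ha
      rw [Ideal.mem_comap] at this
      exact (e.apply_symm_apply a) ▸ this
    have h2 := hP.2 ⟨Ideal.comap_isPrime (e.symm : R' →+* R) J, bot_le⟩ h1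
    intro a ha
    have := h2 ha
    simpa using this
  have h1 := h _ hQ
  rw [← ringKrullDim_eq_of_ringEquiv e, ← h1]
  refine (ringKrullDim_eq_of_ringEquiv (Ideal.quotientEquiv _ _ e ?_)).symm
  exact (Ideal.map_comap_of_surjective _ e.surjective P).symm

theorem atPrime_max_bij (R : Type*) [CommRing R] [IsLocalRing R] :
    Function.Bijective (algebraMap R (Localization.AtPrime (maximalIdeal R))) := by
  have : ∀ s : (maximalIdeal R).primeCompl, IsUnit (s : R) := fun s => by
    have := s.2
    by_contra h
    exact this ((mem_maximalIdeal _).2 h)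
  exact (IsLocalization.atUnits R (maximalIdeal R).primeCompl
    (S := Localization.AtPrime (maximalIdeal R)) fun a ha => this ⟨a, ha⟩).bijective

theorem atPrime_max_equidim (R : Type*) [CommRing R] [IsLocalRing R]
    (h : IsEquidimensional (AdicCompletion (maximalIdeal R) R)) :
    IsEquidimensional (AdicCompletion (maximalIdeal (Localization.AtPrime (maximalIdeal R)))
      (Localization.AtPrime (maximalIdeal R))) := by
  let e := RingEquiv.ofBijective _ (atPrime_max_bij R)
  obtain ⟨E⟩ := compl_equiv e (I := maximalIdeal R)
    (I' := maximalIdeal (Localization.AtPrime (maximalIdeal R)))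
    (fun a ha => by
      rw [Ideal.mem_comap, mem_maximalIdeal, mem_nonunits_iff] at *
      simpa using ha) (fun a ha => by
      rw [Ideal.mem_comap, mem_maximalIdeal, mem_nonunits_iff] at *
      simpa using ha)
  exact h.equiv E

end CompletionTransport

end Piece25

section Piece26

open IsLocalRing

section GRing
open TensorProduct

theorem min_localization_max {R : Type*} [CommRing R] [IsReduced R] (q : Ideal R)
    (hq : q ∈ minimalPrimes R) [q.IsPrime] : maximalIdeal (Localization.AtPrime q) = ⊥ := by
  have hs := IsLocalization.subsingleton_primeSpectrum_of_mem_minimalPrimes q hq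
    (Localization.AtPrime q)
  have hr : IsReduced (Localization.AtPrime q) :=
    inferInstance
  rw [eq_bot_iff, ← (nilradical_eq_bot_iff.2 hr), nilradical_eq_sInf]
  refine le_sInf fun J hJ => ?_
  have := congrArg PrimeSpectrum.asIdeal (Subsingleton.elim
    (⟨maximalIdeal (Localization.AtPrime q), inferInstance⟩ : PrimeSpectrum _) ⟨J, hJ⟩)
  exact this.le

theorem min_residue {R : Type*} [CommRing R] [IsReduced R] (q : Ideal R)
    (hq : q ∈ minimalPrimes R) [q.IsPrime] :
    IsLocalization q.primeCompl (ResidueField (Localization.AtPrime q)) := by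
  have h := min_localization_max q hq
  let f : Localization.AtPrime q →ₐ[R] ResidueField (Localization.AtPrime q) :=
    IsScalarTower.toAlgHom R _ _
  have hf : Function.Bijective f := by
    constructor
    · rw [injective_iff_map_eq_zero]
      intro a ha
      have : a ∈ maximalIdeal (Localization.AtPrime q) :=
        (IsLocalRing.residue_eq_zero_iff a).1 ha
      rw [h] at this
      exact this
    · exact IsLocalRing.residue_surjective
  exact IsLocalization.isLocalization_of_algEquiv q.primeCompl (AlgEquiv.ofBijective f hf)

attribute [local instance] Algebra.TensorProduct.rightAlgebra in
theorem fiber_loc {R C K : Type u} [CommRing R] [CommRing C] [Algebra R C] [Field K] [Algebra R K]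
    (M : Submonoid R) [IsLocalization M K] :
    ∃ g : C →+* K ⊗[K] (K ⊗[R] C), letI := g.toAlgebra;
      IsLocalization (Algebra.algebraMapSubmonoid C M) (K ⊗[K] (K ⊗[R] C)) := by
  let e : K ⊗[K] (K ⊗[R] C) ≃ₐ[K] (K ⊗[R] C) := Algebra.TensorProduct.lid K _
  let g : C →+* K ⊗[K] (K ⊗[R] C) := (e.symm : _ →+* _).comp
    (algebraMap C (K ⊗[R] C))
  refine ⟨g, ?_⟩
  let := g.toAlgebra
  let E : (K ⊗[R] C) ≃ₐ[C] K ⊗[K] (K ⊗[R] C) :=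
    AlgEquiv.ofRingEquiv (f := e.symm.toRingEquiv) (fun r => rfl)
  have := IsLocalization.tensorRight (S := C) K M
  exact IsLocalization.isLocalization_of_algEquiv (Algebra.algebraMapSubmonoid C M) E

theorem loc_regular {C W : Type u} [CommRing C] [CommRing W] [Algebra C W] (M : Submonoid C)
    [IsLocalization M W] (hW : IsRegularRing_stmt14 W)
    (P : Ideal C) [hP : P.IsPrime] (hd : Disjoint (M : Set C) P) :
    ∃ (S : Type u) (_ : CommRing S) (_ : Algebra C S) (_ : IsLocalization.AtPrime S P)
      (_ : IsLocalRing S) (_ : IsNoetherianRing S) (e : ℕ) (z : Fin e → S), RLS z := by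
  have h1 := IsLocalization.isPrime_of_isPrime_disjoint M W P hP hd
  have h2 : (P.map (algebraMap C W)).comap (algebraMap C W) = P :=
    IsLocalization.under_map_of_isPrime_disjoint M W hP hd
  obtain ⟨h3, h4, e, z, h5, h6⟩ := hW.2 _ h1
  have h7 : IsLocalization.AtPrime (Localization.AtPrime (P.map (algebraMap C W)))
      ((P.map (algebraMap C W)).comap (algebraMap C W)) :=
    IsLocalization.isLocalization_isLocalization_atPrime_isLocalization M _ _
  refine ⟨Localization.AtPrime (P.map (algebraMap C W)), inferInstance, inferInstance, ?_,
    inferInstance, h4, e, z, ?_, h5.ge⟩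
  · simpa only [h2] using h7
  · rw [h6]
    exact IsLocalRing.jacobson_eq_maximalIdeal ⊥ bot_ne_top

theorem fiber_regular {R C : Type u} [CommRing R] [IsReduced R] [CommRing C] [Algebra R C]
    (q : Ideal R) (hq : q ∈ minimalPrimes R) [q.IsPrime]
    (hG : IsGeometricallyRegular (ResidueField (Localization.AtPrime q))
      ((ResidueField (Localization.AtPrime q)) ⊗[R] C))
    (P : Ideal C) [P.IsPrime] (hP : P.comap (algebraMap R C) = q) :
    ∃ (S : Type u) (_ : CommRing S) (_ : Algebra C S) (_ : IsLocalization.AtPrime S P)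
      (_ : IsLocalRing S) (_ : IsNoetherianRing S) (e : ℕ) (z : Fin e → S), RLS z := by
  have := min_residue q hq
  obtain ⟨g, hg⟩ := fiber_loc (C := C) (K := ResidueField (Localization.AtPrime q)) q.primeCompl
  have hW := hG (ResidueField (Localization.AtPrime q)) inferInstance
  let := g.toAlgebra
  refine loc_regular (W := ResidueField (Localization.AtPrime q) ⊗[ResidueField
    (Localization.AtPrime q)] (ResidueField (Localization.AtPrime q) ⊗[R] C))
    (Algebra.algebraMapSubmonoid C q.primeCompl) hW P ?_
  rw [Set.disjoint_left]
  rintro _ ⟨s, hs, rfl⟩ h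
  exact hs (hP ▸ h)

end GRing

end Piece26

section Piece27

open IsLocalRing

section UniformC

theorem dim_compl {R C : Type*} [CommRing R] [IsLocalRing R] [IsNoetherianRing R] [CommRing C]
    [IsLocalRing C] [IsNoetherianRing C] [Algebra R C] [Module.Flat R C]
    (hmax : (maximalIdeal R).map (algebraMap R C) = maximalIdeal C) :
    ringKrullDim C = ringKrullDim R := by
  have hlo : (maximalIdeal C).LiesOver (maximalIdeal R) := ⟨by
    refine (maximalIdeal.isMaximal R).eq_of_le ?_ ?_
    · exact Ideal.comap_ne_top _ (maximalIdeal.isMaximal C).ne_top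
    · rw [Ideal.under_def, ← hmax]; exact Ideal.le_comap_map⟩
  have h1 := Ideal.height_eq_height_add_of_liesOver_of_hasGoingDown (maximalIdeal R) (maximalIdeal C)
  have h2 : ((maximalIdeal C).map (Ideal.Quotient.mk
      ((maximalIdeal R).map (algebraMap R C)))) = ⊥ := by
    rw [hmax, Ideal.map_quotient_self]
  have : IsDomain (C ⧸ (maximalIdeal R).map (algebraMap R C)) := by
    rw [hmax]; infer_instance
  rw [h2, Ideal.height_bot, add_zero] at h1
  rw [← maximalIdeal_height_eq_ringKrullDim, ← maximalIdeal_height_eq_ringKrullDim, h1]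

theorem IsSOP.compl {R C : Type*} [CommRing R] [IsLocalRing R] [IsNoetherianRing R] [CommRing C]
    [IsLocalRing C] [IsNoetherianRing C] [Algebra R C] [Module.Flat R C]
    (hmax : (maximalIdeal R).map (algebraMap R C) = maximalIdeal C) {d : ℕ} {x : Fin d → R}
    (hx : IsSOP R x) : IsSOP C (fun i => algebraMap R C (x i)) := by
  refine ⟨(dim_compl hmax).trans hx.1, ?_⟩
  have h1 : Ideal.span (Set.range fun i => algebraMap R C (x i)) =
      (Ideal.span (Set.range x)).map (algebraMap R C) := by
    rw [Ideal.map_span, ← Set.range_comp]; rfl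
  obtain ⟨N, hN⟩ := pow_span_le hx.2
  rw [h1]
  apply le_antisymm
  · rw [(maximalIdeal.isMaximal C).isPrime.radical_le_iff, ← hmax]
    exact Ideal.map_mono (hx.2 ▸ Ideal.le_radical)
  · intro a ha
    refine ⟨N, Ideal.map_mono hN ?_⟩
    rw [Ideal.map_pow, hmax]
    exact Ideal.pow_mem_pow ha N

theorem PS_map {R C : Type*} [CommRing R] [CommRing C] [Algebra R C] {d : ℕ} (x : Fin d → R)
    (s : Fin d → ℕ) (T : Set (Fin d)) :
    PS (fun i => algebraMap R C (x i)) s T = (PS x s T).map (algebraMap R C) := by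
  unfold PS
  rw [Ideal.map_span]
  congr 1
  ext z
  constructor
  · rintro ⟨j, hj, rfl⟩
    exact ⟨_, ⟨j, hj, rfl⟩, by simp⟩
  · rintro ⟨_, ⟨j, hj, rfl⟩, rfl⟩
    exact ⟨j, hj, by simp⟩

theorem KK.contract {R C : Type*} [CommRing R] [CommRing C] [Algebra R C]
    [Module.FaithfullyFlat R C] {d : ℕ} {x : Fin d → R} {c : R}
    (h : KK (algebraMap R C c) (fun i => algebraMap R C (x i))) : KK c x := by
  intro i s n u hu
  have h1 := h i s n (algebraMap R C u) (by
    rw [PS_map, ← map_pow, ← map_mul]; exact Ideal.mem_map_of_mem _ hu)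
  rw [PS_map, ← map_mul, ← Ideal.mem_comap, Ideal.comap_map_eq_self_of_faithfullyFlat] at h1
  exact h1

theorem avoid_min {R : Type*} [CommRing R] [IsNoetherianRing R] (𝔠 : Ideal R)
    (h : ∀ q ∈ minimalPrimes R, ¬ 𝔠 ≤ q) : ∃ c ∈ 𝔠, ∀ q ∈ minimalPrimes R, c ∉ q := by
  by_contra hc
  push Not at hc
  have hF : (minimalPrimes R).Finite := minimalPrimes.finite_of_isNoetherianRing R
  have := (Ideal.subset_union_prime_finite hF (f := id) (I := 𝔠) ⊥ ⊥
    (fun q hq _ _ => hq.1.1)).1 (fun c hcc => by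
      obtain ⟨q, hq, h⟩ := hc c hcc
      simp only [Set.mem_iUnion]
      exact ⟨q, hq, h⟩)
  obtain ⟨q, hq, hle⟩ := this
  exact h q hq hle

theorem uniform_c {R C : Type*} [CommRing R] [IsLocalRing R] [IsNoetherianRing R] [CommRing C]
    [IsLocalRing C] [IsNoetherianRing C] [Algebra R C] [Module.FaithfullyFlat R C]
    (hmax : (maximalIdeal R).map (algebraMap R C) = maximalIdeal C) {d : ℕ} {x : Fin d → R}
    (hx : IsSOP R x)
    (H : ∀ P : Ideal C, P.IsPrime → P.comap (algebraMap R C) ∈ minimalPrimes R →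
      ∃ y : Fin d → C, IsSOP C y ∧ ∃ b ∉ P, KK b y) :
    ∃ c : R, (∀ q ∈ minimalPrimes R, c ∉ q) ∧ KK c x := by
  have hx' := hx.compl hmax
  let 𝔞 : Ideal C :=
    { carrier := {b | KK b (fun i => algebraMap R C (x i))}
      zero_mem' := fun i s n u _ => by simp
      add_mem' := fun h h' => h.add h'
      smul_mem' := fun c b h => h.mul c }
  obtain ⟨c, hc, hc'⟩ := avoid_min (𝔞.comap (algebraMap R C)) (fun q hq hle => by
    have hqp : q.IsPrime := hq.1.1
    obtain ⟨P, hP, h1, h2⟩ := Ideal.exists_le_prime_disjoint 𝔞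
      (Algebra.algebraMapSubmonoid C q.primeCompl) (by
        rw [Set.disjoint_left]
        rintro _ ha ⟨s, hs, rfl⟩
        exact hs (hle ha))
    have h3 : P.comap (algebraMap R C) ≤ q := by
      intro a ha
      by_contra haq
      exact Set.disjoint_left.1 h2 ha ⟨a, haq, rfl⟩
    have h4 : P.comap (algebraMap R C) = q :=
      le_antisymm h3 (hq.2 ⟨Ideal.comap_isPrime _ _, bot_le⟩ h3)
    obtain ⟨y, hy, b, hb, hk⟩ := H P hP (h4 ▸ hq)
    obtain ⟨N, hN⟩ := KK.sop hy hx' hk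
    exact hb (hP.mem_of_pow_mem N (h1 hN)))
  exact ⟨c, hc', KK.contract hc⟩

theorem excellent_c {R : Type u} [CommRing R] [IsLocalRing R] [IsNoetherianRing R] [IsReduced R]
    (p : ℕ) [Fact p.Prime] [CharP R p] (hG : IsGRing R)
    (hequi : IsEquidimensional (AdicCompletion (maximalIdeal R) R))
    {d : ℕ} {x : Fin d → R} (hx : IsSOP R x) :
    ∃ c : R, (∀ q ∈ minimalPrimes R, c ∉ q) ∧ KK c x := by
  let R' := Localization.AtPrime (maximalIdeal R)
  let C := AdicCompletion (maximalIdeal R') R'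
  have hbij : Function.Bijective (algebraMap R R') := atPrime_max_bij R
  have : IsNoetherianRing R' := IsLocalization.isNoetherianRing (maximalIdeal R).primeCompl _ ‹_›
  have : IsNoetherianRing C := completion_noeth R' (maximalIdeal R')
  have : IsAdicComplete (maximalIdeal C) C := completion_complete'
  have h1 : Module.Flat R' C := AdicCompletion.flat_of_isNoetherian _
  have h2 : Module.FaithfullyFlat R' C := Module.FaithfullyFlat.of_flat_of_isLocalHom
  have : IsLocalHom (algebraMap R R') := ⟨fun a ha => by
    have := (MulEquiv.isUnit_map (RingEquiv.ofBijective _ hbij)).1 ha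
    exact this⟩
  have h3 : Module.FaithfullyFlat R R' := Module.FaithfullyFlat.of_flat_of_isLocalHom
  have h4 : Module.FaithfullyFlat R C := Module.FaithfullyFlat.trans R R' C
  have hmax : (maximalIdeal R).map (algebraMap R C) = maximalIdeal C := by
    rw [IsScalarTower.algebraMap_eq R R' C, ← Ideal.map_map,
      Localization.AtPrime.map_eq_maximalIdeal, AdicCompletion.maximalIdeal_eq_map]
  have hinj : Function.Injective (algebraMap R C) := FaithfulSMul.algebraMap_injective R C
  have : CharP C p := charP_of_injective_algebraMap hinj p
  have hd : ringKrullDim C = d := (dim_compl hmax).trans hx.1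
  have hred : IsReduced R' := inferInstance
  refine uniform_c hmax hx fun P hP hPm => ?_
  have hq : P.comap (algebraMap R' C) ∈ minimalPrimes R' := by
    refine ⟨⟨Ideal.comap_isPrime _ _, bot_le⟩, fun J hJ hJle => ?_⟩
    have := hJ.1
    have h5 := hPm.2 (y := J.comap (algebraMap R R')) ⟨Ideal.comap_isPrime _ _, bot_le⟩ (by
      rw [IsScalarTower.algebraMap_eq R R' C, ← Ideal.comap_comap]
      exact Ideal.comap_mono hJle)
    intro a ha
    obtain ⟨a, rfl⟩ := hbij.2 a
    refine h5 (x := a) ?_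
    rw [Ideal.mem_comap, IsScalarTower.algebraMap_apply R R' C]
    exact ha
  have hqp : (P.comap (algebraMap R' C)).IsPrime := Ideal.comap_isPrime _ _
  obtain ⟨S, _, _, _, _, _, e, z, hz⟩ := fiber_regular (R := R') (C := C)
    (P.comap (algebraMap R' C)) hq (hG (maximalIdeal R) inferInstance _ hqp) P rfl
  exact thmT p hd (atPrime_max_equidim R hequi) P hz

end UniformC

end Piece27

section Piece28

open IsLocalRing

section TCExchange

variable {R B : Type*} [CommRing R] [CommRing B] [Algebra R B] {d : ℕ}

theorem span_split (t : Fin d → R) (s : Fin d → ℕ) (k : Fin d) :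
    Ideal.span (Set.range fun j => t j ^ s j) = Ideal.span {t k ^ s k} ⊔ PS t s {k}ᶜ := by
  rw [← PS_insert]
  unfold PS
  congr 1
  ext z
  constructor
  · rintro ⟨j, rfl⟩
    refine ⟨j, ?_, rfl⟩
    by_cases h : j = k
    · exact Or.inl h
    · exact Or.inr h
  · rintro ⟨j, -, rfl⟩
    exact ⟨j, rfl⟩

theorem tc_exchange [IsLocalRing R] [IsNoetherianRing R] {y : Fin d → R} (k : Fin d) (w : R)
    (hy : IsSOP R y) (hw : IsSOP R (Function.update y k w))
    (hB : REG (fun j => algebraMap R B (Function.update y k w j)))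
    (hR : REG (Function.update y k w))
    (h : IB B (Ideal.span (Set.range (Function.update y k w))) 1 ≤
      Ideal.span (Set.range (Function.update y k w))) :
    IB B (Ideal.span (Set.range y)) 1 ≤ Ideal.span (Set.range y) := by
  classical
  intro a ha
  set u := Function.update y k w with hu
  have huk : u k = w := by simp [hu]
  have huj : ∀ j, j ≠ k → u j = y j := fun j hj => by simp [hu, hj]
  let I : Ideal R := PS y 1 {k}ᶜ
  have e1 : Ideal.span (Set.range y) = Ideal.span {y k} ⊔ I := by
    simpa using span_split y 1 k
  obtain ⟨N, hN⟩ := pow_span_le hy.2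
  have hwN : w ^ N ∈ Ideal.span (Set.range y) :=
    hN (Ideal.pow_mem_pow (huk ▸ hw.mem k) N)
  have e2 : PS u (Function.update 1 k N) {k}ᶜ = I := by
    change Ideal.span _ = Ideal.span _
    congr 1
    ext z
    constructor
    · rintro ⟨j, hj, rfl⟩
      exact ⟨j, hj, by simp [huj j hj, Function.update_of_ne hj]⟩
    · rintro ⟨j, hj, rfl⟩
      exact ⟨j, hj, by simp [huj j hj, Function.update_of_ne hj]⟩
  have e3 : Ideal.span (Set.range fun j => u j ^ (Function.update (1 : Fin d → ℕ) k N) j) =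
      Ideal.span {w ^ N} ⊔ I := by
    rw [span_split _ _ k, e2]; simp [huk]
  have e4 : {z | ∃ j, j ≠ k ∧ z = u j ^ (Function.update (1 : Fin d → ℕ) k N) j} =
      {z | ∃ j, j ∈ ({k}ᶜ : Set (Fin d)) ∧ z = u j ^ (Function.update (1 : Fin d → ℕ) k N) j} := rfl
  rw [e1] at hwN
  obtain ⟨v0, hv0, v, hv, hvw⟩ := Submodule.mem_sup.1 hwN
  obtain ⟨r, rfl⟩ := Ideal.mem_span_singleton'.1 hv0
  have ha' : algebraMap R B a ∈ (Ideal.span (Set.range y)).map (algebraMap R B) := by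
    have : a ∈ ((Ideal.span (Set.range y) ^ 1).map (algebraMap R B)).comap (algebraMap R B) := ha
    rwa [pow_one] at this
  rw [e1, Ideal.map_sup, Ideal.map_span, Set.image_singleton] at ha'
  obtain ⟨b0, hb0, ν, hν, hba⟩ := Submodule.mem_sup.1 ha'
  obtain ⟨β, rfl⟩ := Ideal.mem_span_singleton'.1 hb0
  have h1 : algebraMap R B (r * a) ∈ Ideal.span (Set.range fun j => algebraMap R B (u j) ^
      (Function.update (1 : Fin d → ℕ) k N) j) := by
    have e5 : Ideal.span (Set.range fun j => algebraMap R B (u j) ^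
      (Function.update (1 : Fin d → ℕ) k N) j) = (Ideal.span {w ^ N} ⊔ I).map (algebraMap R B) := by
      rw [← e3, Ideal.map_span, ← Set.range_comp]
      congr 2
      ext j; simp
    rw [e5, Ideal.map_sup]
    have e6 : algebraMap R B (r * a) = β * algebraMap R B (w ^ N) +
        (algebraMap R B r * ν - β * algebraMap R B v) := by
      rw [← hvw, map_mul, ← hba, map_add, map_mul]; ring
    rw [e6]
    refine Ideal.add_mem _ (Ideal.mem_sup_left (Ideal.mul_mem_left _ _
      (Ideal.mem_map_of_mem _ (Ideal.mem_span_singleton_self _)))) (Ideal.mem_sup_right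
      (Ideal.sub_mem _ (Ideal.mul_mem_left _ _ hν) (Ideal.mul_mem_left _ _
        (Ideal.mem_map_of_mem _ hv))))
  have h2 := contr_pow hB h _ _ h1
  rw [e3] at h2
  obtain ⟨g0, hg0, i, hi, hgi⟩ := Submodule.mem_sup.1 h2
  obtain ⟨g, rfl⟩ := Ideal.mem_span_singleton'.1 hg0
  have h3 : r * (a - g * y k) ∈ I := by
    have : r * (a - g * y k) = g * v + i := by
      rw [mul_sub, ← hgi, ← hvw]; ring
    rw [this]
    exact Ideal.add_mem _ (Ideal.mul_mem_left _ _ hv) hi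
  have h4 : a - g * y k ∈ I := by
    have := hR.pow k (Function.update (1 : Fin d → ℕ) k N) N (a - g * y k)
    rw [e4] at this
    change _ ∈ PS u (Function.update 1 k N) {k}ᶜ → _ ∈ PS u (Function.update 1 k N) {k}ᶜ at this
    rw [e2, huk] at this
    apply this
    have e7 : w ^ N * (a - g * y k) = y k * (r * (a - g * y k)) + (a - g * y k) * v := by
      rw [← hvw]; ring
    rw [e7]
    exact Ideal.add_mem _ (Ideal.mul_mem_left _ _ h3) (Ideal.mul_mem_left _ _ hv)
  rw [e1]
  have : a = g * y k + (a - g * y k) := by ring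
  rw [this]
  exact Ideal.add_mem _ (Ideal.mem_sup_left (Ideal.mul_mem_left _ _
    (Ideal.mem_span_singleton_self _))) (Ideal.mem_sup_right h4)

theorem tc_sop [IsLocalRing R] [IsNoetherianRing R]
    (hB : ∀ y : Fin d → R, IsSOP R y → REG (fun j => algebraMap R B (y j)))
    {x y : Fin d → R} (hx : IsSOP R x) (hy : IsSOP R y)
    (h : IB B (Ideal.span (Set.range x)) 1 ≤ Ideal.span (Set.range x)) :
    IB B (Ideal.span (Set.range y)) 1 ≤ Ideal.span (Set.range y) := by
  classical
  have hR : ∀ z : Fin d → R, IsSOP R z → REG z := fun z hz =>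
    REG.sop hx hz (contr_REG hx.mem (hB x hx) h)
  induction hn : (Finset.univ.filter fun i => x i ≠ y i).card using Nat.strong_induction_on
    generalizing x y with
  | _ n ih =>
  by_cases hxy : x = y
  · subst hxy; exact h
  obtain ⟨k, hk⟩ := Function.ne_iff.1 hxy
  obtain ⟨w, hw1, hw2⟩ := exists_common hx hy k
  have e : Function.update (Function.update x k w) k (x k) = x := by simp
  have h1 := tc_exchange (B := B) (y := Function.update x k w) k (x k) hw1 (by rwa [e])
    (by rw [e]; exact hB x hx) (by rw [e]; exact hR x hx) (by rwa [e])
  have hlt : (Finset.univ.filter fun i => Function.update x k w i ≠ Function.update y k w i).card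
      < n := by
    rw [← hn]
    refine Finset.card_lt_card ⟨?_, ?_⟩
    · intro i hi
      simp only [Finset.mem_filter, Finset.mem_univ, true_and] at hi ⊢
      by_cases hik : i = k
      · subst hik; exact hk
      · simpa [hik] using hi
    · intro hh
      have := hh (Finset.mem_filter.2 ⟨Finset.mem_univ k, hk⟩)
      simp at this
  have h2 := ih _ hlt hw1 hw2 h1 rfl
  exact tc_exchange k w hy hw2 (hB _ hw2) (hR _ hw2) h2

end TCExchange

end Piece28

section Piece29

open IsLocalRing

section TightAlgebra

/-- Elements outside all minimal primes. -/
def RCirc (R : Type*) [CommRing R] : Submonoid R where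
  carrier := {c | ∀ P ∈ minimalPrimes R, c ∉ P}
  one_mem' := fun _ hP h => hP.1.1.ne_top ((Ideal.eq_top_iff_one _).2 h)
  mul_mem' := fun ha hb P hP h => (hP.1.1.mem_or_mem h).elim (ha P hP) (hb P hP)

/-- Sequences that are eventually a constant in `RCirc R`. -/
def NCirc (R : Type*) [CommRing R] : Submonoid (ℕ → R) where
  carrier := {g | ∃ c ∈ RCirc R, ∃ E : ℕ, ∀ e ≥ E, g e = c}
  one_mem' := ⟨1, one_mem _, 0, fun _ _ => rfl⟩
  mul_mem' := by
    rintro a b ⟨c, hc, E, h⟩ ⟨c', hc', E', h'⟩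
    exact ⟨c * c', mul_mem hc hc', max E E', fun e he => by
      rw [Pi.mul_apply, h e (le_trans (le_max_left _ _) he), h' e (le_trans (le_max_right _ _) he)]⟩

/-- The algebra computing tight closure as contracted extension. -/
def TB (R : Type*) [CommRing R] (_p : ℕ) : Type _ := Localization (NCirc R)

variable (R : Type*) [CommRing R] (p : ℕ)

noncomputable instance : CommRing (TB R p) := inferInstanceAs (CommRing (Localization (NCirc R)))

noncomputable def tbLoc : (ℕ → R) →+* TB R p := algebraMap (ℕ → R) (Localization (NCirc R))

theorem tbLoc_surj (b : TB R p) : ∃ (g n : ℕ → R), IsUnit (tbLoc R p n) ∧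
    tbLoc R p n * b = tbLoc R p g := by
  obtain ⟨g, n, h⟩ := IsLocalization.exists_mk'_eq (NCirc R) (S := Localization (NCirc R)) b
  refine ⟨g, n, IsLocalization.map_units (Localization (NCirc R)) n, ?_⟩
  have := IsLocalization.mk'_spec' (Localization (NCirc R)) g n
  rw [h] at this
  exact this

variable [Fact p.Prime] [CharP R p]

noncomputable def tbFrob : R →+* (ℕ → R) := RingHom.pi fun e => iterateFrobenius R p e

theorem tbFrob_apply (a : R) (e : ℕ) : tbFrob R p a e = a ^ p ^ e := by
  change iterateFrobenius R p e a = _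
  rw [iterateFrobenius_def]

noncomputable instance : Algebra R (TB R p) := ((tbLoc R p).comp (tbFrob R p)).toAlgebra

theorem tb_algebraMap (a : R) : algebraMap R (TB R p) a = tbLoc R p (tbFrob R p a) := rfl

theorem tb_mem {ι : Type*} [Fintype ι] (t : ι → R) (g : ℕ → R) :
    tbLoc R p g ∈ Ideal.span (Set.range fun j => algebraMap R (TB R p) (t j)) ↔
      ∃ c ∈ RCirc R, ∃ E : ℕ, ∀ e ≥ E, c * g e ∈ Ideal.span (Set.range fun j => t j ^ p ^ e) := by
  have e1 : Ideal.span (Set.range fun j => algebraMap R (TB R p) (t j)) =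
      (Ideal.span (Set.range fun j => tbFrob R p (t j))).map (tbLoc R p) := by
    rw [Ideal.map_span, ← Set.range_comp]; rfl
  rw [e1]
  change algebraMap (ℕ → R) (Localization (NCirc R)) g ∈ 
    Ideal.map (algebraMap (ℕ → R) (Localization (NCirc R))) _ ↔ _
  rw [IsLocalization.algebraMap_mem_map_algebraMap_iff (NCirc R)]
  constructor
  · rintro ⟨m, ⟨c, hc, E, hE⟩, hm⟩
    refine ⟨c, hc, E, fun e he => ?_⟩
    have := Ideal.mem_map_of_mem (Pi.evalRingHom (fun _ : ℕ => R) e) hm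
    rw [Ideal.map_span, ← Set.range_comp] at this
    have e2 : (Pi.evalRingHom (fun _ : ℕ => R) e) ∘ (fun j => tbFrob R p (t j)) =
        fun j => t j ^ p ^ e := by
      funext j; exact tbFrob_apply R p (t j) e
    rw [e2] at this
    rw [← hE e he]
    exact this
  · rintro ⟨c, hc, E, hE⟩
    classical
    refine ⟨fun e => if E ≤ e then c else 0, ⟨c, hc, E, fun e he => if_pos he⟩, ?_⟩
    have h1 : ∀ e, ∃ r : ι → R, ∑ j, r j * t j ^ p ^ e = (if E ≤ e then c else 0) * g e := by
      intro e
      split_ifs with h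
      · obtain ⟨r, hr⟩ := Submodule.mem_span_range_iff_exists_fun R |>.1 (hE e h)
        exact ⟨r, by simpa using hr⟩
      · exact ⟨0, by simp⟩
    choose r hr using h1
    refine Submodule.mem_span_range_iff_exists_fun _ |>.2 ⟨fun j e => r e j, ?_⟩
    funext e
    simp [tbFrob_apply, hr]

theorem tb_contr [IsNoetherianRing R] (I : Ideal R) :
    (contractedExt R (algebraMap R (TB R p)) I : Set R) = tightClSet R p I := by
  obtain ⟨S, rfl⟩ := IsNoetherian.noetherian I
  have e1 : (Submodule.span R (S : Set R)) = Ideal.span (Set.range fun j : S => (j : R)) := by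
    simp [Ideal.span]
  rw [e1]
  ext a
  have e2 : (Ideal.span (Set.range fun j : S => (j : R))).map (algebraMap R (TB R p)) =
      Ideal.span (Set.range fun j : S => algebraMap R (TB R p) j) := by
    rw [Ideal.map_span, ← Set.range_comp]; rfl
  change algebraMap R (TB R p) a ∈ Ideal.map _ _ ↔ _
  rw [e2, tb_algebraMap, tb_mem]
  have e3 : ∀ e : ℕ, Ideal.span ((fun a => a ^ p ^ e) ''
      (Ideal.span (Set.range fun j : S => (j : R)) : Set R)) =
      Ideal.span (Set.range fun j : S => (j : R) ^ p ^ e) := by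
    intro e
    have : Ideal.map (iterateFrobenius R p e) (Ideal.span (Set.range fun j : S => (j : R))) =
      Ideal.span (Set.range fun j : S => (j : R) ^ p ^ e) := by
      rw [Ideal.map_span, ← Set.range_comp]
      congr 2
    rw [← this, Ideal.map]
    congr 2
  simp only [tightClSet, Set.mem_ofPred_eq, e3, tbFrob_apply]
  rfl

theorem tb_REG {d : ℕ} {y : Fin d → R} {c : R} (hc : c ∈ RCirc R) (h : KK c y) :
    REG (fun j => algebraMap R (TB R p) (y j)) := by
  classical
  intro i s b hb
  have e1 : Ideal.span {z | ∃ j, j ≠ i ∧ z = algebraMap R (TB R p) (y j) ^ s j} =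
      Ideal.span (Set.range fun j : {j // j ≠ i} => algebraMap R (TB R p) (y j ^ s j)) := by
    congr 1
    ext z
    constructor
    · rintro ⟨j, hj, rfl⟩; exact ⟨⟨j, hj⟩, by simp⟩
    · rintro ⟨⟨j, hj⟩, rfl⟩; exact ⟨j, hj, by simp⟩
  rw [e1] at hb ⊢
  beta_reduce at hb
  obtain ⟨g, n, hu, e2⟩ := tbLoc_surj R p b
  rw [← Ideal.unit_mul_mem_iff_mem _ hu, e2, tb_mem]
  have h2 := Ideal.mul_mem_left _ (tbLoc R p n) hb
  rw [mul_left_comm, e2, tb_algebraMap, ← map_mul, tb_mem] at h2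
  obtain ⟨c', hc', E, hE⟩ := h2
  refine ⟨c * c', mul_mem hc hc', E, fun e he => ?_⟩
  have e3 : Ideal.span (Set.range fun j : {j // j ≠ i} => (y j ^ s j) ^ p ^ e) =
      PS y (fun j => s j * p ^ e) {i}ᶜ := by
    unfold PS
    congr 1
    ext z
    constructor
    · rintro ⟨⟨j, hj⟩, rfl⟩; exact ⟨j, hj, by simp [pow_mul]⟩
    · rintro ⟨j, hj, rfl⟩; exact ⟨⟨j, hj⟩, by simp [pow_mul]⟩
  have h3 := hE e he
  rw [e3] at h3 ⊢
  rw [mul_assoc]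
  refine h i _ (p ^ e) _ ?_
  rw [Pi.mul_apply, tbFrob_apply, mul_left_comm] at h3
  exact h3

end TightAlgebra

end Piece29

section Piece30

open IsLocalRing

section Part2

theorem rcirc_compl {R C : Type*} [CommRing R] [CommRing C] [Algebra R C] [Module.Flat R C]
    {c : R} (hc : c ∈ RCirc R) (P : Ideal C) (hP : P ∈ minimalPrimes C) :
    algebraMap R C c ∉ P := by
  intro h
  have hPp : P.IsPrime := hP.1.1
  obtain ⟨q, hq, hle⟩ := Ideal.exists_minimalPrimes_le (I := (⊥ : Ideal R))
    (J := P.comap (algebraMap R C)) bot_le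
  have hqp : q.IsPrime := hq.1.1
  have : P.LiesOver (P.comap (algebraMap R C)) := ⟨rfl⟩
  obtain ⟨P', hP', h1, h2⟩ := Ideal.exists_ideal_le_liesOver_of_le (p := q)
    (q := P.comap (algebraMap R C)) P hle
  have h3 : P ≤ P' := hP.2 ⟨h1, bot_le⟩ hP'
  refine hc q hq ?_
  rw [h2.over]
  exact h3 h

theorem tight_chev {R : Type*} [CommRing R] [IsLocalRing R] [IsNoetherianRing R]
    (p : ℕ) [Fact p.Prime] [CharP R p]
    (hred : IsReduced (AdicCompletion (maximalIdeal R) R)) (Q : Ideal R)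
    (hQ : Q.radical = maximalIdeal R) (n : ℕ) : ∃ k, IB (TB R p) Q k ≤ maximalIdeal R ^ n := by
  have := completion_noeth R (maximalIdeal R)
  have := completion_complete' (R := R)
  have h1 : Module.Flat R (AdicCompletion (maximalIdeal R) R) :=
    AdicCompletion.flat_of_isNoetherian _
  have h2 : Module.FaithfullyFlat R (AdicCompletion (maximalIdeal R) R) :=
    Module.FaithfullyFlat.of_flat_of_isLocalHom
  have hinj : Function.Injective (algebraMap R (AdicCompletion (maximalIdeal R) R)) :=
    FaithfulSMul.algebraMap_injective _ _
  have : CharP (AdicCompletion (maximalIdeal R) R) p := charP_of_injective_algebraMap hinj p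
  refine chev_main (C := AdicCompletion (maximalIdeal R) R)
    AdicCompletion.maximalIdeal_eq_map.symm completion_contr Q
    (hQ ▸ Ideal.le_radical) (IB (TB R p) Q) (fun a b h => IB_anti Q h) ?_ n
  intro s y hy P hP hyP
  obtain ⟨S, hS⟩ := (IsNoetherian.noetherian (IB (TB R p) Q s) : (IB (TB R p) Q s).FG)
  have h3 : ∀ a : S, ∃ c ∈ RCirc R, ∃ E : ℕ, ∀ e ≥ E, c * (a : R) ^ p ^ e ∈ Q ^ (s * p ^ e) := by
    intro a
    have ha : (a : R) ∈ IB (TB R p) Q s := hS ▸ Ideal.subset_span a.2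
    have ha2 : (a : R) ∈ tightClSet R p (Q ^ s) := by
      rw [← tb_contr]; exact ha
    obtain ⟨c, hc, E, hE⟩ := ha2
    refine ⟨c, hc, E, fun e he => ?_⟩
    refine (Ideal.span_le.2 ?_) (hE e he)
    rintro _ ⟨b, hb, rfl⟩
    rw [pow_mul]
    exact Ideal.pow_mem_pow hb _
  choose c hc E hE using h3
  refine ⟨algebraMap R _ (∏ a, c a), rcirc_compl (prod_mem fun a _ => hc a) P hP, fun t => ?_⟩
  let e := t + ∑ a, E a
  have he : ∀ a, E a ≤ e := fun a =>
    (Finset.single_le_sum (f := E) (fun _ _ => Nat.zero_le _) (Finset.mem_univ a)).trans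
      (Nat.le_add_left _ _)
  refine ⟨p ^ e, ?_, ?_⟩
  · exact (Nat.le_add_right _ _).trans (Nat.lt_pow_self (Fact.out : p.Prime).one_lt).le
  · rw [← hS] at hy
    change y ∈ Ideal.map _ (Ideal.span _) at hy
    rw [Ideal.map_span] at hy
    clear hyP
    classical
    induction hy using Submodule.span_induction with
    | mem z hz =>
      obtain ⟨a, ha, rfl⟩ := hz
      rw [← Ideal.map_pow, ← map_pow, ← map_mul]
      apply Ideal.mem_map_of_mem
      rw [← Finset.mul_prod_erase Finset.univ c (Finset.mem_univ ⟨a, ha⟩), mul_right_comm]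
      exact Ideal.mul_mem_right _ _ (hE ⟨a, ha⟩ e (he _))
    | zero =>
      rw [zero_pow (pow_pos (Fact.out : p.Prime).pos _).ne', mul_zero]
      exact Ideal.zero_mem _
    | add u v _ _ hu hv =>
      rw [add_pow_char_pow, mul_add]
      exact Ideal.add_mem _ hu hv
    | smul r u _ hu =>
      rw [smul_eq_mul, mul_pow, mul_left_comm]
      exact Ideal.mul_mem_left _ _ hu

theorem part2 (R : Type u) [CommRing R] [IsLocalRing R] (p : ℕ) (hp : p.Prime) [CharP R p]
    (hex : IsExcellentRing R)
    (hred : IsReduced (AdicCompletion (maximalIdeal R) R))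
    (hequi : IsEquidimensional (AdicCompletion (maximalIdeal R) R))
    (d : ℕ) (hd : ringKrullDim R = (d : WithBot ℕ∞)) (Q : Ideal R) (hQ : IsParameterIdeal R Q)
    (Jstar : ℕ → Ideal R) (hJ : ∀ n, (Jstar n : Set R) = tightClSet R p (Q ^ n))
    (estar e : ℕ → ℤ) (h1 : HasHilbertSeries R d Jstar estar)
    (h2 : HasHilbertSeries R d (fun n => Q ^ n) e) (h3 : estar 1 = e 1) : IsFRational R p := by
  have : IsNoetherianRing R := hex.1
  have : Fact p.Prime := ⟨hp⟩
  have hsop : ∀ {d' : ℕ} {y : Fin d' → R}, IsSOP R y → d' = d := fun hy => by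
    have := hy.1.symm.trans hd
    exact_mod_cast this
  obtain ⟨d', x, hx, rfl⟩ := hQ
  obtain rfl := hsop hx
  have hfl : Module.Flat R (AdicCompletion (maximalIdeal R) R) :=
    AdicCompletion.flat_of_isNoetherian _
  have hff : Module.FaithfullyFlat R (AdicCompletion (maximalIdeal R) R) :=
    Module.FaithfullyFlat.of_flat_of_isLocalHom
  have : IsReduced R := isReduced_of_injective
    (algebraMap R (AdicCompletion (maximalIdeal R) R)) (FaithfulSMul.algebraMap_injective _ _)
  obtain ⟨c, hc, hK⟩ := excellent_c p hex.2.1 hequi hx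
  have hB : ∀ y : Fin d' → R, IsSOP R y → REG (fun j => algebraMap R (TB R p) (y j)) := by
    intro y hy
    obtain ⟨N, hN⟩ := hK.sop hx hy
    exact tb_REG R p (pow_mem (S := RCirc R) (M := R) hc N) hN
  have hJ' : Jstar = IB (TB R p) (Ideal.span (Set.range x)) := by
    funext n
    apply SetLike.coe_injective
    rw [hJ n, ← tb_contr]; rfl
  obtain ⟨N, hN⟩ := pow_span_le hx.2
  have hcore := core x (hB x hx) ⟨N, hN⟩ (fun n => by
    obtain ⟨k, hk⟩ := tight_chev p hred _ hx.2 (N * n)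
    refine ⟨k, hk.trans ?_⟩
    rw [pow_mul]
    exact Ideal.pow_right_mono hN n) estar e (hJ' ▸ h1) h2 h3
  rintro Q' ⟨d'', y, hy, rfl⟩
  obtain rfl := hsop hy
  have h4 := tc_sop hB hx hy hcore
  intro a ha
  apply h4
  change a ∈ contractedExt R (algebraMap R (TB R p)) (Ideal.span (Set.range y) ^ 1)
  rw [pow_one]
  change a ∈ (contractedExt R (algebraMap R (TB R p)) (Ideal.span (Set.range y)) : Set R)
  rw [tb_contr]
  exact ha

end Part2

end Piece30

/-- **Proposition 3.9.** If `R̂` is reduced and equidimensional, `B` is a balanced big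
Cohen–Macaulay `R`-algebra satisfying (†), and `e₁^B(Q) = e₁(Q)` for some parameter
ideal `Q`, then `R` is `BCM_B`-rational. In particular, if `R` is excellent of
characteristic `p > 0` and `e₁*(Q) = e₁(Q)` for some parameter ideal `Q`, then `R` is
`F`-rational. -/
theorem stmt14 :
    (∀ (R : Type u) [CommRing R] [IsLocalRing R] [IsNoetherianRing R]
        (d : ℕ), ringKrullDim R = (d : WithBot ℕ∞) →
      IsReduced (AdicCompletion (maximalIdeal R) R) →
      IsEquidimensional (AdicCompletion (maximalIdeal R) R) →
      ∀ (B : Type u) [CommRing B] [Algebra R B],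
        IsBalancedBigCM R B → SatisfiesDagger R (algebraMap R B) →
      ∀ Q : Ideal R, IsParameterIdeal R Q →
      ∀ eB e : ℕ → ℤ,
        HasHilbertSeries R d (fun n => contractedExt R (algebraMap R B) (Q ^ n)) eB →
        HasHilbertSeries R d (fun n => Q ^ n) e →
        eB 1 = e 1 →
        IsBCMRational R B d) ∧
    (∀ (R : Type u) [CommRing R] [IsLocalRing R] (p : ℕ), p.Prime → ∀ [CharP R p],
      IsExcellentRing R →
      IsReduced (AdicCompletion (maximalIdeal R) R) →
      IsEquidimensional (AdicCompletion (maximalIdeal R) R) →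
      ∀ (d : ℕ), ringKrullDim R = (d : WithBot ℕ∞) →
      ∀ Q : Ideal R, IsParameterIdeal R Q →
      ∀ (Jstar : ℕ → Ideal R), (∀ n, (Jstar n : Set R) = tightClSet R p (Q ^ n)) →
      ∀ estar e : ℕ → ℤ,
        HasHilbertSeries R d Jstar estar →
        HasHilbertSeries R d (fun n => Q ^ n) e →
        estar 1 = e 1 →
        IsFRational R p) := by
  refine ⟨?_, ?_⟩
  · intro R _ _ _ d hd hred _ B _ _ hB hdag Q hQ eB e h1 h2 h3
    exact part1 R d hd hred B hB hdag Q hQ eB e h1 h2 h3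
  · intro R _ _ p hp _ hex hred hequi d hd Q hQ Jstar hJ estar e h1 h2 h3
    exact part2 R p hp hex hred hequi d hd Q hQ Jstar hJ estar e h1 h2 h3
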